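/- For the braid arrangement, the Bernstein ideal B(A) ⊆ ℂ[(s_{i,j})_{1 ≤ i < j ≤ n}] is the principal ideal generated by ∏_{I ⊆ {1,…,n}, card I ≥ 2} ∏_{k=0}^{(card I − 1)(card I − 2)} ( (∑_{i<j, i,j ∈ I} s_{i,j}) + card I − 1 + k ). -/

import Mathlib

open MvPolynomial

namespace Arrangement

variable {n : ℕ} {ι : Type} [Fintype ι]

/-- The module `D(A)` of logarithmic derivations of the arrangement defined by
the forms `l i`. -/
noncomputable def DA (l : ι → MvPolynomial (Fin n) ℂ) :
    Submodule (MvPolynomial (Fin n) ℂ)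
      (Derivation ℂ (MvPolynomial (Fin n) ℂ) (MvPolynomial (Fin n) ℂ)) where
  carrier := {χ | ∀ i, χ (l i) ∈ Ideal.span {l i}}
  add_mem' := fun hx hy i => by
    simpa using add_mem (hx i) (hy i)
  zero_mem' := fun i => by simp
  smul_mem' := fun r χ hχ i => by
    simpa using Ideal.mul_mem_left _ r (hχ i)

open Classical in
/-- The property characterizing the family of twisted derivatives
`D i = ∂/∂xᵢ + ∑ⱼ sⱼ (∂lⱼ/∂xᵢ)/lⱼ` acting on the localization
`M = ℂ[x,s,1/F]·l^s`. -/
def IsTwisted (l : ι → MvPolynomial (Fin n) ℂ)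
    (D : Fin n → Module.End ℂ
      (Localization.Away (rename Sum.inl (∏ i, l i) : MvPolynomial (Fin n ⊕ ι) ℂ))) : Prop :=
  (∀ (i : Fin n) (r : MvPolynomial (Fin n ⊕ ι) ℂ)
      (m : Localization.Away (rename Sum.inl (∏ i, l i) : MvPolynomial (Fin n ⊕ ι) ℂ)),
      D i (algebraMap _ _ r * m)
        = algebraMap _ _ (pderiv (Sum.inl i) r) * m + algebraMap _ _ r * D i m) ∧
  (∀ i : Fin n,
      algebraMap (MvPolynomial (Fin n ⊕ ι) ℂ) _ (rename Sum.inl (∏ j, l j)) * D i 1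
        = algebraMap _ _ (∑ j, X (Sum.inr j) *
            rename Sum.inl (pderiv i (l j) * ∏ k ∈ Finset.univ.erase j, l k)))

/-- The algebra `W` of operators on `M`, image of the Weyl algebra
`Aₙ(ℂ)[s₁,…,s_p]` acting on `ℂ[x,s,1/F]·l^s`. -/
noncomputable def Wa (l : ι → MvPolynomial (Fin n) ℂ)
    (D : Fin n → Module.End ℂ
      (Localization.Away (rename Sum.inl (∏ i, l i) : MvPolynomial (Fin n ⊕ ι) ℂ))) :
    Subalgebra ℂ (Module.End ℂ
      (Localization.Away (rename Sum.inl (∏ i, l i) : MvPolynomial (Fin n ⊕ ι) ℂ))) :=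
  Algebra.adjoin ℂ
    ((Set.range fun i : Fin n =>
        LinearMap.mulLeft ℂ (algebraMap _ _ (X (Sum.inl i) : MvPolynomial (Fin n ⊕ ι) ℂ))) ∪
     (Set.range fun j : ι =>
        LinearMap.mulLeft ℂ (algebraMap _ _ (X (Sum.inr j) : MvPolynomial (Fin n ⊕ ι) ℂ))) ∪
     Set.range D)

/-- The Bernstein ideal `B(A)`, as the set of polynomials `b(s₁,…,s_p)` such that
`b · l^s = P · l^{s+1}` for some operator `P` in the Weyl algebra. -/
noncomputable def Bideal (l : ι → MvPolynomial (Fin n) ℂ)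
    (D : Fin n → Module.End ℂ
      (Localization.Away (rename Sum.inl (∏ i, l i) : MvPolynomial (Fin n ⊕ ι) ℂ))) :
    Set (MvPolynomial ι ℂ) :=
  {b | ∃ P ∈ Wa l D,
    algebraMap (MvPolynomial (Fin n ⊕ ι) ℂ) _ ((rename Sum.inr b : MvPolynomial (Fin n ⊕ ι) ℂ))
      = P (algebraMap _ _ (rename Sum.inl (∏ i, l i) : MvPolynomial (Fin n ⊕ ι) ℂ))}

/-- The linear functional on `ℂⁿ` associated to a linear form. -/
noncomputable def toLin (f : MvPolynomial (Fin n) ℂ) : (Fin n → ℂ) →ₗ[ℂ] ℂ :=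
  ∑ i, f.coeff (Finsupp.single i 1) • LinearMap.proj i

/-- The hyperplane `ker lᵢ ⊆ ℂⁿ`. -/
noncomputable def hyp (l : ι → MvPolynomial (Fin n) ℂ) (i : ι) : Submodule ℂ (Fin n → ℂ) :=
  LinearMap.ker (toLin (l i))

open Classical in
/-- The intersection lattice `L(A)`: all intersections of nonempty subfamilies. -/
noncomputable def LA (l : ι → MvPolynomial (Fin n) ℂ) : Finset (Submodule ℂ (Fin n → ℂ)) :=
  (Finset.univ.powerset.filter Finset.Nonempty).image fun I : Finset ι => ⨅ i ∈ I, hyp l i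

open Classical in
/-- `J(X) = {i : X ⊆ ker lᵢ}`. -/
noncomputable def JX (l : ι → MvPolynomial (Fin n) ℂ) (Y : Submodule ℂ (Fin n → ℂ)) :
    Finset ι :=
  Finset.univ.filter fun i => Y ≤ hyp l i

/-- `r(X) = n - dim X`, the codimension. -/
noncomputable def rX (Y : Submodule ℂ (Fin n → ℂ)) : ℕ :=
  n - Module.finrank ℂ Y

/-- Irreducibility of the subarrangement with hyperplanes indexed by `J`. -/
def IrredOn (l : ι → MvPolynomial (Fin n) ℂ) (J : Finset ι) : Prop :=
  ¬ ∃ V₁ V₂ : Submodule ℂ (Fin n → ℂ), IsCompl V₁ V₂ ∧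
      (∀ i ∈ J, V₁ ≤ hyp l i ∨ V₂ ≤ hyp l i) ∧
      (∃ i ∈ J, V₁ ≤ hyp l i) ∧ (∃ i ∈ J, V₂ ≤ hyp l i)

open Classical in
/-- `L'(A) = {X ∈ L(A) : A_X irreducible}`. -/
noncomputable def Lprime (l : ι → MvPolynomial (Fin n) ℂ) :
    Finset (Submodule ℂ (Fin n → ℂ)) :=
  (LA l).filter fun Y => IrredOn l (JX l Y)

/-- The polynomial
`b_A = ∏_{X ∈ L'(A)} ∏_{j=0}^{2(card J(X) − r(X))} ((∑_{i ∈ J(X)} sᵢ) + r(X) + j)`. -/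
noncomputable def bGen (l : ι → MvPolynomial (Fin n) ℂ) : MvPolynomial ι ℂ :=
  ∏ Y ∈ Lprime l, ∏ j ∈ Finset.range (2 * ((JX l Y).card - rX (n := n) Y) + 1),
    ((∑ i ∈ JX l Y, X i) + C ((rX (n := n) Y : ℂ) + (j : ℂ)))

end Arrangement

namespace Arrangement

/-- The index set of pairs `(i,j)` with `1 ≤ i < j ≤ n`. -/
abbrev BraidIdx (n : ℕ) : Type := {q : Fin n × Fin n // q.1 < q.2}

/-- The linear forms `l_{i,j} = xᵢ − xⱼ` of the braid arrangement. -/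
noncomputable def braidForm (n : ℕ) (q : BraidIdx n) : MvPolynomial (Fin n) ℂ :=
  X q.1.1 - X q.1.2

/-- The generator
`∏_{I ⊆ {1,…,n}, card I ≥ 2} ∏_{k=0}^{(card I − 1)(card I − 2)}
((∑_{i<j, i,j ∈ I} s_{i,j}) + card I − 1 + k)` of the Bernstein ideal of the braid
arrangement. -/
noncomputable def braidGen (n : ℕ) : MvPolynomial (BraidIdx n) ℂ :=
  ∏ I ∈ Finset.univ.powerset.filter (fun I : Finset (Fin n) => 2 ≤ I.card),
    ∏ k ∈ Finset.range ((I.card - 1) * (I.card - 2) + 1),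
      ((∑ q ∈ Finset.univ.filter (fun q : BraidIdx n => q.1.1 ∈ I ∧ q.1.2 ∈ I), X q)
        + C (((I.card : ℂ) - 1) + (k : ℂ)))

end Arrangement

namespace Arrangement

/-- The polynomial ring in the coordinates and in the exponents. -/
abbrev BA (n : ℕ) : Type := MvPolynomial (Fin n ⊕ BraidIdx n) ℂ

/-- The polynomial ring in the exponents. -/
abbrev SR (n : ℕ) : Type := MvPolynomial (BraidIdx n) ℂ

variable {n : ℕ}

/-- The coordinate `x_a`. -/
noncomputable def xv (a : Fin n) : BA n := X (Sum.inl a)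

/-- The exponents, as a symmetric function of the two indices. -/
noncomputable def sv (a b : Fin n) : SR n :=
  if h : a < b then X ⟨(a, b), h⟩ else if h : b < a then X ⟨(b, a), h⟩ else 0

/-- The inclusion of the ring of exponents. -/
noncomputable def rho (n : ℕ) : SR n →ₐ[ℂ] BA n := rename Sum.inr

/-- The defining polynomial of the braid arrangement. -/
noncomputable def braidF (n : ℕ) : BA n := rename Sum.inl (∏ q : BraidIdx n, braidForm n q)

/-- The partial derivative with respect to `x_a`. -/
noncomputable def dd (a : Fin n) : Derivation ℂ (BA n) (BA n) := pderiv (Sum.inl a)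

theorem sv_symm (a b : Fin n) : (sv a b : SR n) = sv b a := by
  unfold sv
  rcases lt_trichotomy a b with h | h | h
  · simp [h, h.not_gt]
  · subst h; simp
  · simp [h, h.not_gt]

@[simp] theorem sv_self (a : Fin n) : (sv a a : SR n) = 0 := by simp [sv]

theorem sv_of_lt {a b : Fin n} (h : a < b) : (sv a b : SR n) = X ⟨(a, b), h⟩ := by simp [sv, h]

@[simp] theorem dd_xv (a b : Fin n) : dd a (xv b) = if a = b then 1 else 0 := by
  unfold dd xv
  rw [pderiv_X]
  by_cases h : a = b
  · subst h; simp
  · have : (Sum.inl a : Fin n ⊕ BraidIdx n) ≠ Sum.inl b := by simpa using h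
    rw [if_neg h, Pi.single_eq_of_ne]
    simpa using (Ne.symm h)

@[simp] theorem dd_rho (a : Fin n) (c : SR n) : dd a (rho n c) = 0 := by
  unfold dd rho
  induction c using MvPolynomial.induction_on with
  | C r => simp
  | add p q hp hq => rw [map_add, map_add, hp, hq, add_zero]
  | mul_X p q hp =>
    rw [map_mul, Derivation.leibniz, hp]
    simp [rename_X, pderiv_X]

theorem dd_comm (a b : Fin n) (r : BA n) : dd a (dd b r) = dd b (dd a r) := by
  have h : ⁅dd a, dd b⁆ = (0 : Derivation ℂ (BA n) (BA n)) := by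
    apply MvPolynomial.derivation_ext
    intro i
    rw [Derivation.commutator_apply]
    unfold dd
    rw [pderiv_X, pderiv_X]
    simp only [Pi.single_apply]
    split_ifs <;> simp
  have := congrArg (fun d : Derivation ℂ (BA n) (BA n) => d r) h
  rw [Derivation.commutator_apply] at this
  simpa [sub_eq_zero] using this

theorem braidF_eq : braidF n = ∏ q : BraidIdx n, (xv q.1.1 - xv q.1.2) := by
  simp [braidF, braidForm, xv, map_prod]

theorem xv_sub_ne_zero {a b : Fin n} (h : a ≠ b) : (xv a - xv b : BA n) ≠ 0 := by
  rw [sub_ne_zero]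
  intro h'
  apply h
  have := X_injective (R := ℂ) h'
  simpa using this

theorem braidF_ne_zero : braidF n ≠ 0 := by
  rw [braidF_eq]
  exact Finset.prod_ne_zero_iff.mpr fun q _ => xv_sub_ne_zero q.2.ne

theorem xv_sub_dvd_braidF {a b : Fin n} (h : a ≠ b) : (xv a - xv b : BA n) ∣ braidF n := by
  have key : ∀ q : BraidIdx n, (xv q.1.1 - xv q.1.2 : BA n) ∣ braidF n := fun q => by
    rw [braidF_eq]
    exact Finset.dvd_prod_of_mem _ (Finset.mem_univ q)
  rcases lt_or_gt_of_ne h with h | h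
  · exact key ⟨(a, b), h⟩
  · have := key ⟨(b, a), h⟩
    rwa [← neg_dvd, neg_sub] at this

theorem sum_braidIdx {M : Type*} [AddCommMonoid M] (f : BraidIdx n → M) :
    ∑ q, f q = ∑ i, ∑ j, if h : i < j then f ⟨(i, j), h⟩ else 0 := by
  set g : Fin n × Fin n → M := fun q => if h : q.1 < q.2 then f ⟨q, h⟩ else 0 with hg
  have h1 : ∀ q : BraidIdx n, f q = g q.1 := fun q => by rw [hg]; simp [q.2]
  have h2 : ∑ q : BraidIdx n, g q.1 = ∑ q ∈ Finset.univ.filter (fun q : Fin n × Fin n =>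
      q.1 < q.2), g q := (Finset.sum_subtype _ (by simp) g).symm
  rw [Finset.sum_congr rfl fun q _ => h1 q, h2, Finset.sum_filter, ← Finset.sum_product',
    Finset.univ_product_univ]
  refine Finset.sum_congr rfl fun q _ => ?_
  by_cases h : q.1 < q.2 <;> simp [h, hg]

variable {L : Type} [CommRing L] [Algebra (BA n) L]

/-- The inverse of `x_a - x_b`, and zero for `a = b`. -/
noncomputable def uv (L : Type) [CommRing L] [Algebra (BA n) L] (a b : Fin n) : L :=
  Ring.inverse (algebraMap (BA n) L (xv a - xv b))

/-- The module generated by `F` over the twisted Weyl algebra. -/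
structure Setting (D : Fin n → L →+ L) (E : Submodule (BA n) L) : Prop where
  loc : IsLocalization.Away (braidF n) L
  leib : ∀ a r m, D a (algebraMap (BA n) L r * m)
    = algebraMap (BA n) L (dd a r) * m + algebraMap (BA n) L r * D a m
  one : ∀ a, D a 1 = ∑ b, algebraMap (BA n) L (rho n (sv a b)) * uv L a b
  memF : algebraMap (BA n) L (braidF n) ∈ E
  memD : ∀ a, ∀ m ∈ E, D a m ∈ E
  min : ∀ E' : Submodule (BA n) L, algebraMap (BA n) L (braidF n) ∈ E' →
    (∀ a, ∀ m ∈ E', D a m ∈ E') → E ≤ E'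

local notation "φ" => algebraMap (BA n) L

theorem uv_symm (a b : Fin n) : uv L b a = - uv L a b := by
  unfold uv
  rw [← neg_sub, map_neg]
  by_cases h : IsUnit (φ (xv a - xv b))
  · obtain ⟨u, hu⟩ := h
    rw [← hu, ← Units.val_neg, Ring.inverse_unit, Ring.inverse_unit, inv_neg, Units.val_neg]
  · rw [Ring.inverse_non_unit _ h, Ring.inverse_non_unit, neg_zero]
    rwa [IsUnit.neg_iff]

namespace Setting

variable {D : Fin n → L →+ L} {E : Submodule (BA n) L}

section
variable (hS : Setting D E)
include hS

theorem inj : Function.Injective (algebraMap (BA n) L) := by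
  have := hS.loc
  exact IsLocalization.injective L (M := Submonoid.powers (braidF n))
    (powers_le_nonZeroDivisors_of_noZeroDivisors braidF_ne_zero)

theorem isDomain : IsDomain L := by
  have := hS.loc
  exact IsLocalization.isDomain_of_le_nonZeroDivisors L (M := Submonoid.powers (braidF n))
    (powers_le_nonZeroDivisors_of_noZeroDivisors braidF_ne_zero)

theorem isUnit_braidF : IsUnit (φ (braidF n)) := by
  have := hS.loc
  exact IsLocalization.Away.algebraMap_isUnit _

theorem exists_num (m : L) : ∃ (k : ℕ) (r : BA n), φ (braidF n) ^ k * m = φ r := by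
  have := hS.loc
  obtain ⟨k, r, h⟩ := IsLocalization.Away.surj (braidF n) m
  exact ⟨k, r, by rw [mul_comm, h]⟩

theorem uv_mul {a b : Fin n} (h : a ≠ b) : uv L a b * φ (xv a - xv b) = 1 := by
  unfold uv
  exact Ring.inverse_mul_cancel _
    (isUnit_of_dvd_unit ((algebraMap (BA n) L).map_dvd (xv_sub_dvd_braidF h)) hS.isUnit_braidF)

theorem D_phi (a : Fin n) (r : BA n) : D a (φ r) = φ (dd a r) + φ r * D a 1 := by
  simpa using hS.leib a r 1

theorem D_uv (a : Fin n) {b c : Fin n} (h : b ≠ c) :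
    D a (uv L b c) = uv L b c * D a 1
      - ((if a = b then 1 else 0) - (if a = c then 1 else 0)) * uv L b c ^ 2 := by
  have h1 := hS.uv_mul h
  have h2 := hS.leib a (xv b - xv c) (uv L b c)
  rw [mul_comm, h1, map_sub, dd_xv, dd_xv] at h2
  have h3 : φ ((if a = b then 1 else 0) - (if a = c then 1 else 0) : BA n)
    = (if a = b then 1 else 0) - (if a = c then 1 else 0) := by
    split_ifs <;> simp
  rw [h3] at h2
  linear_combination (- D a (uv L b c)) * h1 - uv L b c * h2

theorem D_rho (a : Fin n) (c : SR n) (m : L) : D a (φ (rho n c) * m) = φ (rho n c) * D a m := by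
  rw [hS.leib, dd_rho]; simp

theorem D_one_comm (a b : Fin n) : D a (D b 1) = D b (D a 1) := by
  rcases eq_or_ne a b with rfl | hab
  · rfl
  have key : ∀ a b : Fin n, a ≠ b →
      D a (D b 1) = D b 1 * D a 1 + φ (rho n (sv a b)) * uv L a b ^ 2 := by
    intro a b hab
    rw [hS.one b, map_sum, Finset.sum_mul]
    have : ∀ c, D a (φ (rho n (sv b c)) * uv L b c) = φ (rho n (sv b c)) * uv L b c * D a 1
        + if c = a then φ (rho n (sv a b)) * uv L a b ^ 2 else 0 := by
      intro c
      rw [hS.D_rho]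
      rcases eq_or_ne b c with rfl | hbc
      · simp [hab.symm]
      rw [hS.D_uv a hbc, if_neg hab]
      by_cases h : c = a
      · subst h
        rw [sv_symm b c, uv_symm c b]
        simp; ring
      · rw [if_neg h, if_neg (Ne.symm h)]; ring
    rw [Finset.sum_congr rfl fun c _ => this c, Finset.sum_add_distrib]
    simp
  rw [key a b hab, key b a hab.symm, sv_symm b a, uv_symm a b]
  ring

theorem D_comm (a b : Fin n) (m : L) : D a (D b m) = D b (D a m) := by
  obtain ⟨k, r, hr⟩ := hS.exists_num m
  rw [← map_pow] at hr
  set g := braidF n ^ k with hg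
  have hu : IsUnit (φ g) := by rw [hg, map_pow]; exact hS.isUnit_braidF.pow k
  have key : ∀ r m, D a (D b (φ r * m)) - D b (D a (φ r * m)) =
      φ r * (D a (D b m) - D b (D a m)) := by
    intro r m
    rw [hS.leib, hS.leib, map_add, map_add, hS.leib, hS.leib, hS.leib, hS.leib, dd_comm a b]
    ring
  have h1 := key g m
  have h2 := key r 1
  rw [mul_one, hS.D_one_comm a b, sub_self, mul_zero] at h2
  rw [hr, h2] at h1
  exact sub_eq_zero.mp ((hu.mul_right_eq_zero).mp h1.symm)

end

end Setting

end Arrangement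

namespace Arrangement

variable {n : ℕ} {L : Type} [CommRing L] [Algebra (BA n) L]

local notation "φ" => algebraMap (BA n) L

/-- The iterated application of the operators indexed by a multiset. -/
noncomputable def itD (D : Fin n → L →+ L) (s : Multiset (Fin n)) (m : L) : L :=
  s.toList.foldr (fun a m => D a m) m

theorem xv_sub_dvd_aeval_sub (p : Polynomial (BA n)) (a b : Fin n) :
    (xv a - xv b : BA n) ∣ p.eval (xv a) - p.eval (xv b) :=
  Polynomial.sub_dvd_eval_sub _ _ _

theorem braidF_dvd_sum {v : Fin n → BA n} (hv : ∀ a b, xv a - xv b ∣ v a - v b) :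
    braidF n ∣ ∑ a, v a * dd a (braidF n) := by
  rw [braidF_eq]
  have : ∀ s : Finset (BraidIdx n), ∏ q ∈ s, (xv q.1.1 - xv q.1.2 : BA n) ∣
      ∑ a, v a * dd a (∏ q ∈ s, (xv q.1.1 - xv q.1.2 : BA n)) := by
    classical
    intro s
    induction s using Finset.induction_on with
    | empty => simp
    | insert q s hq ih =>
      rw [Finset.prod_insert hq]
      simp only [Derivation.leibniz, smul_eq_mul, mul_add, Finset.sum_add_distrib]
      apply dvd_add
      · have : ∑ a, v a * ((xv q.1.1 - xv q.1.2) * dd a (∏ q ∈ s, (xv q.1.1 - xv q.1.2 : BA n)))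
          = (xv q.1.1 - xv q.1.2) * ∑ a, v a * dd a (∏ q ∈ s, (xv q.1.1 - xv q.1.2 : BA n)) := by
          rw [Finset.mul_sum]; exact Finset.sum_congr rfl fun a _ => by ring
        rw [this]
        exact mul_dvd_mul_left _ ih
      · have : ∑ a, v a * ((∏ q ∈ s, (xv q.1.1 - xv q.1.2 : BA n)) * dd a (xv q.1.1 - xv q.1.2))
          = (v q.1.1 - v q.1.2) * ∏ q ∈ s, (xv q.1.1 - xv q.1.2 : BA n) := by
          simp [mul_sub, mul_ite, Finset.sum_sub_distrib, sub_mul]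
        rw [this]
        exact mul_dvd_mul_right (hv _ _) _
  exact this Finset.univ

namespace Setting

variable {D : Fin n → L →+ L} {E : Submodule (BA n) L} (hS : Setting D E)
include hS

theorem itD_cons (a : Fin n) (s : Multiset (Fin n)) (m : L) :
    itD D (a ::ₘ s) m = D a (itD D s m) := by
  unfold itD
  have hp : (a ::ₘ s).toList.Perm (a :: s.toList) := by
    rw [← Multiset.coe_eq_coe, ← Multiset.cons_coe, Multiset.coe_toList, Multiset.coe_toList]
  rw [hp.foldr_eq' (fun x _ y _ z => hS.D_comm y x z)]
  simp

omit hS [Algebra (BA n) L] in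
theorem itD_zero (m : L) : itD D 0 m = m := by simp [itD]

/-- A symmetrized sum of divided differences. -/
theorem sum_mul_D_one {v : Fin n → BA n} {w : Fin n → Fin n → BA n}
    (hv : ∀ a b, v a - v b = (xv a - xv b) * w a b) :
    2 * ∑ a, φ (v a) * D a 1 = φ (∑ a, ∑ b, rho n (sv a b) * w a b) := by
  have h1 : ∑ a, φ (v a) * D a 1 = ∑ a, ∑ b, φ (v a) * φ (rho n (sv a b)) * uv L a b := by
    refine Finset.sum_congr rfl fun a _ => ?_
    rw [hS.one, Finset.mul_sum]
    exact Finset.sum_congr rfl fun b _ => by ring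
  have h2 : ∑ a, φ (v a) * D a 1 = ∑ a, ∑ b, - (φ (v b) * φ (rho n (sv a b)) * uv L a b) := by
    rw [h1, Finset.sum_comm]
    refine Finset.sum_congr rfl fun a _ => Finset.sum_congr rfl fun b _ => ?_
    rw [sv_symm, uv_symm b a]; ring
  rw [two_mul]
  nth_rewrite 1 [h1]
  rw [h2, ← Finset.sum_add_distrib, map_sum]
  refine Finset.sum_congr rfl fun a _ => ?_
  rw [← Finset.sum_add_distrib, map_sum]
  refine Finset.sum_congr rfl fun b _ => ?_
  rcases eq_or_ne a b with rfl | hab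
  · simp
  have h3 := hS.uv_mul hab
  have h4 := congrArg φ (hv a b)
  rw [map_sub, map_mul] at h4
  rw [map_mul]
  linear_combination φ (rho n (sv a b)) * uv L a b * h4 + φ (rho n (sv a b)) * φ (w a b) * h3

theorem exists_sum_mul_D_one {v : Fin n → BA n} (hv : ∀ a b, xv a - xv b ∣ v a - v b) :
    ∃ g : BA n, ∑ a, φ (v a) * D a 1 = φ g := by
  choose w hw using hv
  refine ⟨C (1 / 2) * ∑ a, ∑ b, rho n (sv a b) * w a b, ?_⟩
  rw [map_mul, ← hS.sum_mul_D_one hw, ← mul_assoc]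
  have : φ (C (1 / 2)) * 2 = 1 := by
    rw [← map_ofNat (algebraMap (BA n) L) 2, ← map_mul, ← map_ofNat (C (σ := Fin n ⊕ BraidIdx n)) 2,
      ← map_mul]
    norm_num
  rw [this, one_mul]

theorem exists_sum_mul_D_braidF {v : Fin n → BA n} (hv : ∀ a b, xv a - xv b ∣ v a - v b) :
    ∃ g : BA n, ∑ a, φ (v a) * D a (φ (braidF n)) = φ (g * braidF n) := by
  obtain ⟨g, hg⟩ := hS.exists_sum_mul_D_one hv
  obtain ⟨g', hg'⟩ := braidF_dvd_sum hv
  refine ⟨g + g', ?_⟩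
  have : ∀ a, φ (v a) * D a (φ (braidF n)) = φ (v a * dd a (braidF n))
      + φ (braidF n) * (φ (v a) * D a 1) := fun a => by
    rw [hS.D_phi, map_mul]; ring
  rw [Finset.sum_congr rfl fun a _ => this a, Finset.sum_add_distrib, ← Finset.mul_sum, hg,
    ← map_sum, hg', ← map_mul, ← map_add]
  congr 1; ring

end Setting

/-- The part of `E` generated by the derivatives of order at most `k`. -/
noncomputable def filt (D : Fin n → L →+ L) (k : ℕ) : Submodule (BA n) L :=
  Submodule.span (BA n) {m | ∃ s : Multiset (Fin n), s.card ≤ k ∧ m = itD D s (φ (braidF n))}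

namespace Setting

variable {D : Fin n → L →+ L} {E : Submodule (BA n) L}

theorem filt_mono {k l : ℕ} (h : k ≤ l) : filt D k ≤ filt D l :=
  Submodule.span_mono fun _ ⟨s, hs, hm⟩ => ⟨s, hs.trans h, hm⟩

theorem itD_mem_filt {k : ℕ} {s : Multiset (Fin n)} (h : s.card ≤ k) :
    itD D s (φ (braidF n)) ∈ filt D k :=
  Submodule.subset_span ⟨s, h, rfl⟩

variable (hS : Setting D E)
include hS

theorem D_mem_filt {k : ℕ} {m : L} (hm : m ∈ filt D k) (a : Fin n) : D a m ∈ filt D (k + 1) := by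
  induction hm using Submodule.span_induction with
  | mem m h =>
    obtain ⟨s, hs, rfl⟩ := h
    rw [← hS.itD_cons]
    exact itD_mem_filt (by simpa using hs)
  | zero => simp
  | add x y _ _ hx hy => rw [map_add]; exact add_mem hx hy
  | smul r x h hx =>
    rw [Algebra.smul_def, hS.leib, ← Algebra.smul_def, ← Algebra.smul_def]
    exact add_mem (Submodule.smul_mem _ _ (filt_mono (Nat.le_succ k) h)) (Submodule.smul_mem _ _ hx)

theorem le_filt {e : L} (he : e ∈ E) : ∃ k, e ∈ filt D k := by
  let E' : Submodule (BA n) L := ⨆ k, filt D k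
  have hdir : Directed (· ≤ ·) (filt D) := (monotone_nat_of_le_succ fun k =>
    filt_mono (Nat.le_succ k)).directed_le
  have := hS.min E' (Submodule.mem_iSup_of_mem 0 (by
    rw [← itD_zero (D := D) (φ (braidF n))]; exact itD_mem_filt (by simp))) ?_ he
  · exact (Submodule.mem_iSup_of_directed _ hdir).mp this
  · intro a m hm
    obtain ⟨k, hk⟩ := (Submodule.mem_iSup_of_directed _ hdir).mp hm
    exact Submodule.mem_iSup_of_mem (k + 1) (hS.D_mem_filt hk a)

theorem itD_mem_of_mem_filt {k : ℕ} {m : L} (hm : m ∈ filt D k) (s : Multiset (Fin n)) :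
    itD D s m ∈ filt D (k + s.card) := by
  induction s using Multiset.induction_on with
  | empty => simpa [itD_zero] using hm
  | cons a s ih =>
    rw [hS.itD_cons, Multiset.card_cons, ← add_assoc]
    exact hS.D_mem_filt ih a

theorem itD_phi_mul_sub (s : Multiset (Fin n)) (r : BA n) (a : Fin n) :
    itD D s (φ r * D a (φ (braidF n))) - φ r * itD D (a ::ₘ s) (φ (braidF n)) ∈ filt D s.card := by
  induction s using Multiset.induction_on with
  | empty =>
    rw [hS.itD_cons, itD_zero, itD_zero, sub_self]
    exact zero_mem _
  | cons b s ih =>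
    rw [hS.itD_cons, Multiset.cons_swap, hS.itD_cons b (a ::ₘ s), Multiset.card_cons]
    have h1 := hS.D_mem_filt ih b
    rw [map_sub, hS.leib] at h1
    have h2 : φ (dd b r) * itD D (a ::ₘ s) (φ (braidF n)) ∈ filt D (s.card + 1) := by
      rw [← Algebra.smul_def]
      exact Submodule.smul_mem _ _ (itD_mem_filt (by simp))
    convert add_mem h1 h2 using 1
    ring

theorem itD_sum (s : Multiset (Fin n)) {ι : Type*} (t : Finset ι) (f : ι → L) :
    itD D s (∑ i ∈ t, f i) = ∑ i ∈ t, itD D s (f i) := by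
  induction s using Multiset.induction_on with
  | empty => simp [itD_zero]
  | cons a s ih => simp only [hS.itD_cons, ih, map_sum]

theorem relation {v : Fin n → BA n} (hv : ∀ a b, xv a - xv b ∣ v a - v b)
    (s : Multiset (Fin n)) :
    ∑ a, φ (v a) * itD D (a ::ₘ s) (φ (braidF n)) ∈ filt D s.card := by
  obtain ⟨g, hg⟩ := hS.exists_sum_mul_D_braidF hv
  have h1 : itD D s (φ (g * braidF n)) ∈ filt D s.card := by
    have h0 : φ (g * braidF n) ∈ filt D 0 := by
      rw [map_mul, ← Algebra.smul_def]
      refine Submodule.smul_mem _ _ ?_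
      nth_rewrite 1 [← itD_zero (D := D) (φ (braidF n))]
      exact itD_mem_filt (by simp)
    simpa using hS.itD_mem_of_mem_filt h0 s
  rw [← hg, hS.itD_sum] at h1
  have h2 := sub_mem h1 (Submodule.sum_mem _ fun a (_ : a ∈ Finset.univ) =>
    hS.itD_phi_mul_sub s (v a) a)
  convert h2 using 1
  rw [← Finset.sum_sub_distrib]
  exact Finset.sum_congr rfl fun a _ => by ring

end Setting

/-- The monomial `x ^ α`. -/
noncomputable def xm (α : Fin n →₀ ℕ) : BA n := rename Sum.inl (monomial α (1 : ℂ))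

theorem xm_add (α β : Fin n →₀ ℕ) : (xm (α + β) : BA n) = xm α * xm β := by
  unfold xm
  rw [← map_mul, monomial_mul, one_mul]

theorem xm_single (a : Fin n) (k : ℕ) : (xm (Finsupp.single a k) : BA n) = xv a ^ k := by
  unfold xm xv
  rw [← X_pow_eq_monomial, map_pow, rename_X]

/-- Every polynomial is a combination of the monomials in the coordinates with coefficients in the
ring of exponents. -/
theorem mem_of_xm_mem (N : AddSubmonoid (BA n)) (hN : ∀ c : SR n, ∀ m ∈ N, rho n c * m ∈ N)
    (h : ∀ α, xm α ∈ N) (r : BA n) : r ∈ N := by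
  induction r using MvPolynomial.monomial_add_induction_on with
  | C c =>
    have h0 := hN (C c) _ (h 0)
    have : (xm 0 : BA n) = 1 := by simp [xm]
    rw [this, mul_one] at h0
    simpa [rho] using h0
  | monomial_add m c r _ _ h2 =>
    refine add_mem ?_ h2
    have h3 := hN (∏ j : BraidIdx n, X j ^ m (Sum.inr j) * C 1) _
      (hN (C c) _ (h (Finsupp.equivFunOnFinite.symm fun a => m (Sum.inl a))))
    convert h3 using 1
    rw [monomial_eq, Finsupp.prod_fintype _ _ (by simp), Fintype.prod_sum_type]
    simp only [rho, xm, monomial_eq, map_mul, map_prod, map_pow, rename_X, rename_C]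
    rw [Finsupp.prod_fintype _ _ (by simp)]
    simp only [map_prod, map_pow, rename_X, Finsupp.equivFunOnFinite_symm_apply_apply, C_1, mul_one,
      one_mul]
    ring

/-- The standard pairs of exponents. -/
def StdIdx (n : ℕ) : Type :=
  {p : (Fin n →₀ ℕ) × Multiset (Fin n) // ∀ j ∈ p.2, p.1 j < (j : ℕ)}

/-- The standard elements. -/
noncomputable def stdVec (D : Fin n → L →+ L) (p : StdIdx n) : L :=
  φ (xm p.1.1) * itD D p.1.2 (φ (braidF n))

/-- The action of the ring of exponents. -/
@[reducible] noncomputable def srModule (n : ℕ) (L : Type) [CommRing L] [Algebra (BA n) L] :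
    Module (SR n) L :=
  Module.compHom L ((algebraMap (BA n) L).comp (rho n).toRingHom)

attribute [local instance] srModule

theorem sr_smul_def (c : SR n) (m : L) : c • m = φ (rho n c) * m := rfl

/-- The product of `x_j - x_i` for `i < q`. -/
noncomputable def initProd (q : ℕ) (y : BA n) : BA n :=
  ∏ i ∈ Finset.univ.filter (fun i : Fin n => (i : ℕ) < q), (y - xv i)

theorem initProd_zero (y : BA n) : initProd 0 y = 1 := by simp [initProd]

theorem initProd_succ (q : Fin n) (y : BA n) :
    initProd ((q : ℕ) + 1) y = initProd q y * (y - xv q) := by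
  unfold initProd
  have : Finset.univ.filter (fun i : Fin n => (i : ℕ) < (q : ℕ) + 1)
      = insert q (Finset.univ.filter (fun i : Fin n => (i : ℕ) < q)) := by
    ext i
    simp only [Finset.mem_filter, Finset.mem_univ, true_and, Finset.mem_insert, Fin.ext_iff]
    omega
  rw [this, Finset.prod_insert (by simp), mul_comm]

theorem initProd_of_lt {j a : Fin n} (h : a < j) : initProd (n := n) j (xv a) = 0 := by
  unfold initProd
  exact Finset.prod_eq_zero (i := a) (by simpa using h) (sub_self _)

theorem xv_sub_dvd_initProd (j : Fin n) (a b : Fin n) :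
    (xv a - xv b : BA n) ∣ initProd j (xv a) - initProd j (xv b) := by
  have := xv_sub_dvd_aeval_sub (∏ i ∈ Finset.univ.filter (fun i : Fin n => i < j),
    (Polynomial.X - Polynomial.C (xv i))) a b
  simpa [Polynomial.eval_prod, initProd] using this

/-- The weight of an exponent. -/
def wt (α : Fin n →₀ ℕ) : ℕ := ∑ i : Fin n, (i : ℕ) * α i

theorem wt_add (α β : Fin n →₀ ℕ) : wt (α + β) = wt α + wt β := by
  simp [wt, mul_add, Finset.sum_add_distrib]

theorem wt_single (i : Fin n) (k : ℕ) : wt (Finsupp.single i k) = i * k := by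
  classical
  simp [wt, Finsupp.single_apply]

/-- Reduction of a power of `x_j` modulo an additive submonoid. -/
theorem xm_mem_of_initProd (N : AddSubgroup (BA n)) {W : ℕ} (hlow : ∀ γ, wt γ < W → xm γ ∈ N)
    (j : Fin n) (h : ∀ r, initProd j (xv j) * r ∈ N) (α : Fin n →₀ ℕ) (hα : (j : ℕ) ≤ α j)
    (hW : wt α = W) : xm α ∈ N := by
  have hR : ∀ q : ℕ, q ≤ j → ∀ γ, wt γ + q * j < W → xm γ * initProd q (xv j) ∈ N := by
    intro q
    induction q with
    | zero => intro _ γ hγ; simpa [initProd_zero] using hlow γ (by simpa using hγ)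
    | succ q ih =>
      intro hq γ hγ
      let q' : Fin n := ⟨q, by omega⟩
      have e : initProd (n := n) (q + 1) (xv j) = initProd q (xv j) * (xv j - xv q') :=
        initProd_succ q' (xv j)
      have h1 := ih (by omega) (γ + Finsupp.single j 1) (by
        rw [wt_add, wt_single]; rw [add_mul] at hγ; omega)
      have h2 := ih (by omega) (γ + Finsupp.single q' 1) (by
        rw [wt_add, wt_single]; rw [add_mul] at hγ; simp only [q']; omega)
      convert sub_mem h1 h2 using 1
      rw [e, xm_add, xm_add, xm_single, xm_single]
      ring
  obtain ⟨α', rfl⟩ : ∃ α', α = α' + Finsupp.single j (j : ℕ) :=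
    ⟨α - Finsupp.single j (j : ℕ), (tsub_add_cancel_of_le (by simpa using hα)).symm⟩
  rw [wt_add, wt_single] at hW
  have hT : ∀ k q : ℕ, q + k = j → xm α' * xv j ^ k * initProd q (xv j) ∈ N := by
    intro k
    induction k with
    | zero =>
      intro q hq
      obtain rfl : q = j := by omega
      convert h (xm α') using 1; ring
    | succ k ih =>
      intro q hq
      let q' : Fin n := ⟨q, by omega⟩
      have e : initProd (n := n) (q + 1) (xv j) = initProd q (xv j) * (xv j - xv q') :=
        initProd_succ q' (xv j)
      have h1 := ih (q + 1) (by omega)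
      have h2 := hR q (by omega) (α' + Finsupp.single j k + Finsupp.single q' 1) (by
        rw [wt_add, wt_add, wt_single, wt_single, ← hW]
        have : (q' : ℕ) = q := rfl
        rw [this, ← hq]
        nlinarith [Nat.zero_le k])
      convert add_mem h1 h2 using 1
      rw [e, xm_add, xm_add, xm_single, xm_single]
      ring
  have := hT j 0 (by simp)
  rwa [initProd_zero, mul_one, ← xm_single, ← xm_add] at this

namespace Setting

variable {D : Fin n → L →+ L} {E : Submodule (BA n) L} (hS : Setting D E)
include hS

theorem phi_mul_itD_mem (s : Multiset (Fin n)) : ∀ r : BA n,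
    φ r * itD D s (φ (braidF n)) ∈ Submodule.span (SR n) (Set.range (stdVec D)) := by
  set N := Submodule.span (SR n) (Set.range (stdVec D)) with hNdef
  suffices H : ∀ k, ∀ s : Multiset (Fin n), s.card = k → ∀ r : BA n,
      φ r * itD D s (φ (braidF n)) ∈ N from H _ s rfl
  intro k
  induction k using Nat.strong_induction_on with
  | _ k ihk =>
  have hfilt : ∀ l < k, ∀ m ∈ filt D l, m ∈ N := by
    intro l hl m hm
    suffices ∀ r : BA n, φ r * m ∈ N by simpa using this 1
    induction hm using Submodule.span_induction with
    | mem m h => obtain ⟨s, hs, rfl⟩ := h; exact ihk _ (by omega) s rfl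
    | zero => simp
    | add x y _ _ hx hy => intro r; rw [mul_add]; exact add_mem (hx r) (hy r)
    | smul r' x h hx => intro r; rw [Algebra.smul_def, ← mul_assoc, ← map_mul]; exact hx _
  suffices H : ∀ l, ∀ s : Multiset (Fin n), s.card = k →
      n * k - (s.map (fun i : Fin n => (i : ℕ))).sum = l →
      ∀ r : BA n, φ r * itD D s (φ (braidF n)) ∈ N from fun s hs => H _ s hs rfl
  intro l
  induction l using Nat.strong_induction_on with
  | _ l ihl =>
  intro s hs hl
  let Q : AddSubgroup (BA n) :=
    { carrier := {r | φ r * itD D s (φ (braidF n)) ∈ N}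
      add_mem' := fun {x y} hx hy => by
        simp only [Set.mem_ofPred_eq, map_add, add_mul] at *
        exact add_mem hx hy
      zero_mem' := by simp
      neg_mem' := fun {x} hx => by
        simp only [Set.mem_ofPred_eq, map_neg, neg_mul] at *
        exact neg_mem hx }
  have hQ : ∀ r, r ∈ Q ↔ φ r * itD D s (φ (braidF n)) ∈ N := fun r => Iff.rfl
  suffices H : ∀ W, ∀ α, wt α = W → xm α ∈ Q by
    intro r
    refine mem_of_xm_mem Q.toAddSubmonoid (fun c m hm => ?_) (fun α => H _ α rfl) r
    change φ (rho n c * m) * _ ∈ N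
    rw [map_mul, mul_assoc, ← sr_smul_def]
    exact Submodule.smul_mem _ _ hm
  intro W
  induction W using Nat.strong_induction_on with
  | _ W ihW =>
  intro α hα
  by_cases hstd : ∀ j ∈ s, α j < (j : ℕ)
  · rw [hQ]
    exact Submodule.subset_span ⟨⟨(α, s), hstd⟩, rfl⟩
  push Not at hstd
  obtain ⟨j, hj, hjα⟩ := hstd
  refine xm_mem_of_initProd Q (W := W) (fun γ hγ => ihW _ hγ γ rfl) j ?_ α hjα hα
  obtain ⟨γ, rfl⟩ := Multiset.exists_cons_of_mem hj
  rw [Multiset.card_cons] at hs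
  intro r
  rw [hQ]
  have hrel := Submodule.smul_mem _ r
    (hS.relation (xv_sub_dvd_initProd j) γ)
  have h1 := hfilt _ (by omega) _ hrel
  rw [Algebra.smul_def, Finset.mul_sum] at h1
  rw [← Finset.add_sum_erase _ _ (Finset.mem_univ j)] at h1
  have h2 : ∑ a ∈ Finset.univ.erase j, φ r * (φ (initProd j (xv a)) *
      itD D (a ::ₘ γ) (φ (braidF n))) ∈ N := by
    refine Submodule.sum_mem _ fun a ha => ?_
    rcases lt_or_gt_of_ne (Finset.ne_of_mem_erase ha) with h | h
    · rw [initProd_of_lt h]; simp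
    · rw [← mul_assoc, ← map_mul]
      have hb : ∀ t : Multiset (Fin n), (t.map (fun i : Fin n => (i : ℕ))).sum ≤ n * t.card := by
        intro t
        have := Multiset.sum_le_card_nsmul (t.map (fun i : Fin n => (i : ℕ))) n (by
          intro x hx
          obtain ⟨i, _, rfl⟩ := Multiset.mem_map.mp hx
          exact i.2.le)
        rw [Multiset.card_map, smul_eq_mul, mul_comm] at this
        exact this
      refine ihl _ ?_ (a ::ₘ γ) (by simpa using hs) rfl _
      have h3 := hb (a ::ₘ γ)
      have h4 : (j : ℕ) < a := h
      rw [Multiset.card_cons, hs] at h3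
      rw [← hl]
      simp only [Multiset.map_cons, Multiset.sum_cons] at h3 ⊢
      omega
  have h5 := (Submodule.add_mem_iff_left _ h2).mp h1
  convert h5 using 1
  rw [map_mul]; ring

theorem mem_span_stdVec {e : L} (he : e ∈ E) :
    e ∈ Submodule.span (SR n) (Set.range (stdVec D)) := by
  obtain ⟨k, hk⟩ := hS.le_filt he
  clear he
  suffices ∀ r : BA n, φ r * e ∈ Submodule.span (SR n) (Set.range (stdVec D)) by simpa using this 1
  induction hk using Submodule.span_induction with
  | mem m h => obtain ⟨s, hs, rfl⟩ := h; exact hS.phi_mul_itD_mem s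
  | zero => simp
  | add x y _ _ hx hy => intro r; rw [mul_add]; exact add_mem (hx r) (hy r)
  | smul r' x h hx => intro r; rw [Algebra.smul_def, ← mul_assoc, ← map_mul]; exact hx _

theorem itD_mem {m : L} (hm : m ∈ E) (s : Multiset (Fin n)) : itD D s m ∈ E := by
  induction s using Multiset.induction_on with
  | empty => simpa [itD_zero] using hm
  | cons a s ih => rw [hS.itD_cons]; exact hS.memD _ _ ih

theorem stdVec_mem (p : StdIdx n) : stdVec D p ∈ E := by
  unfold stdVec
  rw [← Algebra.smul_def]
  exact Submodule.smul_mem _ _ (hS.itD_mem hS.memF _)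

end Setting

end Arrangement

namespace Arrangement

variable {n : ℕ}

/-- Uniqueness of expansions in base `q`, twisted by powers of a polynomial prime to `q`. -/
theorem base_expansion_unique {R : Type*} [CommRing R] [IsDomain R] {k : Type*} [Fintype k]
    (p : k → R) (hp : Function.Injective p) (Q : Polynomial R) (hQ : ∀ i, Q.eval (p i) ≠ 0)
    (B : ℕ) (P : ℕ → Polynomial R)
    (hP : ∀ b, b ≠ 0 → (P b).degree < Fintype.card k)
    (h : ∑ b ∈ Finset.range (B + 1),
      P b * (∏ i, (Polynomial.X - Polynomial.C (p i))) ^ (B - b) * Q ^ b = 0) :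
    ∀ b ≤ B, P b = 0 := by
  induction B with
  | zero => intro b hb; obtain rfl : b = 0 := by omega
            simpa using h
  | succ B ih =>
    set q : Polynomial R := ∏ i, (Polynomial.X - Polynomial.C (p i)) with hq
    have hq0 : ∀ i, q.eval (p i) = 0 := fun i => by
      rw [hq, Polynomial.eval_prod]
      exact Finset.prod_eq_zero (Finset.mem_univ i) (by simp)
    have hqne : q ≠ 0 := (Polynomial.monic_prod_of_monic _ _ fun i _ =>
      Polynomial.monic_X_sub_C _).ne_zero
    rw [Finset.sum_range_succ] at h
    have hsum : ∑ b ∈ Finset.range (B + 1), P b * q ^ (B + 1 - b) * Q ^ b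
        = q * ∑ b ∈ Finset.range (B + 1), P b * q ^ (B - b) * Q ^ b := by
      rw [Finset.mul_sum]
      refine Finset.sum_congr rfl fun b hb => ?_
      rw [Nat.succ_sub (by have := Finset.mem_range.mp hb; omega), pow_succ]
      ring
    rw [hsum] at h
    have htop : P (B + 1) = 0 := by
      refine Polynomial.eq_zero_of_degree_lt_of_eval_index_eq_zero (s := Finset.univ) (v := p)
        hp.injOn (by simpa using hP (B + 1) (by omega)) fun i _ => ?_
      have := congrArg (Polynomial.eval (p i)) h
      simpa [hq0, hQ] using this
    rw [htop] at h
    have h' : ∑ b ∈ Finset.range (B + 1), P b * q ^ (B - b) * Q ^ b = 0 := by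
      simpa [hqne] using h
    intro b hb
    rcases Nat.lt_or_ge b (B + 1) with h1 | h1
    · exact ih h' b (by omega)
    · obtain rfl : b = B + 1 := by omega
      exact htop

/-- Polynomials in the coordinates with coefficients in the ring of exponents. -/
abbrev PX (n : ℕ) : Type := MvPolynomial (Fin n) (SR n)

/-- The product of `x_a - x_i` over `i < a`. -/
noncomputable def qv (a : Fin n) : PX n := ∏ i ∈ Finset.univ.filter (· < a), (X a - X i)

/-- The numerator of `∑_{i < a} s_{i,a} / (x_a - x_i)`. -/
noncomputable def Qv (a : Fin n) : PX n :=
  ∑ i ∈ Finset.univ.filter (· < a), C (sv i a) *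
    ∏ j ∈ (Finset.univ.filter (· < a)).erase i, (X a - X j)

/-- The subalgebra generated by the coordinates before `k`. -/
noncomputable def RK (n k : ℕ) : Subalgebra (SR n) (PX n) :=
  Algebra.adjoin (SR n) (X '' {i : Fin n | (i : ℕ) < k})

theorem X_mem_RK {k : ℕ} {i : Fin n} (h : (i : ℕ) < k) : (X i : PX n) ∈ RK n k :=
  Algebra.subset_adjoin ⟨i, h, rfl⟩

theorem RK_mono {k l : ℕ} (h : k ≤ l) : RK n k ≤ RK n l :=
  Algebra.adjoin_mono (Set.image_mono fun _ hi => lt_of_lt_of_le hi h)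

theorem qv_mem_RK (a : Fin n) : qv a ∈ RK n (a + 1) := by
  refine prod_mem fun i hi => sub_mem (X_mem_RK (by omega)) (X_mem_RK ?_)
  have : i < a := by simpa using hi
  have : (i : ℕ) < a := this
  omega

theorem Qv_mem_RK (a : Fin n) : Qv a ∈ RK n (a + 1) := by
  refine sum_mem fun i _ => mul_mem (Subalgebra.algebraMap_mem _ _) (prod_mem fun i hi =>
    sub_mem (X_mem_RK (by omega)) (X_mem_RK ?_))
  have : i < a := by simpa using (Finset.mem_erase.mp hi).2
  have : (i : ℕ) < a := this
  omega

theorem transcendental_RK (k : Fin n) : Transcendental (RK n k) (X k : PX n) := by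
  have := (MvPolynomial.algebraicIndependent_X (Fin n) (SR n))
  exact this.transcendental_adjoin (s := {i : Fin n | (i : ℕ) < k}) (i := k) (by simp)

/-- The factor of index `a` of the numerator of a standard element. -/
noncomputable def facv (B : ℕ) (a : Fin n) (c d : ℕ) : PX n :=
  X a ^ c * qv a ^ (B - d) * Qv a ^ d

theorem fraction_independent {R P : Type*} [CommRing R] [IsDomain R] [CommRing P] [Algebra R P]
    {x : P} (hx : Transcendental R x) {I : Type*} [Fintype I] [DecidableEq I] (pt : I → R)
    (hpt : Function.Injective pt) (σ : I → R) (hσ : ∀ i, σ i ≠ 0) (B : ℕ)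
    {ι : Type*} (T : Finset ι) (c d : ι → ℕ)
    (hd : ∀ p ∈ T, d p ≤ B) (hcd : ∀ p ∈ T, d p = 0 ∨ c p < Fintype.card I) (f : ι → R)
    (h : ∑ p ∈ T, algebraMap R P (f p) * (x ^ c p * (∏ i, (x - algebraMap R P (pt i))) ^ (B - d p) *
      (∑ i, algebraMap R P (σ i) *
        ∏ i' ∈ Finset.univ.erase i, (x - algebraMap R P (pt i'))) ^ d p) = 0) (c0 d0 : ℕ) :
    ∑ p ∈ T.filter (fun p => c p = c0 ∧ d p = d0), f p = 0 := by
  classical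
  let Q : Polynomial R := ∑ i : I, Polynomial.C (σ i) *
    ∏ i' ∈ Finset.univ.erase i, (Polynomial.X - Polynomial.C (pt i'))
  have hQ : ∀ i, Q.eval (pt i) ≠ 0 := by
    intro i
    have : Q.eval (pt i) = σ i * ∏ i' ∈ Finset.univ.erase i, (pt i - pt i') := by
      simp only [Q, Polynomial.eval_finsetSum, Polynomial.eval_mul, Polynomial.eval_C,
        Polynomial.eval_prod, Polynomial.eval_sub, Polynomial.eval_X]
      refine Finset.sum_eq_single i (fun j _ hj => ?_) (by simp)
      rw [Finset.prod_eq_zero (i := i) (by simp [hj.symm]) (sub_self _), mul_zero]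
    rw [this]
    refine mul_ne_zero (hσ i) (Finset.prod_ne_zero_iff.mpr fun j hj => ?_)
    rw [sub_ne_zero]
    exact fun h0 => (Finset.ne_of_mem_erase hj) (hpt h0).symm
  let P' : ℕ → Polynomial R := fun b =>
    ∑ p ∈ T.filter (fun p => d p = b), Polynomial.C (f p) * Polynomial.X ^ c p
  have hP : ∀ b, b ≠ 0 → (P' b).degree < Fintype.card I := by
    intro b hb
    refine (Polynomial.degree_sum_le _ _).trans_lt ?_
    rw [Finset.sup_lt_iff (WithBot.bot_lt_coe _)]
    intro p hp
    rw [Finset.mem_filter] at hp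
    refine (Polynomial.degree_C_mul_X_pow_le _ _).trans_lt ?_
    have := (hcd p hp.1).resolve_left (by omega)
    exact_mod_cast this
  have hev : ∀ g : Polynomial R, Polynomial.aeval x g = 0 → g = 0 :=
    fun g hg => (transcendental_iff.mp hx) g hg
  have hq : Polynomial.aeval x (∏ i : I, (Polynomial.X - Polynomial.C (pt i)))
      = ∏ i, (x - algebraMap R P (pt i)) := by
    simp only [map_prod, map_sub, Polynomial.aeval_X, Polynomial.aeval_C]
  have hQe : Polynomial.aeval x Q = ∑ i, algebraMap R P (σ i) *
        ∏ i' ∈ Finset.univ.erase i, (x - algebraMap R P (pt i')) := by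
    simp only [Q, map_sum, map_mul, map_prod, map_sub, Polynomial.aeval_X, Polynomial.aeval_C]
  have hmain := base_expansion_unique pt hpt Q hQ B P' hP (by
    apply hev
    rw [map_sum, ← h]
    simp only [map_mul, map_pow, hq, hQe]
    simp only [P', map_sum, map_mul, map_pow, Polynomial.aeval_X, Polynomial.aeval_C]
    rw [← Finset.sum_fiberwise_of_maps_to (s := T) (t := Finset.range (B + 1)) (g := d)
      (fun p hp => by have := hd p hp; simp; omega)]
    refine Finset.sum_congr rfl fun b _ => ?_
    rw [Finset.sum_mul, Finset.sum_mul]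
    refine Finset.sum_congr rfl fun p hp => ?_
    rw [Finset.mem_filter] at hp
    rw [hp.2]
    ring)
  by_cases hd0 : d0 ≤ B
  · have h1 := congrArg (fun g : Polynomial R => g.coeff c0) (hmain d0 hd0)
    simp only [P', Polynomial.finsetSum_coeff, Polynomial.coeff_C_mul, Polynomial.coeff_X_pow,
      mul_ite, mul_one, mul_zero, Polynomial.coeff_zero] at h1
    rw [← Finset.sum_filter, Finset.filter_filter] at h1
    rw [← h1]
    refine Finset.sum_congr ?_ fun p hp => rfl
    ext p; simp only [Finset.mem_filter]; tauto
  · rw [Finset.filter_false_of_mem, Finset.sum_empty]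
    rintro p hp ⟨-, rfl⟩
    exact hd0 (hd p hp)

theorem facv_independent (k : Fin n) (B : ℕ) {ι : Type*} (T : Finset ι) (c d : ι → ℕ)
    (hd : ∀ p ∈ T, d p ≤ B) (hcd : ∀ p ∈ T, d p = 0 ∨ c p < (k : ℕ)) (f : ι → PX n)
    (hf : ∀ p ∈ T, f p ∈ RK n k) (h : ∑ p ∈ T, f p * facv B k (c p) (d p) = 0) (c0 d0 : ℕ) :
    ∑ p ∈ T.filter (fun p => c p = c0 ∧ d p = d0), f p = 0 := by
  classical
  let I := {i : Fin n // i < k}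
  let _ : CommRing (RK n k) := Subalgebra.toCommRing (RK n k)
  let pt : I → RK n k := fun i => ⟨X i.1, X_mem_RK i.2⟩
  have hpt : Function.Injective pt := fun i j hij => by
    have := congrArg Subtype.val hij
    exact Subtype.ext (X_injective this)
  let σ : I → RK n k := fun i => ⟨C (sv i.1 k), Subalgebra.algebraMap_mem _ _⟩
  have hσ : ∀ i, σ i ≠ 0 := by
    intro i h0
    have h1 := congrArg Subtype.val h0
    have h2 : (C (sv i.1 k) : PX n) = 0 := h1
    rw [C_eq_zero, sv_of_lt i.2] at h2
    exact X_ne_zero _ h2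
  let f' : ι → RK n k := fun p => if h : p ∈ T then ⟨f p, hf p h⟩ else 0
  have hf' : ∀ p ∈ T, algebraMap (RK n k) (PX n) (f' p) = f p := fun p hp => by
    simp only [f', hp, dif_pos]; rfl
  have hcard : Fintype.card I = k := by
    rw [Fintype.card_subtype, show Finset.univ.filter (fun i : Fin n => i < k) = Finset.Iio k by
      ext; simp, Fin.card_Iio]
  have hq : (∏ i : I, (X k - algebraMap (RK n k) (PX n) (pt i))) = qv k := by
    unfold qv
    exact (Finset.prod_subtype (Finset.univ.filter (· < k)) (by simp)
      (fun i : Fin n => (X k - X i : PX n))).symm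
  have hQe : (∑ i, algebraMap (RK n k) (PX n) (σ i) *
        ∏ i' ∈ Finset.univ.erase i, (X k - algebraMap (RK n k) (PX n) (pt i'))) = Qv k := by
    unfold Qv
    rw [Finset.sum_subtype (Finset.univ.filter (· < k)) (p := (· < k)) (by simp)]
    refine Finset.sum_congr rfl fun i _ => ?_
    refine congrArg₂ (· * ·) rfl ?_
    refine Finset.prod_bij (fun j _ => j.1) (fun j hj => ?_) (fun _ _ _ _ h => Subtype.ext h)
      (fun j hj => ?_) (fun j hj => rfl)
    · have := Finset.ne_of_mem_erase hj
      simp only [Finset.mem_erase, Finset.mem_filter, Finset.mem_univ, true_and]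
      exact ⟨fun h => this (Subtype.ext h), j.2⟩
    · simp only [Finset.mem_erase, Finset.mem_filter, Finset.mem_univ, true_and] at hj
      exact ⟨⟨j, hj.2⟩, Finset.mem_erase.mpr
        ⟨fun h => hj.1 (congrArg Subtype.val h), Finset.mem_univ _⟩, rfl⟩
  have hmain := fraction_independent (transcendental_RK k) pt hpt σ hσ B T c d hd
    (by rw [hcard]; exact hcd) f' (by
      rw [← h, hq, hQe]
      exact Finset.sum_congr rfl fun p hp => by rw [hf' p hp]; rfl) c0 d0
  have h1 := congrArg (algebraMap (RK n k) (PX n)) hmain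
  rw [map_sum, map_zero] at h1
  rw [← h1]
  exact Finset.sum_congr rfl fun p hp => (hf' p (Finset.mem_of_mem_filter p hp)).symm

/-- The numerators of the leading coefficients of the standard elements are independent. -/
theorem numer_independent (B : ℕ) {ι : Type*} (T : Finset ι) (c d : ι → Fin n → ℕ)
    (hinj : ∀ p ∈ T, ∀ p' ∈ T, c p = c p' → d p = d p' → p = p')
    (hd : ∀ p ∈ T, ∀ a, d p a ≤ B) (hcd : ∀ p ∈ T, ∀ a, d p a = 0 ∨ c p a < (a : ℕ)) (f : ι → SR n)
    (h : ∑ p ∈ T, C (f p) * ∏ a, facv B a (c p a) (d p a) = (0 : PX n)) : ∀ p ∈ T, f p = 0 := by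
  classical
  suffices H : ∀ k ≤ n, ∀ p0 : ι,
      ∑ p ∈ T.filter (fun p => ∀ a : Fin n, k ≤ a → c p a = c p0 a ∧ d p a = d p0 a),
        C (f p) * ∏ a ∈ Finset.univ.filter (fun a : Fin n => (a : ℕ) < k), facv B a (c p a) (d p a)
        = (0 : PX n) by
    intro p0 hp0
    have h1 := H 0 (Nat.zero_le n) p0
    have h2 : T.filter (fun p => ∀ a : Fin n, 0 ≤ (a : ℕ) → c p a = c p0 a ∧ d p a = d p0 a) = {p0} := by
      ext p
      simp only [Finset.mem_filter, Finset.mem_singleton]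
      constructor
      · rintro ⟨hp, hp'⟩
        exact hinj p hp p0 hp0 (funext fun a => (hp' a (Nat.zero_le _)).1)
          (funext fun a => (hp' a (Nat.zero_le _)).2)
      · rintro rfl
        exact ⟨hp0, fun a _ => ⟨rfl, rfl⟩⟩
    rw [h2] at h1
    simpa using h1
  intro k hk
  induction hk using Nat.decreasingInduction with
  | self =>
    intro p0
    rw [Finset.filter_true_of_mem (fun p _ a ha => absurd a.2 (by omega))]
    simpa using h
  | of_succ k hk ih =>
    intro p0
    let a : Fin n := ⟨k, hk⟩
    have key : ∀ p, ∏ a ∈ Finset.univ.filter (fun a : Fin n => (a : ℕ) < k + 1), facv B a (c p a) (d p a)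
        = (∏ a ∈ Finset.univ.filter (fun a : Fin n => (a : ℕ) < k), facv B a (c p a) (d p a))
          * facv B a (c p a) (d p a) := by
      intro p
      have : Finset.univ.filter (fun i : Fin n => (i : ℕ) < k + 1)
          = insert a (Finset.univ.filter (fun i : Fin n => (i : ℕ) < k)) := by
        ext i
        simp only [Finset.mem_filter, Finset.mem_univ, true_and, Finset.mem_insert, Fin.ext_iff, a]
        omega
      rw [this, Finset.prod_insert (by simp [a]), mul_comm]
    have h1 := ih p0
    simp only [key, ← mul_assoc] at h1
    have h2 := facv_independent a B _ (fun p => c p a) (fun p => d p a)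
      (fun p hp => hd p (Finset.mem_of_mem_filter p hp) a)
      (fun p hp => hcd p (Finset.mem_of_mem_filter p hp) a) _ (fun p hp => ?_) h1 (c p0 a) (d p0 a)
    · rw [← h2, Finset.filter_filter]
      refine Finset.sum_congr ?_ fun _ _ => rfl
      ext p
      simp only [Finset.mem_filter]
      refine and_congr_right fun _ => ⟨fun hp => ⟨fun i hi => hp i (by omega), hp a le_rfl⟩,
        fun hp i hi => ?_⟩
      rcases Nat.eq_or_lt_of_le hi with h3 | h3
      · obtain rfl : i = a := Fin.ext h3.symm
        exact hp.2
      · exact hp.1 i h3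
    · refine mul_mem (Subalgebra.algebraMap_mem _ _) (prod_mem fun i hi => ?_)
      have hi' : (i : ℕ) < k := by simpa using hi
      have hle : RK n (i + 1) ≤ RK n k := RK_mono hi'
      unfold facv
      exact mul_mem (mul_mem (pow_mem (X_mem_RK hi') _) (pow_mem (hle (qv_mem_RK i)) _))
        (pow_mem (hle (Qv_mem_RK i)) _)

end Arrangement

namespace Arrangement

variable {n : ℕ} {L : Type} [CommRing L] [Algebra (BA n) L]

local notation "φ" => algebraMap (BA n) L

/-- A strictly decreasing positive weight. -/
def wgt (a : Fin n) : ℕ := n - a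

theorem wgt_pos (a : Fin n) : 0 < wgt a := by unfold wgt; omega

theorem wgt_lt {a b : Fin n} (h : a < b) : wgt b < wgt a := by
  have : (a : ℕ) < b := h
  unfold wgt; omega

/-- The weighted homogenization of the ring of exponents. -/
noncomputable def tau (n : ℕ) : SR n →ₐ[ℂ] Polynomial (SR n) :=
  aeval fun q : BraidIdx n => Polynomial.C (X q) * Polynomial.X ^ wgt q.1.2

theorem tau_ne_zero {c : SR n} (h : c ≠ 0) : tau n c ≠ 0 := by
  intro h0
  apply h
  have : (Polynomial.evalRingHom (1 : SR n)).comp (tau n).toRingHom = RingHom.id (SR n) := by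
    apply MvPolynomial.ringHom_ext
    · intro r
      simp only [tau, RingHom.comp_apply, AlgHom.toRingHom_eq_coe, RingHom.coe_coe, aeval_C,
        Polynomial.coe_evalRingHom, RingHom.id_apply]
      rw [Polynomial.algebraMap_apply, Polynomial.eval_C]; rfl
    · intro i; simp [tau]
  have h1 := congrArg (fun g : SR n →+* SR n => g c) this
  simp only [RingHom.comp_apply, AlgHom.toRingHom_eq_coe, RingHom.coe_coe, h0, map_zero,
    RingHom.id_apply] at h1
  exact h1.symm

/-- The weighted homogenization in the exponents. -/
noncomputable def psiZero (n : ℕ) : BA n →ₐ[ℂ] Polynomial (PX n) :=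
  aeval (Sum.elim (fun a => Polynomial.C (X a))
    (fun q => Polynomial.C (C (X q)) * Polynomial.X ^ wgt q.1.2))

theorem psiZero_xv (a : Fin n) : psiZero n (xv a) = Polynomial.C (X a) := by
  simp [psiZero, xv]

theorem psiZero_xm (α : Fin n →₀ ℕ) : psiZero n (xm α) = Polynomial.C (∏ a, X a ^ α a) := by
  unfold xm
  rw [monomial_eq, Finsupp.prod_fintype _ _ (by simp)]
  simp [psiZero, map_prod]

theorem psiZero_rho (c : SR n) : psiZero n (rho n c) = (tau n c).map (C : SR n →+* PX n) := by
  have : (psiZero n).toRingHom.comp (rho n).toRingHom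
      = (Polynomial.mapRingHom (C : SR n →+* PX n)).comp (tau n).toRingHom := by
    apply MvPolynomial.ringHom_ext
    · intro r
      simp [psiZero, rho, tau, Polynomial.algebraMap_apply, MvPolynomial.algebraMap_eq,
        IsScalarTower.algebraMap_apply ℂ (SR n) (PX n)]
    · intro i; simp [psiZero, rho, tau]
  exact congrArg (fun g : SR n →+* Polynomial (PX n) => g c) this

theorem psiZero_dd_coeff (a : Fin n) (r : BA n) (m : ℕ) :
    (psiZero n (dd a r)).coeff m = pderiv a ((psiZero n r).coeff m) := by
  induction r using MvPolynomial.induction_on generalizing m with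
  | C c =>
    have h1 : dd a (C c : BA n) = 0 := by unfold dd; simp
    rw [h1, map_zero, Polynomial.coeff_zero]
    have h2 : psiZero n (C c) = Polynomial.C (C (C c)) := by
      simp [psiZero, Polynomial.algebraMap_apply, MvPolynomial.algebraMap_eq,
        IsScalarTower.algebraMap_apply ℂ (SR n) (PX n)]
    rw [h2, Polynomial.coeff_C]
    split_ifs <;> simp
  | add p q hp hq => simp only [map_add, Polynomial.coeff_add, hp, hq]
  | mul_X p i hp =>
    rw [Derivation.leibniz, smul_eq_mul, smul_eq_mul, map_add, map_mul, map_mul, map_mul]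
    rcases i with b | q
    · have h1 : (X (Sum.inl b) : BA n) = xv b := rfl
      rw [h1, psiZero_xv, dd_xv, Polynomial.coeff_mul_C, Polynomial.coeff_add,
        Polynomial.coeff_C_mul, hp, Derivation.leibniz, pderiv_X]
      simp only [smul_eq_mul, Pi.single_apply]
      by_cases h : a = b
      · subst h; simp [mul_comm]
      · simp [h, Ne.symm h, mul_comm]
    · have h1 : dd a (X (Sum.inr q) : BA n) = 0 := by
        have := dd_rho a (X q : SR n)
        simpa [rho] using this
      have h2 : psiZero n (X (Sum.inr q)) = Polynomial.C (C (X q)) * Polynomial.X ^ wgt q.1.2 := by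
        simp [psiZero]
      rw [h1, h2, map_zero, mul_zero, zero_add, mul_comm, ← mul_assoc, ← mul_assoc,
        Polynomial.coeff_mul_X_pow', Polynomial.coeff_mul_X_pow']
      split_ifs
      · rw [mul_comm, Polynomial.coeff_C_mul, mul_comm, Polynomial.coeff_mul_C, hp,
          Derivation.leibniz, pderiv_C]
        simp [mul_comm]
      · simp

variable {K : Type} [Field K] [Algebra (PX n) K] [IsFractionRing (PX n) K]

/-- The weighted homogenization with values in polynomials over a field. -/
noncomputable def psiOne (n : ℕ) (K : Type) [Field K] [Algebra (PX n) K] :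
    BA n →+* Polynomial K :=
  (Polynomial.mapRingHom (algebraMap (PX n) K)).comp (psiZero n).toRingHom

omit [IsFractionRing (PX n) K] in
theorem psiOne_apply (r : BA n) : psiOne n K r = (psiZero n r).map (algebraMap (PX n) K) := rfl

theorem psiOne_natDegree (r : BA n) : (psiOne n K r).natDegree = (psiZero n r).natDegree := by
  rw [psiOne_apply, Polynomial.natDegree_map_eq_of_injective (IsFractionRing.injective (PX n) K)]

theorem psiOne_dd_natDegree (a : Fin n) (r : BA n) :
    (psiOne n K (dd a r)).natDegree ≤ (psiOne n K r).natDegree := by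
  rw [psiOne_natDegree, psiOne_natDegree, Polynomial.natDegree_le_iff_coeff_eq_zero]
  intro m hm
  rw [psiZero_dd_coeff, Polynomial.coeff_eq_zero_of_natDegree_lt hm, map_zero]

/-- The value of the discriminant. -/
noncomputable def Fx (n : ℕ) (K : Type) [Field K] [Algebra (PX n) K] : K :=
  algebraMap (PX n) K (∏ q : BraidIdx n, (X q.1.1 - X q.1.2))

omit [IsFractionRing (PX n) K] in
theorem psiOne_braidF : psiOne n K (braidF n) = Polynomial.C (Fx n K) := by
  rw [braidF_eq, psiOne_apply, map_prod]
  simp only [map_sub, psiZero_xv]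
  simp [Fx, Polynomial.map_prod]

theorem X_sub_X_ne_zero {a b : Fin n} (h : a ≠ b) :
    algebraMap (PX n) K (X a) - algebraMap (PX n) K (X b) ≠ 0 := by
  rw [sub_ne_zero]
  exact fun h0 => h (X_injective (IsFractionRing.injective (PX n) K h0))

theorem Fx_ne_zero : Fx n K ≠ 0 := by
  unfold Fx
  rw [map_prod]
  refine Finset.prod_ne_zero_iff.mpr fun q _ => ?_
  rw [map_sub]
  exact X_sub_X_ne_zero q.2.ne

theorem isUnit_psiOne_braidF : IsUnit (psiOne n K (braidF n)) := by
  rw [psiOne_braidF, Polynomial.isUnit_C]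
  exact (Fx_ne_zero (n := n) (K := K)).isUnit

/-- The leading coefficient of the operator of index `a`. -/
noncomputable def Yb (K : Type) [Field K] [Algebra (PX n) K] (a : Fin n) : K :=
  ∑ i ∈ Finset.univ.filter (· < a),
    algebraMap (PX n) K (C (sv i a)) / (algebraMap (PX n) K (X a) - algebraMap (PX n) K (X i))

theorem qv_mul_Yb (a : Fin n) : algebraMap (PX n) K (qv a) * Yb K a = algebraMap (PX n) K (Qv a) := by
  unfold qv Yb Qv
  rw [Finset.mul_sum, map_sum]
  refine Finset.sum_congr rfl fun i hi => ?_
  have hne := X_sub_X_ne_zero (n := n) (K := K) (a := a) (b := i) (by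
    have : i < a := by simpa using hi
    exact this.ne')
  rw [← Finset.mul_prod_erase _ _ hi, map_mul, map_sub, map_mul]
  field_simp

/-- The extension of the homogenization to the localization. -/
noncomputable def psi (K : Type) [Field K] [Algebra (PX n) K] [IsFractionRing (PX n) K]
    [IsLocalization.Away (braidF n) L] : L →+* Polynomial K :=
  IsLocalization.Away.lift (braidF n) (g := psiOne n K) isUnit_psiOne_braidF

section

variable [IsLocalization.Away (braidF n) L]

theorem psi_phi (r : BA n) : psi (n := n) K (φ r) = psiOne n K r :=
  IsLocalization.Away.lift_eq _ _ _

/-- `m` has degree at most `p`, with coefficient `q` in degree `p`. -/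
def Lead (K : Type) [Field K] [Algebra (PX n) K] [IsFractionRing (PX n) K] (m : L) (p : ℕ) (q : K) :
    Prop :=
  (psi (n := n) K m).natDegree ≤ p ∧ (psi (n := n) K m).coeff p = q

theorem psi_rho_sv {a b : Fin n} (h : a < b) :
    psi (n := n) (L := L) K (φ (rho n (sv a b))) =
      Polynomial.C (algebraMap (PX n) K (C (sv a b))) * Polynomial.X ^ wgt b := by
  rw [psi_phi, psiOne_apply, psiZero_rho, sv_of_lt h, tau, aeval_X]
  simp

variable {D : Fin n → L →+ L} {E : Submodule (BA n) L} (hS : Setting D E)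
include hS

theorem psi_uv {a b : Fin n} (h : a ≠ b) : psi (n := n) K (uv L a b) =
    Polynomial.C (algebraMap (PX n) K (X a) - algebraMap (PX n) K (X b))⁻¹ := by
  have h1 := congrArg (psi (n := n) K) (hS.uv_mul h)
  rw [map_mul, psi_phi, map_one, psiOne_apply, map_sub, psiZero_xv, psiZero_xv, Polynomial.map_sub,
    Polynomial.map_C, Polynomial.map_C, ← Polynomial.C_sub] at h1
  have h2 := X_sub_X_ne_zero (n := n) (K := K) h
  have h3 : Polynomial.C (algebraMap (PX n) K (X a) - algebraMap (PX n) K (X b)) *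
    Polynomial.C (algebraMap (PX n) K (X a) - algebraMap (PX n) K (X b))⁻¹ = 1 := by
    rw [← Polynomial.C_mul, mul_inv_cancel₀ h2, Polynomial.C_1]
  exact left_inv_eq_right_inv h1 h3

theorem lead_D_one (a : Fin n) : Lead (n := n) K (D a 1) (wgt a) (Yb K a) := by
  have h : psi (n := n) K (D a 1) = ∑ b, psi (n := n) K (φ (rho n (sv a b)) * uv L a b) := by
    rw [hS.one, map_sum]
  have h1 : ∀ b, b < a → psi (n := n) K (φ (rho n (sv a b)) * uv L a b) =
      Polynomial.C (algebraMap (PX n) K (C (sv b a)) /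
        (algebraMap (PX n) K (X a) - algebraMap (PX n) K (X b))) * Polynomial.X ^ wgt a := by
    intro b hb
    rw [map_mul, sv_symm, psi_rho_sv hb, psi_uv hS hb.ne', div_eq_mul_inv, Polynomial.C_mul]
    ring
  have h2 : ∀ b, a < b → psi (n := n) K (φ (rho n (sv a b)) * uv L a b) =
      Polynomial.C (algebraMap (PX n) K (C (sv a b)) /
        (algebraMap (PX n) K (X a) - algebraMap (PX n) K (X b))) * Polynomial.X ^ wgt b := by
    intro b hb
    rw [map_mul, psi_rho_sv hb, psi_uv hS hb.ne, div_eq_mul_inv, Polynomial.C_mul]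
    ring
  unfold Lead
  rw [h]
  constructor
  · refine Polynomial.natDegree_sum_le_of_forall_le _ _ fun b _ => ?_
    rcases lt_trichotomy b a with hb | rfl | hb
    · rw [h1 b hb]; exact Polynomial.natDegree_C_mul_X_pow_le _ _
    · simp
    · rw [h2 b hb]; exact (Polynomial.natDegree_C_mul_X_pow_le _ _).trans (wgt_lt hb).le
  · rw [Polynomial.finsetSum_coeff, Yb, Finset.sum_filter]
    refine Finset.sum_congr rfl fun b _ => ?_
    rcases lt_trichotomy b a with hb | rfl | hb
    · rw [h1 b hb, if_pos hb]; simp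
    · simp
    · rw [h2 b hb, if_neg hb.not_gt, Polynomial.coeff_C_mul_X_pow, if_neg (wgt_lt hb).ne']

theorem natDegree_psi_D_sub (a : Fin n) (m : L) :
    (psi (n := n) K (D a m - m * D a 1)).natDegree ≤ (psi (n := n) K m).natDegree := by
  obtain ⟨k, r, hr⟩ := hS.exists_num m
  rw [← map_pow] at hr
  set g := braidF n ^ k with hg
  have hpg : psiOne n K g = Polynomial.C (Fx n K ^ k) := by
    rw [hg, map_pow, psiOne_braidF, Polynomial.C_pow]
  have hne : Fx n K ^ k ≠ 0 := pow_ne_zero _ Fx_ne_zero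
  have hdeg : ∀ y z : L, φ g * y = z → (psi (n := n) K y).natDegree = (psi (n := n) K z).natDegree := by
    rintro y z rfl
    rw [map_mul, psi_phi, hpg, Polynomial.natDegree_C_mul hne]
  have h1 : φ g * (D a m - m * D a 1) = φ (dd a r) - φ (dd a g) * m := by
    have h2 := hS.leib a g m
    rw [hr, hS.D_phi a r] at h2
    linear_combination - h2 - D a 1 * hr
  rw [hdeg _ _ h1, hdeg _ _ hr, map_sub, map_mul, psi_phi, psi_phi, psi_phi]
  refine (Polynomial.natDegree_sub_le _ _).trans (max_le (psiOne_dd_natDegree a r) ?_)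
  refine Polynomial.natDegree_mul_le.trans ?_
  have h3 := psiOne_dd_natDegree (K := K) a g
  rw [hpg, Polynomial.natDegree_C] at h3
  rw [hdeg _ _ hr, psi_phi]
  omega

theorem lead_D {m : L} {p : ℕ} {q : K} (h : Lead (n := n) K m p q) (a : Fin n) :
    Lead (n := n) K (D a m) (wgt a + p) (Yb K a * q) := by
  have h1 := natDegree_psi_D_sub (K := K) hS a m
  have h2 := lead_D_one (K := K) hS a
  have e : psi (n := n) K (D a m) = psi (n := n) K (D a m - m * D a 1)
      + psi (n := n) K (D a 1) * psi (n := n) K m := by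
    rw [← map_mul, ← map_add]; congr 1; ring
  have hp := wgt_pos a
  obtain ⟨ha, hb⟩ := h
  unfold Lead
  rw [e]
  constructor
  · refine (Polynomial.natDegree_add_le _ _).trans (max_le (by omega) ?_)
    exact Polynomial.natDegree_mul_le.trans (add_le_add h2.1 ha)
  · rw [Polynomial.coeff_add, Polynomial.coeff_eq_zero_of_natDegree_lt (by omega), zero_add,
      Polynomial.coeff_mul_add_eq_of_natDegree_le h2.1 ha, h2.2, hb]

theorem lead_itD {m : L} {p : ℕ} {q : K} (h : Lead (n := n) K m p q) (s : Multiset (Fin n)) :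
    Lead (n := n) K (itD D s m) ((s.map wgt).sum + p) ((s.map (Yb K)).prod * q) := by
  induction s using Multiset.induction_on with
  | empty => simpa [Setting.itD_zero] using h
  | cons a s ih =>
    rw [hS.itD_cons, Multiset.map_cons, Multiset.map_cons, Multiset.sum_cons, Multiset.prod_cons,
      add_assoc, mul_assoc]
    exact lead_D hS ih a

omit hS in
theorem lead_mul {m m' : L} {p p' : ℕ} {q q' : K} (h : Lead (n := n) K m p q)
    (h' : Lead (n := n) K m' p' q') : Lead (n := n) K (m * m') (p + p') (q * q') := by
  unfold Lead
  rw [map_mul]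
  exact ⟨Polynomial.natDegree_mul_le.trans (add_le_add h.1 h'.1), by
    rw [Polynomial.coeff_mul_add_eq_of_natDegree_le h.1 h'.1, h.2, h'.2]⟩

omit hS in
theorem lead_phi {r : BA n} {c : PX n} (h : psiZero n r = Polynomial.C c) :
    Lead (n := n) K (φ r) 0 (algebraMap (PX n) K c) := by
  unfold Lead
  rw [psi_phi, psiOne_apply, h]
  simp

omit hS in
theorem lead_rho (c : SR n) :
    Lead (n := n) K (φ (rho n c)) (tau n c).natDegree
      (algebraMap (PX n) K (C (tau n c).leadingCoeff)) := by
  unfold Lead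
  rw [psi_phi, psiOne_apply, psiZero_rho, Polynomial.map_map]
  refine ⟨Polynomial.natDegree_map_le, ?_⟩
  rw [Polynomial.coeff_map]; rfl

theorem lead_stdVec (p : StdIdx n) :
    Lead (n := n) K (stdVec D p) (p.1.2.map wgt).sum
      (algebraMap (PX n) K (∏ a, X a ^ p.1.1 a) * ((p.1.2.map (Yb K)).prod * Fx n K)) := by
  have h0 : Lead (n := n) K (φ (braidF n)) 0 (Fx n K) := by
    unfold Lead
    rw [psi_phi, psiOne_braidF]
    simp
  have := lead_mul (lead_phi (L := L) (K := K) (psiZero_xm p.1.1)) (lead_itD hS h0 p.1.2)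
  simpa [stdVec] using this

end

end Arrangement

namespace Arrangement

variable {n : ℕ} {L : Type} [CommRing L] [Algebra (BA n) L]

local notation "φ" => algebraMap (BA n) L

attribute [local instance] srModule

namespace Setting

variable {D : Fin n → L →+ L} {E : Submodule (BA n) L} (hS : Setting D E)
include hS

theorem linearIndependent_stdVec : LinearIndependent (SR n) (stdVec D) := by
  classical
  have := hS.loc
  let K := FractionRing (PX n)
  rw [linearIndependent_iff']
  intro s g hg
  by_contra! hne
  obtain ⟨i0, hi0, hgi0⟩ := hne
  set T := s.filter (fun p => g p ≠ 0) with hT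
  have hTs : ∑ p ∈ T, φ (rho n (g p)) * stdVec D p = 0 := by
    rw [← hg, hT, Finset.sum_filter]
    refine Finset.sum_congr rfl fun p _ => ?_
    split_ifs with h
    · rfl
    · rw [not_not] at h; rw [h, zero_smul]
  set N : StdIdx n → ℕ := fun p => (tau n (g p)).natDegree + (p.1.2.map wgt).sum with hN
  obtain ⟨p0, hp0, hmax⟩ := T.exists_max_image N ⟨i0, by simp [hT, hi0, hgi0]⟩
  have hlead : ∀ p, Lead (n := n) K (φ (rho n (g p)) * stdVec D p) (N p) _ := fun p =>
    lead_mul (lead_rho (L := L) (K := K) (g p)) (lead_stdVec (K := K) hS p)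
  have h1 := congrArg (fun m => (psi (n := n) K m).coeff (N p0)) hTs
  simp only [map_sum, Polynomial.finsetSum_coeff, map_zero, Polynomial.coeff_zero] at h1
  set T' := T.filter (fun p => N p = N p0) with hT'
  set B := ∑ p ∈ T, p.1.2.card with hB
  have hcount : ∀ p ∈ T', ∀ a, p.1.2.count a ≤ B := fun p hp a =>
    (Multiset.count_le_card _ _).trans
      (Finset.single_le_sum (f := fun p : StdIdx n => p.1.2.card) (fun _ _ => Nat.zero_le _)
        (Finset.mem_of_mem_filter p hp))
  have h2 : ∑ p ∈ T', algebraMap (PX n) K (C (tau n (g p)).leadingCoeff) *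
      (algebraMap (PX n) K (∏ a, X a ^ p.1.1 a) * ((p.1.2.map (Yb K)).prod * Fx n K)) = 0 := by
    rw [← h1, hT', Finset.sum_filter]
    refine Finset.sum_congr rfl fun p hp => ?_
    split_ifs with h
    · rw [← h]; exact ((hlead p).2).symm
    · exact (Polynomial.coeff_eq_zero_of_natDegree_lt
        ((hlead p).1.trans_lt (lt_of_le_of_ne (hmax p hp) h))).symm
  have h3 : ∑ p ∈ T', C (tau n (g p)).leadingCoeff *
      ∏ a, facv B a (p.1.1 a) (p.1.2.count a) = (0 : PX n) := by
    apply IsFractionRing.injective (PX n) K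
    rw [map_zero, map_sum]
    refine mul_right_cancel₀ (Fx_ne_zero (n := n) (K := K)) ?_
    rw [zero_mul, Finset.sum_mul, ← mul_zero (algebraMap (PX n) K (∏ a, qv a ^ B)), ← h2,
      Finset.mul_sum]
    refine Finset.sum_congr rfl fun p hp => ?_
    have h5 : (p.1.2.map (Yb K)).prod = ∏ a, Yb K a ^ p.1.2.count a := by
      rw [Finset.prod_multiset_map_count]
      refine Finset.prod_subset (Finset.subset_univ _) fun a _ ha => ?_
      rw [Multiset.mem_toFinset] at ha
      rw [Multiset.count_eq_zero_of_notMem ha, pow_zero]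
    have h4 : algebraMap (PX n) K (∏ a, facv B a (p.1.1 a) (p.1.2.count a))
        = algebraMap (PX n) K (∏ a, X a ^ p.1.1 a) * (algebraMap (PX n) K (∏ a, qv a ^ B) *
          ∏ a, Yb K a ^ p.1.2.count a) := by
      simp only [map_prod, ← Finset.prod_mul_distrib]
      refine Finset.prod_congr rfl fun a _ => ?_
      unfold facv
      rw [map_mul, map_mul, map_pow, map_pow, map_pow, map_pow, ← qv_mul_Yb, mul_pow, mul_assoc]
      congr 1
      rw [← mul_assoc, ← pow_add, Nat.sub_add_cancel (hcount p hp a)]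
    rw [map_mul, h4, h5]
    ring
  have h5 := numer_independent B T' (fun p a => p.1.1 a) (fun p a => p.1.2.count a) (by
      intro p _ p' _ h h'
      apply Subtype.ext
      apply Prod.ext
      · exact Finsupp.ext fun a => congrFun h a
      · exact Multiset.ext.mpr fun a => congrFun h' a) hcount (fun p _ a => by
      by_cases ha : a ∈ p.1.2
      · exact Or.inr (p.2 a ha)
      · exact Or.inl (Multiset.count_eq_zero_of_notMem ha)) _ h3 p0 (by simp [hT', hp0])
  have h6 : g p0 ≠ 0 := (Finset.mem_filter.mp hp0).2
  exact tau_ne_zero h6 (Polynomial.leadingCoeff_eq_zero.mp h5)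

theorem smul_mem_of_isRelPrime {c₁ c₂ g : SR n} (hc : c₁ ≠ 0) (hrel : IsRelPrime c₁ c₂) {e : L}
    (h₁ : φ (rho n (g * c₁)) * e ∈ E) (h₂ : φ (rho n (g * c₂)) * e ∈ E) :
    φ (rho n g) * e ∈ E := by
  obtain ⟨P, hP⟩ := Finsupp.mem_span_range_iff_exists_finsupp.mp (hS.mem_span_stdVec h₁)
  obtain ⟨Q, hQ⟩ := Finsupp.mem_span_range_iff_exists_finsupp.mp (hS.mem_span_stdVec h₂)
  have hPQ : c₂ • P = c₁ • Q := by
    refine (linearIndependent_iff_injective_finsuppLinearCombination.mp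
      hS.linearIndependent_stdVec) ?_
    rw [map_smul, map_smul]
    change c₂ • (P.sum fun i a => a • stdVec D i) = c₁ • (Q.sum fun i a => a • stdVec D i)
    rw [hP, hQ, sr_smul_def, sr_smul_def, map_mul, map_mul, map_mul, map_mul]
    ring
  have hdvd : ∀ i, c₁ ∣ P i := fun i => by
    refine hrel.dvd_of_dvd_mul_left ⟨Q i, ?_⟩
    exact DFunLike.congr_fun hPQ i
  choose f hf using hdvd
  have key : φ (rho n g) * e = ∑ i ∈ P.support, f i • stdVec D i := by
    have := hS.isDomain
    have hne : φ (rho n c₁) ≠ 0 := by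
      rw [Ne, map_eq_zero_iff _ hS.inj]
      exact fun h => hc (rename_injective _ Sum.inr_injective (by rw [map_zero]; exact h))
    refine mul_left_cancel₀ hne ?_
    rw [← mul_assoc, ← map_mul, ← map_mul, mul_comm c₁, ← hP, Finsupp.sum, Finset.mul_sum]
    refine Finset.sum_congr rfl fun i _ => ?_
    rw [hf i, sr_smul_def, sr_smul_def, map_mul, map_mul, mul_assoc]
  rw [key]
  refine Submodule.sum_mem _ fun i _ => ?_
  rw [sr_smul_def, ← Algebra.smul_def]
  exact Submodule.smul_mem _ _ (hS.stdVec_mem i)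

end Setting

end Arrangement

namespace Arrangement

open scoped Pointwise

variable {n : ℕ} {L : Type} [CommRing L] [Algebra (BA n) L]

local notation "φ" => algebraMap (BA n) L

/-- The pairs contained in `I`. -/
def edges (I : Finset (Fin n)) : Finset (BraidIdx n) :=
  Finset.univ.filter (fun q : BraidIdx n => q.1.1 ∈ I ∧ q.1.2 ∈ I)

/-- The linear factors of the generator. -/
noncomputable def lin (I : Finset (Fin n)) (k : ℕ) : SR n :=
  (∑ q ∈ edges I, X q) + C (((I.card : ℂ) - 1) + (k : ℂ))

theorem mem_edges {I : Finset (Fin n)} {q : BraidIdx n} : q ∈ edges I ↔ q.1.1 ∈ I ∧ q.1.2 ∈ I := by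
  simp [edges]

theorem sum_sum_sv {M : Type*} [AddCommMonoid M] (I : Finset (Fin n)) (f : Fin n → Fin n → M)
    (hf : ∀ a b, f a b = f b a) (h0 : ∀ a, f a a = 0) :
    ∑ a ∈ I, ∑ b ∈ I, f a b = 2 • ∑ q ∈ edges I, f q.1.1 q.1.2 := by
  classical
  have h1 : ∑ q ∈ edges I, f q.1.1 q.1.2 = ∑ a ∈ I, ∑ b ∈ I, if a < b then f a b else 0 := by
    unfold edges
    rw [Finset.sum_filter, sum_braidIdx]
    rw [← Finset.sum_subset (Finset.subset_univ I) (fun a _ ha => by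
      refine Finset.sum_eq_zero fun b _ => ?_
      simp [ha])]
    refine Finset.sum_congr rfl fun a ha => ?_
    rw [← Finset.sum_subset (Finset.subset_univ I) (fun b _ hb => by simp [hb])]
    refine Finset.sum_congr rfl fun b hb => ?_
    simp [ha, hb]
  have h2 : ∑ q ∈ edges I, f q.1.1 q.1.2 = ∑ a ∈ I, ∑ b ∈ I, if b < a then f a b else 0 := by
    rw [h1, Finset.sum_comm]
    refine Finset.sum_congr rfl fun a _ => Finset.sum_congr rfl fun b _ => ?_
    rw [hf b a]
  rw [two_nsmul]
  nth_rewrite 1 [h1]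
  rw [h2, ← Finset.sum_add_distrib]
  refine Finset.sum_congr rfl fun a _ => ?_
  rw [← Finset.sum_add_distrib]
  refine Finset.sum_congr rfl fun b _ => ?_
  rcases lt_trichotomy a b with h | rfl | h
  · simp [h, h.not_gt]
  · simp [h0]
  · simp [h, h.not_gt]

/-- A submodule that is stable by the derivations and saturated with respect to `G` and to the
complement of the multiples of `ϖ`. -/
structure Sat (D : Fin n → L →+ L) (ϖ : SR n) (G : BA n) (V : Submodule (BA n) L) : Prop where
  memD : ∀ a, ∀ m ∈ V, D a m ∈ V
  unG : ∀ m, φ G * m ∈ V → m ∈ V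
  unC : ∀ c m, ¬ ϖ ∣ c → φ (rho n c) * m ∈ V → m ∈ V

/-- The saturation of the quotient of `E` by `p`. -/
noncomputable def satMod (E : Submodule (BA n) L) {ϖ : SR n} (hϖ : Prime ϖ) (p : SR n) (G : BA n) :
    Submodule (BA n) L where
  carrier := {m | ∃ c r, ¬ ϖ ∣ c ∧ φ (rho n (p * c) * G ^ r) * m ∈ E}
  zero_mem' := ⟨1, 0, fun h => hϖ.not_isUnit (isUnit_of_dvd_one h), by simp⟩
  add_mem' := by
    rintro m m' ⟨c, r, hc, h⟩ ⟨c', r', hc', h'⟩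
    refine ⟨c * c', r + r', fun hd => (hϖ.dvd_or_dvd hd).elim hc hc', ?_⟩
    convert add_mem (E.smul_mem (rho n c' * G ^ r') h) (E.smul_mem (rho n c * G ^ r) h') using 1
    simp only [Algebra.smul_def, map_mul, map_pow]
    ring
  smul_mem' := by
    rintro y m ⟨c, r, hc, h⟩
    refine ⟨c, r, hc, ?_⟩
    convert E.smul_mem y h using 1
    simp only [Algebra.smul_def]
    ring

theorem satMod_mono {E : Submodule (BA n) L} {ϖ : SR n} {hϖ : Prime ϖ} {p p' : SR n} {G : BA n}
    (h : p ∣ p') : satMod E hϖ p G ≤ satMod E hϖ p' G := by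
  obtain ⟨d, rfl⟩ := h
  rintro m ⟨c, r, hc, hm⟩
  refine ⟨c, r, hc, ?_⟩
  convert E.smul_mem (rho n d) hm using 1
  simp only [Algebra.smul_def, map_mul, map_pow]
  ring

theorem mem_satMod_mul {E : Submodule (BA n) L} {ϖ : SR n} {hϖ : Prime ϖ} {p p' : SR n} {G : BA n}
    {m : L} (h : φ (rho n p') * m ∈ satMod E hϖ p G) : m ∈ satMod E hϖ (p * p') G := by
  obtain ⟨c, r, hc, hm⟩ := h
  refine ⟨c, r, hc, ?_⟩
  convert hm using 1
  simp only [map_mul, map_pow]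
  ring

theorem exists_pow_mem_satMod {E : Submodule (BA n) L} {ϖ : SR n} {hϖ : Prime ϖ} {p : SR n}
    {G l : BA n} {m : L} (h : m ∈ satMod E hϖ p (l * G)) : ∃ r, φ (l ^ r) * m ∈ satMod E hϖ p G := by
  obtain ⟨c, r, hc, hm⟩ := h
  refine ⟨r, c, r, hc, ?_⟩
  convert hm using 1
  simp only [map_mul, map_pow, mul_pow]
  ring

namespace Setting

variable {D : Fin n → L →+ L} {E : Submodule (BA n) L} (hS : Setting D E)
include hS

theorem sat_satMod {ϖ : SR n} (hϖ : Prime ϖ) (p : SR n) (G : BA n) :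
    Sat D ϖ G (satMod E hϖ p G) where
  memD := by
    rintro a m ⟨c, r, hc, h⟩
    refine ⟨c, r + 1, hc, ?_⟩
    have h1 := hS.memD a _ (E.smul_mem G h)
    rw [Algebra.smul_def, ← mul_assoc, ← map_mul, hS.leib] at h1
    have h2 : φ (dd a (G * (rho n (p * c) * G ^ r))) * m ∈ E := by
      convert E.smul_mem (((r : BA n) + 1) * dd a G) h using 1
      rw [Algebra.smul_def, ← mul_assoc (φ _) (φ _), ← map_mul]
      congr 2
      have e : G * (rho n (p * c) * G ^ r) = rho n (p * c) * G ^ (r + 1) := by ring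
      rw [e, Derivation.leibniz, dd_rho, Derivation.leibniz_pow]
      simp only [smul_eq_mul, nsmul_eq_mul, Nat.add_sub_cancel]
      push_cast
      ring
    convert sub_mem h1 h2 using 1
    rw [add_sub_cancel_left]
    congr 2; ring
  unG := by
    rintro m ⟨c, r, hc, h⟩
    refine ⟨c, r + 1, hc, ?_⟩
    convert h using 1
    simp only [map_mul, map_pow]; ring
  unC := by
    rintro c m hc ⟨c', r, hc', h⟩
    refine ⟨c * c', r, fun hd => (hϖ.dvd_or_dvd hd).elim hc hc', ?_⟩
    convert h using 1
    simp only [map_mul, map_pow]; ring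

end Setting

namespace Sat

variable {D : Fin n → L →+ L} {E : Submodule (BA n) L} (hS : Setting D E)
  {ϖ : SR n} {G : BA n} {V : Submodule (BA n) L} (hV : Sat D ϖ G V)
include hS hV

theorem uv_mul_mem {a b : Fin n} (h : xv a - xv b ∣ G) {m : L} (hm : m ∈ V) : uv L a b * m ∈ V := by
  rcases eq_or_ne a b with rfl | hab
  · simp [uv]
  obtain ⟨g, hg⟩ := h
  refine hV.unG _ ?_
  have := hS.uv_mul hab
  convert V.smul_mem g hm using 1
  rw [Algebra.smul_def, hg, map_mul]
  linear_combination φ g * m * this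

theorem divergence_mem (I : Finset (Fin n)) (hG : ∀ a ∈ I, ∀ b ∉ I, xv a - xv b ∣ G)
    (v : Fin n → BA n) (w : Fin n → Fin n → BA n)
    (hv : ∀ a ∈ I, ∀ b ∈ I, v a - v b = (xv a - xv b) * w a b) (h : BA n)
    (hh : ∀ a ∈ I, φ (v a * h) ∈ V) :
    φ (∑ a ∈ I, dd a (v a * h) + C (1 / 2) * (∑ a ∈ I, ∑ b ∈ I, rho n (sv a b) * w a b) * h) ∈ V := by
  classical
  have h1 : ∑ a ∈ I, D a (φ (v a * h)) ∈ V := sum_mem fun a ha => hV.memD a _ (hh a ha)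
  have h2 : ∀ a ∈ I, D a (φ (v a * h)) = φ (dd a (v a * h)) +
      (∑ b ∈ I, φ (v a) * φ (rho n (sv a b)) * uv L a b) * φ h +
      ∑ b ∈ Iᶜ, φ (rho n (sv a b)) * (uv L a b * φ (v a * h)) := by
    intro a _
    rw [hS.D_phi, hS.one, ← Finset.sum_add_sum_compl I, mul_add, ← add_assoc]
    congr 1
    · congr 1
      rw [Finset.mul_sum, Finset.sum_mul]
      refine Finset.sum_congr rfl fun b _ => ?_
      rw [map_mul]; ring
    · rw [Finset.mul_sum]
      exact Finset.sum_congr rfl fun b _ => by ring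
  rw [Finset.sum_congr rfl h2, Finset.sum_add_distrib, Finset.sum_add_distrib] at h1
  have h3 : ∑ a ∈ I, ∑ b ∈ Iᶜ, φ (rho n (sv a b)) * (uv L a b * φ (v a * h)) ∈ V :=
    sum_mem fun a ha => sum_mem fun b hb => by
      rw [← Algebra.smul_def]
      exact V.smul_mem _ (hV.uv_mul_mem hS (hG a ha b (by simpa using hb)) (hh a ha))
  have h4 := (Submodule.add_mem_iff_left V h3).mp h1
  set S := ∑ a ∈ I, ∑ b ∈ I, φ (v a) * φ (rho n (sv a b)) * uv L a b with hSdef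
  have h5 : S = ∑ a ∈ I, ∑ b ∈ I, - (φ (v b) * φ (rho n (sv a b)) * uv L a b) := by
    rw [hSdef, Finset.sum_comm]
    refine Finset.sum_congr rfl fun a _ => Finset.sum_congr rfl fun b _ => ?_
    rw [sv_symm, uv_symm b a]; ring
  have h6 : 2 * S = φ (∑ a ∈ I, ∑ b ∈ I, rho n (sv a b) * w a b) := by
    rw [two_mul]
    nth_rewrite 1 [hSdef]
    rw [h5, ← Finset.sum_add_distrib, map_sum]
    refine Finset.sum_congr rfl fun a ha => ?_
    rw [← Finset.sum_add_distrib, map_sum]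
    refine Finset.sum_congr rfl fun b hb => ?_
    rcases eq_or_ne a b with rfl | hab
    · simp
    have h3 := hS.uv_mul hab
    have h4 := congrArg φ (hv a ha b hb)
    rw [map_sub, map_mul] at h4
    rw [map_mul]
    linear_combination φ (rho n (sv a b)) * uv L a b * h4 + φ (rho n (sv a b)) * φ (w a b) * h3
  have h7 : φ (C (1 / 2)) * 2 = 1 := by
    rw [← map_ofNat (algebraMap (BA n) L) 2, ← map_mul, ← map_ofNat (C (σ := Fin n ⊕ BraidIdx n)) 2,
      ← map_mul]
    norm_num
  convert h4 using 1
  rw [map_add, map_mul, map_mul, ← h6, ← map_sum, ← Finset.sum_mul]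
  linear_combination S * φ h * h7

/-- The differences of the coordinates in `I`. -/
def diffs (I : Finset (Fin n)) (a₀ : Fin n) : Set (BA n) := (fun a => xv a - xv a₀) '' I

omit hV in
omit hS in
omit [CommRing L] [Algebra (BA n) L] in
theorem euler {I : Finset (Fin n)} {a₀ : Fin n} (h₀ : a₀ ∈ I) {k : ℕ} :
    ∀ h ∈ diffs I a₀ ^ k, ∑ a ∈ I, (xv a - xv a₀) * dd a h = (k : BA n) * h := by
  classical
  induction k with
  | zero => intro h hh; rw [pow_zero] at hh; obtain rfl := hh; simp
  | succ k ih =>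
    intro h hh
    rw [pow_succ] at hh
    obtain ⟨g, hg, y, ⟨b, hb, rfl⟩, rfl⟩ := Set.mem_mul.mp hh
    have hb : b ∈ I := hb
    simp only [Derivation.leibniz, smul_eq_mul, mul_add, Finset.sum_add_distrib, map_sub, dd_xv]
    have h1 := ih g hg
    have h2 : ∑ a ∈ I, (xv a - xv a₀) * ((xv b - xv a₀) * dd a g) = (xv b - xv a₀) * (k * g) := by
      rw [← h1, Finset.mul_sum]
      exact Finset.sum_congr rfl fun a _ => by ring
    rw [h2]
    have h3 : ∑ a ∈ I, (xv a - xv a₀ : BA n) * (g * ((if a = b then 1 else 0) - if a = a₀ then 1 else 0))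
        = (xv b - xv a₀) * g := by
      simp only [mul_sub, mul_ite, mul_one, mul_zero, Finset.sum_sub_distrib, Finset.sum_ite_eq', hb,
        h₀, if_true]
      ring
    rw [h3]
    push_cast; ring

theorem euler_mem {I : Finset (Fin n)} (hG : ∀ a ∈ I, ∀ b ∉ I, xv a - xv b ∣ G) {a₀ : Fin n}
    (h₀ : a₀ ∈ I) {k : ℕ} {h : BA n} (hh : h ∈ diffs I a₀ ^ k)
    (hm : ∀ a ∈ I, φ ((xv a - xv a₀) * h) ∈ V) : φ (rho n (lin I k)) * φ h ∈ V := by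
  classical
  have h1 := hV.divergence_mem hS I hG (fun a => xv a - xv a₀) (fun a b => if a = b then 0 else 1)
    (fun a _ b _ => by by_cases hab : a = b <;> simp [hab]) h hm
  rw [← map_mul]
  convert h1 using 2
  have h2 : ∑ a ∈ I, dd a ((xv a - xv a₀) * h) = ((I.card : BA n) - 1 + k) * h := by
    simp only [Derivation.leibniz, smul_eq_mul, Finset.sum_add_distrib, map_sub, dd_xv, euler h₀ h hh]
    simp [mul_sub, h₀]
    ring
  have h3 : ∑ a ∈ I, ∑ b ∈ I, rho n (sv a b) * (if a = b then 0 else 1)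
      = 2 • ∑ q ∈ edges I, rho n (X q) := by
    rw [sum_sum_sv I _ (fun a b => by rw [sv_symm]; simp only [eq_comm]) (by simp)]
    congr 1
    refine Finset.sum_congr rfl fun q _ => ?_
    rw [if_neg q.2.ne, sv_of_lt q.2, mul_one]
  rw [h2, h3, lin, map_add, map_sum, nsmul_eq_mul, ← mul_assoc]
  have h4 : (C (1 / 2) : BA n) * ((2 : ℕ) : BA n) = 1 := by
    rw [← map_natCast (C (σ := Fin n ⊕ BraidIdx n)), ← map_mul]; norm_num
  have h5 : rho n (C ((I.card : ℂ) - 1 + k)) = ((I.card : BA n) - 1 + k) := by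
    rw [rho, rename_C]; simp
  rw [h4, h5, one_mul]
  ring

/-- The ideal of the polynomials in `V`. -/
noncomputable def ideal (V : Submodule (BA n) L) : Ideal (BA n) := V.comap (Algebra.linearMap (BA n) L)

omit hS hV in
theorem mem_ideal {h : BA n} : h ∈ ideal V ↔ φ h ∈ V := Iff.rfl

theorem block {I : Finset (Fin n)} (hG : ∀ a ∈ I, ∀ b ∉ I, xv a - xv b ∣ G) {a₀ : Fin n}
    (h₀ : a₀ ∈ I) (hr : ∀ a ∈ I, ∃ r, φ ((xv a - xv a₀) ^ r) ∈ V) (h1 : (1 : L) ∉ V) :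
    ∃ k, ϖ ∣ lin I k ∧ Ideal.span (diffs I a₀) ^ (k + 1) ≤ ideal V ∧
      ¬ Ideal.span (diffs I a₀) ^ k ≤ ideal V := by
  classical
  have hex : ∃ k, Ideal.span (diffs I a₀) ^ k ≤ ideal V := by
    refine Ideal.exists_pow_le_of_le_radical_of_fg ?_ ?_
    · rw [Ideal.span_le]
      rintro _ ⟨a, ha, rfl⟩
      exact hr a ha
    · exact ⟨I.image (fun a => xv a - xv a₀), by rw [Finset.coe_image]; rfl⟩
  have hk := Nat.find_spec hex
  have hmin := fun {m} => Nat.find_min hex (m := m)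
  set k := Nat.find hex with hkdef
  rcases hk0 : k with _ | d
  · rw [hk0, pow_zero] at hk
    rw [Ideal.one_eq_top, top_le_iff, Ideal.eq_top_iff_one, mem_ideal, map_one] at hk
    exact absurd hk h1
  rw [hk0] at hk
  refine ⟨d, ?_, hk, hmin (by omega)⟩
  by_contra hd
  refine hmin (m := d) (by omega) ?_
  rw [Ideal.span, Submodule.span_pow, Submodule.span_le]
  intro h hh
  refine hV.unC _ _ hd (hV.euler_mem hS hG h₀ hh fun a ha => ?_)
  refine mem_ideal.mp (hk ?_)
  rw [pow_succ']
  refine Ideal.mul_mem_mul (Ideal.subset_span ⟨a, ha, rfl⟩) ?_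
  rw [Ideal.span, Submodule.span_pow]
  exact Submodule.subset_span hh

end Sat

end Arrangement

namespace Arrangement

section Coinvariant

variable {R : Type*} [CommRing R] [Algebra ℚ R] {m : ℕ} {y : ℕ → R}

theorem prod_one_sub_eq_one (h : ∀ j, 1 ≤ j → j ≤ m → ∑ i ∈ Finset.range m, y i ^ j = 0) :
    ∏ i ∈ Finset.range m, (1 - Polynomial.C (y i) * Polynomial.X) = (1 : Polynomial R) := by
  classical
  set G : Polynomial R := ∏ i ∈ Finset.range m, (1 - Polynomial.C (y i) * Polynomial.X) with hG
  have h1 : Polynomial.derivative G = - ∑ i ∈ Finset.range m,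
      Polynomial.C (y i) * ∏ i' ∈ (Finset.range m).erase i,
        (1 - Polynomial.C (y i') * Polynomial.X) := by
    rw [hG, Polynomial.derivative_prod_finset, ← Finset.sum_neg_distrib]
    refine Finset.sum_congr rfl fun i _ => ?_
    rw [Polynomial.derivative_sub, Polynomial.derivative_one, Polynomial.derivative_C_mul,
      Polynomial.derivative_X]
    ring
  have h2 : ∀ i ∈ Finset.range m, G * (Polynomial.C (y i) *
        ∑ j ∈ Finset.range m, (Polynomial.C (y i) * Polynomial.X) ^ j)
      = (Polynomial.C (y i) * ∏ i' ∈ (Finset.range m).erase i,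
          (1 - Polynomial.C (y i') * Polynomial.X)) -
        Polynomial.X ^ m * (Polynomial.C (y i ^ (m + 1)) * ∏ i' ∈ (Finset.range m).erase i,
          (1 - Polynomial.C (y i') * Polynomial.X)) := by
    intro i hi
    rw [hG, ← Finset.mul_prod_erase _ _ hi]
    have h3 : (1 - Polynomial.C (y i) * Polynomial.X) *
        ∑ j ∈ Finset.range m, (Polynomial.C (y i) * Polynomial.X) ^ j
        = 1 - (Polynomial.C (y i) * Polynomial.X) ^ m := by
      rw [mul_neg_geom_sum]
    rw [mul_pow] at h3
    rw [Polynomial.C_pow]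
    linear_combination (Polynomial.C (y i) * ∏ i' ∈ (Finset.range m).erase i,
      (1 - Polynomial.C (y i') * Polynomial.X)) * h3
  have h3 : ∑ i ∈ Finset.range m, Polynomial.C (y i) *
      ∑ j ∈ Finset.range m, (Polynomial.C (y i) * Polynomial.X) ^ j = (0 : Polynomial R) := by
    simp only [Finset.mul_sum]
    rw [Finset.sum_comm]
    refine Finset.sum_eq_zero fun j hj => ?_
    have h4 := congrArg (fun r => Polynomial.C r * (Polynomial.X : Polynomial R) ^ j)
      (h (j + 1) (by omega) (by
      have := Finset.mem_range.mp hj; omega))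
    simp only [map_sum, Polynomial.C_0, zero_mul, Finset.sum_mul] at h4
    rw [← h4]
    refine Finset.sum_congr rfl fun i _ => ?_
    rw [mul_pow, Polynomial.C_pow]; ring
  have h4 : (Polynomial.X : Polynomial R) ^ m ∣ Polynomial.derivative G := by
    have h5 := Finset.sum_congr rfl h2
    rw [← Finset.mul_sum, h3, mul_zero, Finset.sum_sub_distrib, ← Finset.mul_sum] at h5
    rw [h1, sub_eq_zero.mp h5.symm]
    exact (dvd_neg.mpr (dvd_mul_right _ _))
  have h5 : ∀ k, k + 1 ≤ m → G.coeff (k + 1) = 0 := by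
    intro k hk
    have h6 := Polynomial.X_pow_dvd_iff.mp h4 k (by omega)
    rw [Polynomial.coeff_derivative] at h6
    have h7 : IsUnit ((k : R) + 1) := by
      have : IsUnit (algebraMap ℚ R ((k : ℚ) + 1)) :=
        (IsUnit.mk0 _ (by positivity)).map (algebraMap ℚ R)
      simpa using this
    exact (h7.mul_left_eq_zero).mp h6
  have h6 : G.natDegree ≤ m := by
    refine (Polynomial.natDegree_prod_le _ _).trans ?_
    refine (Finset.sum_le_card_nsmul _ _ 1 fun i _ => ?_).trans (by simp)
    exact (Polynomial.natDegree_sub_le _ _).trans (max_le (by simp)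
      ((Polynomial.natDegree_C_mul_le _ _).trans Polynomial.natDegree_X_le))
  ext k
  rcases k with _ | k
  · rw [hG, Polynomial.coeff_zero_eq_eval_zero, Polynomial.eval_prod]; simp
  · rw [Polynomial.coeff_one, if_neg (by omega)]
    by_cases hk : k + 1 ≤ m
    · exact h5 k hk
    · exact Polynomial.coeff_eq_zero_of_natDegree_lt (by omega)

/-- The coefficients of a partial product. -/
noncomputable def tailCoeff (y : ℕ → R) (m k i : ℕ) : R :=
  (∏ j ∈ Finset.Ico i m, (1 - Polynomial.C (y j) * Polynomial.X)).coeff k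

omit [Algebra ℚ R] in
theorem tailCoeff_succ {i : ℕ} (hi : i < m) (k : ℕ) :
    tailCoeff y m (k + 1) (i + 1) = tailCoeff y m (k + 1) i + y i * tailCoeff y m k (i + 1) := by
  unfold tailCoeff
  rw [Finset.prod_eq_prod_Ico_succ_bot hi, sub_mul, one_mul, mul_assoc, Polynomial.coeff_sub,
    Polynomial.coeff_C_mul, Polynomial.coeff_X_mul]
  ring

omit [Algebra ℚ R] in
theorem tailCoeff_zero (i : ℕ) : tailCoeff y m 0 i = 1 := by
  unfold tailCoeff
  rw [Polynomial.coeff_zero_eq_eval_zero, Polynomial.eval_prod]; simp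

omit [Algebra ℚ R] in
theorem tailCoeff_eq_zero {k i : ℕ} (h : m < k + i) (hi : i ≤ m) : tailCoeff y m k i = 0 := by
  unfold tailCoeff
  refine Polynomial.coeff_eq_zero_of_natDegree_lt ?_
  refine ((Polynomial.natDegree_prod_le _ _).trans
    (Finset.sum_le_card_nsmul _ _ 1 fun j _ => ?_)).trans_lt (?_ : (Finset.Ico i m).card • 1 < k)
  · exact (Polynomial.natDegree_sub_le _ _).trans (max_le (by simp)
      ((Polynomial.natDegree_C_mul_le _ _).trans Polynomial.natDegree_X_le))
  · simp; omega

/-- Monomials of large degree vanish if the first power sums do. -/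
theorem prod_pow_eq_zero (h : ∀ j, 1 ≤ j → j ≤ m → ∑ i ∈ Finset.range m, y i ^ j = 0)
    {N : ℕ} (hN : m * (m - 1) / 2 < N) (α : ℕ → ℕ) (hα : ∑ i ∈ Finset.range m, α i = N) :
    ∏ i ∈ Finset.range m, y i ^ α i = 0 := by
  classical
  have hzero : ∀ k, tailCoeff y m (k + 1) 0 = 0 := by
    intro k
    unfold tailCoeff
    rw [← Finset.range_eq_Ico, prod_one_sub_eq_one h, Polynomial.coeff_one, if_neg (by omega)]
  set w : (ℕ → ℕ) → ℕ := fun α => ∑ i ∈ Finset.range m, i * α i with hw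
  set Y : (ℕ → ℕ) → R := fun α => ∏ i ∈ Finset.range m, y i ^ α i with hY
  set dg : (ℕ → ℕ) → ℕ := fun α => ∑ i ∈ Finset.range m, α i with hdg
  have hYs : ∀ i < m, ∀ δ e, Y (δ + Pi.single i e) = Y δ * y i ^ e := by
    intro i hi δ e
    simp only [hY, Pi.add_apply, pow_add, Finset.prod_mul_distrib]
    congr 1
    rw [Finset.prod_eq_single_of_mem i (by simpa using hi) fun j _ hj => by simp [hj]]
    simp
  have hws : ∀ i < m, ∀ δ e, w (δ + Pi.single i e) = w δ + i * e := by
    intro i hi δ e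
    simp only [hw, Pi.add_apply, mul_add, Finset.sum_add_distrib]
    congr 1
    rw [Finset.sum_eq_single_of_mem i (by simpa using hi) fun j _ hj => by simp [hj]]
    simp
  have hds : ∀ i < m, ∀ δ e, dg (δ + Pi.single i e) = dg δ + e := by
    intro i hi δ e
    simp only [hdg, Pi.add_apply, Finset.sum_add_distrib]
    congr 1
    rw [Finset.sum_eq_single_of_mem i (by simpa using hi) fun j _ hj => by simp [hj]]
    simp
  suffices H : ∀ W, ∀ α, w α = W → dg α = N → Y α = 0 from H _ α rfl hα
  intro W
  induction W using Nat.strong_induction_on with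
  | _ W IH =>
  have hA : ∀ i ≤ m, ∀ k, ∀ δ, dg δ + (k + 1) = N → w δ + (k + 1) * (i - 1) < W →
      Y δ * tailCoeff y m (k + 1) i = 0 := by
    intro i
    induction i with
    | zero => intro _ k δ _ _; rw [hzero, mul_zero]
    | succ i ihi =>
      intro hi k
      induction k with
      | zero =>
        intro δ h1 h2
        rw [tailCoeff_succ (by omega), mul_add, ihi (by omega) 0 δ h1 (by
          refine lt_of_le_of_lt ?_ h2; gcongr; omega), zero_add, tailCoeff_zero, mul_one]
        have := hYs i (by omega) δ 1
        rw [pow_one] at this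
        rw [← this]
        refine IH _ ?_ _ rfl ?_
        · rw [hws i (by omega)]; simpa using h2
        · rw [hds i (by omega)]; simpa using h1
      | succ k ihk =>
        intro δ h1 h2
        rw [tailCoeff_succ (by omega), mul_add, ihi (by omega) (k + 1) δ h1 (by
          refine lt_of_le_of_lt ?_ h2; gcongr; omega), zero_add, ← mul_assoc]
        have := hYs i (by omega) δ 1
        rw [pow_one] at this
        rw [← this]
        refine ihk _ ?_ ?_
        · rw [hds i (by omega)]; omega
        · rw [hws i (by omega)]
          simp only [Nat.add_sub_cancel] at h2 ⊢
          refine lt_of_eq_of_lt ?_ h2; ring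
  intro α hαW hαN
  obtain ⟨i, hi, hiα⟩ : ∃ i < m, m - i ≤ α i := by
    by_contra! hcon
    have h1 : dg α ≤ ∑ i ∈ Finset.range m, (m - 1 - i) := by
      refine Finset.sum_le_sum fun i hi => ?_
      have := hcon i (by simpa using hi)
      omega
    rw [Finset.sum_range_reflect (fun i => i) m, Finset.sum_range_id] at h1
    omega
  have hB : ∀ k, ∀ δ, dg δ + k = N → w δ + i * k = W →
      Y δ * tailCoeff y m k (i + 1) = Y δ * y i ^ k := by
    intro k
    induction k with
    | zero => intro δ _ _; rw [tailCoeff_zero, pow_zero]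
    | succ k ih =>
      intro δ h1 h2
      have h3 : Y δ * tailCoeff y m (k + 1) i = 0 := by
        rcases Nat.eq_zero_or_pos i with rfl | hpos
        · rw [hzero, mul_zero]
        · refine hA i hi.le k δ h1 ?_
          rw [← h2, mul_comm]
          have : (i - 1) * (k + 1) < i * (k + 1) := Nat.mul_lt_mul_of_pos_right (by omega) (by omega)
          omega
      rw [tailCoeff_succ hi, mul_add, h3, zero_add, ← mul_assoc]
      have h4 := hYs i hi δ 1
      rw [pow_one] at h4
      rw [← h4, ih _ (by rw [hds i hi]; omega) (by rw [hws i hi]; rw [← h2]; ring), h4, pow_succ]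
      ring
  set γ : ℕ → ℕ := Function.update α i (α i - (m - i)) with hγ
  have e : α = γ + Pi.single i (m - i) := by
    funext j
    by_cases hj : j = i
    · subst hj; simp [hγ]; omega
    · simp [hγ, hj]
  have h1 := hB (m - i) γ (by rw [← hds i hi, ← e, hαN]) (by rw [← hws i hi, ← e, hαW])
  rw [e, hYs i hi, ← h1, tailCoeff_eq_zero (by omega) (by omega), mul_zero]

/-- Monomials of large degree vanish if the first power sums do. -/
theorem prod_pow_eq_zero_of_psum {κ : Type*} (S : Finset κ) (z : κ → R)
    (h : ∀ j, 1 ≤ j → j ≤ S.card → ∑ a ∈ S, z a ^ j = 0) (α : κ → ℕ)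
    (hα : S.card * (S.card - 1) / 2 < ∑ a ∈ S, α a) : ∏ a ∈ S, z a ^ α a = 0 := by
  classical
  let e := S.equivFin
  let y : ℕ → R := fun i => if h : i < S.card then z (e.symm ⟨i, h⟩) else 0
  let β : ℕ → ℕ := fun i => if h : i < S.card then α (e.symm ⟨i, h⟩) else 0
  have key : ∑ a ∈ S, α a = ∑ i ∈ Finset.range S.card, β i := by
    rw [Finset.sum_range, ← Finset.sum_coe_sort S, ← e.symm.sum_comp]
    simp [β]
  have key' : ∏ a ∈ S, z a ^ α a = ∏ i ∈ Finset.range S.card, y i ^ β i := by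
    rw [Finset.prod_range, ← Finset.prod_coe_sort S, ← e.symm.prod_comp]
    simp [y, β]
  rw [key']
  refine prod_pow_eq_zero (N := ∑ a ∈ S, α a) ?_ hα β key.symm
  intro j h1 h2
  rw [← h j h1 h2, Finset.sum_range, ← Finset.sum_coe_sort S, ← e.symm.sum_comp]
  simp [y]

end Coinvariant

end Arrangement

namespace Arrangement

variable {n : ℕ}

/-- The quotient of `x ^ (j + 1) - y ^ (j + 1)` by `x - y`. -/
def gsum {R : Type*} [CommRing R] (x y : R) (j : ℕ) : R :=
  ∑ i ∈ Finset.range (j + 1), x ^ i * y ^ (j - i)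

theorem sub_mul_gsum {R : Type*} [CommRing R] (x y : R) (j : ℕ) :
    x ^ (j + 1) - y ^ (j + 1) = (x - y) * gsum x y j := by
  rw [mul_comm, gsum]
  exact (geom_sum₂_mul x y (j + 1)).symm

theorem gsum_comm {R : Type*} [CommRing R] (x y : R) (j : ℕ) : gsum x y j = gsum y x j := by
  unfold gsum
  rw [← Finset.sum_range_reflect]
  refine Finset.sum_congr rfl fun i hi => ?_
  have : i ≤ j := by have := Finset.mem_range.mp hi; omega
  rw [mul_comm, show j + 1 - 1 - i = j - i by omega, Nat.sub_sub_self this]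

theorem gsum_zero_left {R : Type*} [CommRing R] (y : R) (j : ℕ) : gsum 0 y j = y ^ j := by
  unfold gsum
  rw [Finset.sum_eq_single_of_mem 0 (by simp) fun i _ hi => by rw [zero_pow hi, zero_mul]]
  simp

theorem map_gsum {R R' : Type*} [CommRing R] [CommRing R'] (f : R →+* R') (x y : R) (j : ℕ) :
    f (gsum x y j) = gsum (f x) (f y) j := by simp [gsum]

theorem sum_edges_star {M : Type*} [AddCommGroup M] [Module ℂ M] {I : Finset (Fin n)} {a₀ : Fin n}
    (h₀ : a₀ ∈ I) (f : Fin n → M) :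
    ∑ e ∈ edges I, (if e.1.1 = a₀ then f e.1.2 else if e.1.2 = a₀ then f e.1.1 else 0)
      = ∑ a ∈ I.erase a₀, f a := by
  classical
  have h1 := sum_sum_sv I (fun a b => if a = b then 0 else if a = a₀ then f b else
    if b = a₀ then f a else 0) (fun a b => by
      by_cases hab : a = b
      · simp [hab]
      · rw [if_neg hab, if_neg (Ne.symm hab)]
        split_ifs with h h' <;> first | rfl | (exact absurd (h.trans h'.symm) hab)) (by simp)
  have h2 : ∀ e ∈ edges I, (if e.1.1 = e.1.2 then 0 else if e.1.1 = a₀ then f e.1.2 else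
      if e.1.2 = a₀ then f e.1.1 else 0) = (if e.1.1 = a₀ then f e.1.2 else
      if e.1.2 = a₀ then f e.1.1 else 0) := fun e _ => if_neg e.2.ne
  rw [Finset.sum_congr rfl h2] at h1
  have h3 : ∑ a ∈ I, ∑ b ∈ I, (if a = b then 0 else if a = a₀ then f b else
      if b = a₀ then f a else 0) = 2 • ∑ a ∈ I.erase a₀, f a := by
    rw [← Finset.add_sum_erase I _ h₀, two_nsmul]
    congr 1
    · rw [← Finset.add_sum_erase I _ h₀]
      simp only [if_true, zero_add]
      refine Finset.sum_congr rfl fun b hb => ?_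
      rw [if_neg (Finset.ne_of_mem_erase hb).symm]
    · refine Finset.sum_congr rfl fun a ha => ?_
      have ha' := Finset.ne_of_mem_erase ha
      rw [Finset.sum_eq_single_of_mem a₀ h₀ fun b _ hb => by simp [hb, ha']]
      simp [ha']
  rw [h1] at h3
  have h4 := congrArg (fun x => (1 / 2 : ℂ) • x) h3
  simpa [← Nat.cast_smul_eq_nsmul ℂ, smul_smul] using h4

section Local

variable (I : Finset (Fin n)) (a₀ : Fin n)

/-- The local coordinate of index `a`. -/
noncomputable def yy (R : Type*) [CommRing R] (a : Fin n) : MvPolynomial ↥(I.erase a₀) R :=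
  if h : a ∈ I.erase a₀ then X ⟨a, h⟩ else 0

/-- The multiplier of the vector field `∑ y_a ^ (j + 1) ∂_a`. -/
noncomputable def HH {R : Type*} [CommRing R] (t : BraidIdx n → R) (j : ℕ) :
    MvPolynomial ↥(I.erase a₀) R :=
  ∑ e ∈ edges I, C (t e) * gsum (yy I a₀ R e.1.1) (yy I a₀ R e.1.2) j

variable {I a₀}

theorem yy_isHomogeneous {R : Type*} [CommRing R] (a : Fin n) : (yy I a₀ R a).IsHomogeneous 1 := by
  unfold yy
  split_ifs
  · exact isHomogeneous_X _ _
  · exact isHomogeneous_zero _ _ _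

theorem HH_isHomogeneous {R : Type*} [CommRing R] (t : BraidIdx n → R) (j : ℕ) :
    (HH I a₀ t j).IsHomogeneous j := by
  unfold HH gsum
  refine IsHomogeneous.sum _ _ _ fun e _ => ?_
  refine IsHomogeneous.C_mul (IsHomogeneous.sum _ _ _ fun i hi => ?_) _
  have h : i + (j - i) = j := by have := Finset.mem_range.mp hi; omega
  have := ((yy_isHomogeneous (R := R) (I := I) (a₀ := a₀) e.1.1).pow i).mul
    ((yy_isHomogeneous (R := R) (I := I) (a₀ := a₀) e.1.2).pow (j - i))
  rwa [one_mul, one_mul, h] at this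

theorem map_yy {R R' : Type*} [CommRing R] [CommRing R'] (f : R →+* R') (a : Fin n) :
    MvPolynomial.map f (yy I a₀ R a) = yy I a₀ R' a := by
  unfold yy
  split_ifs <;> simp

theorem map_HH {R R' : Type*} [CommRing R] [CommRing R'] (f : R →+* R') (t : BraidIdx n → R)
    (j : ℕ) : MvPolynomial.map f (HH I a₀ t j) = HH I a₀ (fun e => f (t e)) j := by
  simp [HH, map_gsum, map_yy]

theorem HH_add_smul {R : Type*} [CommRing R] (t t' : BraidIdx n → R) (r : R) (j : ℕ) :
    HH I a₀ (fun e => t e + r * t' e) j = HH I a₀ t j + C r * HH I a₀ t' j := by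
  unfold HH
  rw [Finset.mul_sum, ← Finset.sum_add_distrib]
  refine Finset.sum_congr rfl fun e _ => ?_
  rw [C_add, C_mul]; ring

/-- The direction in the space of exponents. -/
noncomputable def starDir (I : Finset (Fin n)) (a₀ a₁ : Fin n) (e : BraidIdx n) : ℂ :=
  if e.1.1 = a₀ then (if e.1.2 = a₁ then -((I.card - 2 : ℕ) : ℂ) else 1) else
    if e.1.2 = a₀ then (if e.1.1 = a₁ then -((I.card - 2 : ℕ) : ℂ) else 1) else 0

theorem sum_starDir {a₁ : Fin n} (h₀ : a₀ ∈ I) (h₁ : a₁ ∈ I.erase a₀) :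
    ∑ e ∈ edges I, starDir I a₀ a₁ e = 0 := by
  unfold starDir
  rw [sum_edges_star h₀ (fun a => if a = a₁ then -((I.card - 2 : ℕ) : ℂ) else 1),
    ← Finset.add_sum_erase _ _ h₁, if_pos rfl,
    Finset.sum_congr rfl fun a ha => if_neg (Finset.ne_of_mem_erase ha)]
  simp [Finset.card_erase_of_mem h₁, Finset.card_erase_of_mem h₀, Nat.sub_sub]

theorem HH_starDir {a₁ : Fin n} (h₀ : a₀ ∈ I) (h₁ : a₁ ∈ I.erase a₀) (j : ℕ) :
    HH I a₀ (starDir I a₀ a₁) j = ∑ a ∈ Finset.univ.erase (⟨a₁, h₁⟩ : ↥(I.erase a₀)), X a ^ j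
      - C ((I.card - 2 : ℕ) : ℂ) * X ⟨a₁, h₁⟩ ^ j := by
  classical
  have h2 : HH I a₀ (starDir I a₀ a₁) j = ∑ a ∈ I.erase a₀,
      C (if a = a₁ then -((I.card - 2 : ℕ) : ℂ) else 1) * yy I a₀ ℂ a ^ j := by
    rw [← sum_edges_star h₀, HH]
    refine Finset.sum_congr rfl fun e _ => ?_
    have hy : yy I a₀ ℂ a₀ = 0 := by simp [yy]
    unfold starDir
    split_ifs with h h' h' h'' <;> first
      | (simp only [h, hy, gsum_zero_left])
      | (simp only [h', hy, gsum_comm _ (0 : MvPolynomial ↥(I.erase a₀) ℂ), gsum_zero_left])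
      | simp
  rw [h2, ← Finset.sum_coe_sort (I.erase a₀), ← Finset.add_sum_erase _ _ (Finset.mem_univ ⟨a₁, h₁⟩)]
  have h3 : ∀ a : ↥(I.erase a₀), yy I a₀ ℂ a = X a := fun a => by
    unfold yy; rw [dif_pos a.2]
  rw [add_comm, Finset.sum_congr rfl fun (a : ↥(I.erase a₀)) ha => by
    rw [if_neg fun h => Finset.ne_of_mem_erase ha (Subtype.ext h), C_1, one_mul, h3]]
  rw [h3 ⟨a₁, h₁⟩]
  simp [sub_eq_add_neg]

theorem homogeneousComponent_mul {σ R : Type*} [CommRing R] {f g : MvPolynomial σ R} {i d : ℕ}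
    (hf : f.IsHomogeneous i) (h : i ≤ d) :
    homogeneousComponent d (f * g) = f * homogeneousComponent (d - i) g := by
  classical
  let _ := gradedAlgebra (R := R) (σ := σ)
  have := DirectSum.coe_decompose_mul_of_left_mem_of_le (homogeneousSubmodule σ R) (b := g)
    (by exact hf : f ∈ homogeneousSubmodule σ R i) h
  erw [decomposition.decompose'_apply, decomposition.decompose'_apply] at this
  exact this

theorem exists_eq_sum_HH {a₁ : Fin n} (h₀ : a₀ ∈ I) (h₁ : a₁ ∈ I.erase a₀) {d : ℕ}
    (hd : (I.card - 2) * (I.card - 2 - 1) / 2 < d) (β : ↥(I.erase a₀) →₀ ℕ) (hβ : ∑ a, β a = d) :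
    ∃ (q : ℕ → MvPolynomial ↥(I.erase a₀) ℂ) (p : MvPolynomial ↥(I.erase a₀) ℂ),
      (∀ j ∈ Finset.Icc 1 (I.card - 2), j ≤ d ∧ (q j).IsHomogeneous (d - j)) ∧
      p.IsHomogeneous (d - 1) ∧
      monomial β 1 = ∑ j ∈ Finset.Icc 1 (I.card - 2), HH I a₀ (starDir I a₀ a₁) j * q j
        + X ⟨a₁, h₁⟩ * p := by
  classical
  set m := I.card - 2 with hm
  set J : Ideal (MvPolynomial ↥(I.erase a₀) ℂ) := Ideal.span (insert (X ⟨a₁, h₁⟩)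
    (HH I a₀ (starDir I a₀ a₁) '' ↑(Finset.Icc 1 m))) with hJ
  have hX : Ideal.Quotient.mk J (X ⟨a₁, h₁⟩) = 0 :=
    Ideal.Quotient.eq_zero_iff_mem.mpr (Ideal.subset_span (Set.mem_insert _ _))
  have hβeq : monomial β (1 : ℂ) = ∏ a, X a ^ β a := by
    rw [monomial_eq, Finsupp.prod_fintype _ _ (by simp), C_1, one_mul]
  set S := Finset.univ.erase (⟨a₁, h₁⟩ : ↥(I.erase a₀)) with hS
  have hcard : S.card = m := by
    rw [hS, Finset.card_erase_of_mem (Finset.mem_univ _), Finset.card_univ, Fintype.card_coe,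
      Finset.card_erase_of_mem h₀, hm]; omega
  have hmd : m ≤ d := by
    rcases Nat.lt_or_ge m 2 with h | h
    · interval_cases m <;> omega
    · have : m - 1 ≤ m * (m - 1) / 2 := by
        rw [Nat.le_div_iff_mul_le (by norm_num)]; nlinarith
      omega
  have hmem : monomial β 1 ∈ J := by
    rw [← Ideal.Quotient.eq_zero_iff_mem, hβeq, map_prod,
      ← Finset.mul_prod_erase _ _ (Finset.mem_univ ⟨a₁, h₁⟩)]
    by_cases h : β ⟨a₁, h₁⟩ = 0
    · have := prod_pow_eq_zero_of_psum S (fun a => Ideal.Quotient.mk J (X a)) (fun j h1 h2 => by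
        have h3 : Ideal.Quotient.mk J (HH I a₀ (starDir I a₀ a₁) j) = 0 :=
          Ideal.Quotient.eq_zero_iff_mem.mpr (Ideal.subset_span (Set.mem_insert_of_mem _
            ⟨j, by simp; omega, rfl⟩))
        rw [HH_starDir h₀ h₁, map_sub, map_mul, map_pow, hX, zero_pow (by omega), mul_zero,
          sub_zero] at h3
        rw [← h3]; simp [hS]) (fun a => β a) (by
        rw [hcard]
        rw [← Finset.add_sum_erase _ _ (Finset.mem_univ ⟨a₁, h₁⟩), h, zero_add] at hβ
        rw [hS, hβ]; exact hd)
      simp only [map_pow]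
      rw [← hS, this, mul_zero]
    · rw [map_pow, hX, zero_pow h, zero_mul]
  rw [hJ, Ideal.mem_span_insert] at hmem
  obtain ⟨p, z, hz, he⟩ := hmem
  obtain ⟨q', hq'⟩ := (Submodule.mem_span_image_finset_iff_exists_fun _).mp hz
  obtain ⟨q, hq⟩ : ∃ q : ℕ → MvPolynomial ↥(I.erase a₀) ℂ,
      ∑ j ∈ Finset.Icc 1 m, q j • HH I a₀ (starDir I a₀ a₁) j = z := by
    refine ⟨fun j => if h : j ∈ Finset.Icc 1 m then q' ⟨j, h⟩ else 0, ?_⟩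
    rw [← hq', ← Finset.sum_coe_sort]
    refine Finset.sum_congr rfl fun j _ => ?_
    simp only [dif_pos j.2]
  have hd1 : 1 ≤ d := by omega
  refine ⟨fun j => homogeneousComponent (d - j) (q j), homogeneousComponent (d - 1) p,
    fun j hj => ⟨by have := (Finset.mem_Icc.mp hj).2; omega, homogeneousComponent_isHomogeneous _ _⟩,
    homogeneousComponent_isHomogeneous _ _, ?_⟩
  have h2 : homogeneousComponent d (monomial β (1 : ℂ)) = monomial β 1 := by
    refine homogeneousComponent_of_mem ?_ |>.trans (if_pos rfl)
    refine isHomogeneous_monomial _ ?_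
    rw [Finsupp.degree_eq_sum, hβ]
  rw [← h2, he, ← hq, map_add, map_sum, mul_comm p, homogeneousComponent_mul (isHomogeneous_X _ _) hd1,
    add_comm]
  congr 1
  refine Finset.sum_congr rfl fun j hj => ?_
  rw [smul_eq_mul, mul_comm (q j), homogeneousComponent_mul (HH_isHomogeneous _ _)
    (by have := (Finset.mem_Icc.mp hj).2; omega)]

end Local

end Arrangement

namespace Arrangement

open scoped Pointwise

variable {n : ℕ}

/-- The product of the linear forms of the pairs in `B`. -/
noncomputable def prodl (B : Finset (BraidIdx n)) : BA n := ∏ q ∈ B, (xv q.1.1 - xv q.1.2)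

section Local

variable {I : Finset (Fin n)} {a₀ : Fin n}

/-- Substitution of the differences of coordinates. -/
noncomputable def evl (I : Finset (Fin n)) (a₀ : Fin n) : MvPolynomial ↥(I.erase a₀) (SR n) →+* BA n :=
  eval₂Hom (rho n : SR n →+* BA n) (fun a => xv a - xv a₀)

theorem evl_C (c : SR n) : evl I a₀ (C c) = rho n c := by simp [evl]

theorem evl_X (a : ↥(I.erase a₀)) : evl I a₀ (X a) = xv a - xv a₀ := by simp [evl]

theorem evl_yy {a : Fin n} (ha : a ∈ I) : evl I a₀ (yy I a₀ (SR n) a) = xv a - xv a₀ := by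
  unfold yy
  split_ifs with h
  · rw [evl_X]
  · have : a = a₀ := by by_contra h'; exact h (Finset.mem_erase.mpr ⟨h', ha⟩)
    rw [this, map_zero, sub_self]

theorem dd_evl (a : ↥(I.erase a₀)) (f : MvPolynomial ↥(I.erase a₀) (SR n)) :
    dd a (evl I a₀ f) = evl I a₀ (pderiv a f) := by
  classical
  induction f using MvPolynomial.induction_on with
  | C c => simp [evl_C]
  | add p q hp hq => simp only [map_add, hp, hq]
  | mul_X p b hp =>
    rw [map_mul, Derivation.leibniz, Derivation.leibniz, hp, evl_X, map_add, pderiv_X]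
    have h0 : (a : Fin n) ≠ a₀ := Finset.ne_of_mem_erase a.2
    simp only [smul_eq_mul, map_mul, evl_X, map_sub, dd_xv, h0, if_false, sub_zero]
    rcases eq_or_ne a b with rfl | h
    · simp
    · rw [Pi.single_eq_of_ne (Ne.symm h), if_neg (fun h' => h (Subtype.ext h'))]
      simp

theorem evl_HH (t : BraidIdx n → SR n) (j : ℕ) :
    evl I a₀ (HH I a₀ t j)
      = ∑ e ∈ edges I, rho n (t e) * gsum (xv e.1.1 - xv a₀) (xv e.1.2 - xv a₀) j := by
  rw [HH, map_sum]
  refine Finset.sum_congr rfl fun e he => ?_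
  rw [mem_edges] at he
  rw [map_mul, evl_C, map_gsum, evl_yy he.1, evl_yy he.2]

theorem sum_mul_dd_prodl (B : Finset (BraidIdx n)) (hB : B ⊆ edges I) (j : ℕ) :
    ∑ a ∈ I, (xv a - xv a₀) ^ (j + 1) * dd a (prodl B)
      = prodl B * ∑ e ∈ B, gsum (xv e.1.1 - xv a₀) (xv e.1.2 - xv a₀) j := by
  classical
  induction B using Finset.induction_on with
  | empty => simp [prodl]
  | insert e B he ih =>
    have h := ih fun q hq => hB (Finset.mem_insert_of_mem hq)
    have he' := mem_edges.mp (hB (Finset.mem_insert_self e B))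
    have h1 : (prodl (insert e B) : BA n) = (xv e.1.1 - xv e.1.2) * prodl B := by
      rw [prodl, Finset.prod_insert he]; rfl
    rw [h1, Finset.sum_insert he]
    have h2 := sub_mul_gsum (xv e.1.1 - xv a₀ : BA n) (xv e.1.2 - xv a₀) j
    simp only [Derivation.leibniz, smul_eq_mul, mul_add, Finset.sum_add_distrib, map_sub, dd_xv]
    have h3 : ∑ a ∈ I, (xv a - xv a₀) ^ (j + 1) * ((xv e.1.1 - xv e.1.2) * dd a (prodl B))
        = (xv e.1.1 - xv e.1.2) *
          (prodl B * ∑ e ∈ B, gsum (xv e.1.1 - xv a₀) (xv e.1.2 - xv a₀) j) := by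
      rw [← h, Finset.mul_sum]
      exact Finset.sum_congr rfl fun a _ => by ring
    rw [h3]
    have h4 : ∑ a ∈ I, (xv a - xv a₀ : BA n) ^ (j + 1) * (prodl B *
        ((if a = e.1.1 then 1 else 0) - if a = e.1.2 then 1 else 0))
        = prodl B * ((xv e.1.1 - xv a₀) ^ (j + 1) - (xv e.1.2 - xv a₀) ^ (j + 1)) := by
      simp only [mul_sub, mul_ite, mul_one, mul_zero, Finset.sum_sub_distrib, Finset.sum_ite_eq',
        he'.1, he'.2, if_true]
      ring
    rw [h4, h2]
    ring

/-- The action of the vector field `∑ y_a ^ (j + 1) ∂_a` with exponents `t`. -/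
noncomputable def theta {R : Type*} [CommRing R] (t : BraidIdx n → R) (j : ℕ)
    (q : MvPolynomial ↥(I.erase a₀) R) : MvPolynomial ↥(I.erase a₀) R :=
  ∑ a, pderiv a (X a ^ (j + 1) * q) + HH I a₀ t j * q

theorem map_theta {R R' : Type*} [CommRing R] [CommRing R'] (f : R →+* R') (t : BraidIdx n → R) (j : ℕ)
    (q : MvPolynomial ↥(I.erase a₀) R) :
    MvPolynomial.map f (theta t j q) = theta (fun e => f (t e)) j (MvPolynomial.map f q) := by
  simp [theta, map_HH, pderiv_map]

theorem theta_add_smul {R : Type*} [CommRing R] (t t' : BraidIdx n → R) (r : R) (j : ℕ)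
    (q : MvPolynomial ↥(I.erase a₀) R) :
    theta (fun e => t e + r * t' e) j q = theta t j q + C r * (HH I a₀ t' j * q) := by
  rw [theta, theta, HH_add_smul]; ring

theorem theta_isHomogeneous {R : Type*} [CommRing R] (t : BraidIdx n → R) {j d : ℕ} (hj : j ≤ d)
    {q : MvPolynomial ↥(I.erase a₀) R} (hq : q.IsHomogeneous (d - j)) :
    (theta t j q).IsHomogeneous d := by
  refine IsHomogeneous.add (IsHomogeneous.sum _ _ _ fun a _ => ?_) ?_
  · have := (((isHomogeneous_X R a).pow (j + 1)).mul hq).pderiv (i := a)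
    rwa [show 1 * (j + 1) + (d - j) - 1 = d by omega] at this
  · have := (HH_isHomogeneous (I := I) (a₀ := a₀) t j).mul hq
    rwa [show j + (d - j) = d by omega] at this

theorem evl_mem {f : MvPolynomial ↥(I.erase a₀) (SR n)} {d : ℕ} (hf : f.IsHomogeneous d) :
    evl I a₀ f ∈ Ideal.span (Sat.diffs I a₀) ^ d := by
  rw [f.as_sum, map_sum]
  refine sum_mem fun β hβ => ?_
  have h1 : ∑ a, β a = d := by
    rw [← Finsupp.degree_eq_sum]
    by_contra h
    exact (mem_support_iff.mp hβ) (hf.coeff_eq_zero h)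
  rw [monomial_eq, map_mul, Finsupp.prod_fintype _ _ (by simp), map_prod, ← h1,
    ← Finset.prod_pow_eq_pow_sum]
  refine Ideal.mul_mem_left _ _ (Ideal.prod_mem_prod fun a _ => ?_)
  rw [map_pow, evl_X]
  exact Ideal.pow_mem_pow (Ideal.subset_span
    (show xv (a : Fin n) - xv a₀ ∈ Sat.diffs I a₀ from ⟨a, Finset.mem_of_mem_erase a.2, rfl⟩)) _

theorem mem_diffs_pow {d : ℕ} : ∀ {h : BA n}, h ∈ Sat.diffs I a₀ ^ d →
    h = 0 ∨ ∃ β : ↥(I.erase a₀) →₀ ℕ, ∑ a, β a = d ∧ h = evl I a₀ (monomial β 1) := by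
  induction d with
  | zero =>
    intro h hh
    rw [pow_zero] at hh
    obtain rfl := hh
    exact Or.inr ⟨0, by simp, by simp⟩
  | succ d ih =>
    intro h hh
    rw [pow_succ] at hh
    obtain ⟨g, hg, y, ⟨b, hb, rfl⟩, rfl⟩ := Set.mem_mul.mp hh
    have hb : b ∈ I := hb
    rcases ih hg with rfl | ⟨β, hβ, rfl⟩
    · left; simp
    by_cases h : b = a₀
    · left; simp [h]
    have hb' : b ∈ I.erase a₀ := Finset.mem_erase.mpr ⟨h, hb⟩
    refine Or.inr ⟨β + Finsupp.single ⟨b, hb'⟩ 1, ?_, ?_⟩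
    · simp only [Finsupp.add_apply, Finset.sum_add_distrib, hβ]
      rw [← Finsupp.degree_eq_sum]; simp
    · have h1 : (xv b - xv a₀ : BA n) = evl I a₀ (X ⟨b, hb'⟩) := by rw [evl_X]
      change evl I a₀ (monomial β 1) * (xv b - xv a₀) = _
      rw [h1, ← RingHom.map_mul, X, monomial_mul, one_mul]

theorem span_diffs_eq {a₁ : Fin n} (h₀ : a₀ ∈ I) (h₁ : a₁ ∈ I) :
    Ideal.span (Sat.diffs I a₀) = Ideal.span (Sat.diffs I a₁) := by
  have key : ∀ {a b : Fin n}, a ∈ I → b ∈ I →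
      Ideal.span (Sat.diffs I a) ≤ Ideal.span (Sat.diffs I b) := by
    intro a b ha _
    rw [Ideal.span_le]
    rintro _ ⟨c, hc, rfl⟩
    have : (xv c - xv a : BA n) = (xv c - xv b) - (xv a - xv b) := by ring
    simp only [this]
    exact sub_mem (Ideal.subset_span ⟨c, hc, rfl⟩) (Ideal.subset_span ⟨a, ha, rfl⟩)
  exact le_antisymm (key h₀ h₁) (key h₁ h₀)

theorem prodl_mem (B : Finset (BraidIdx n)) (hB : B ⊆ edges I) :
    prodl B ∈ Ideal.span (Sat.diffs I a₀) ^ B.card := by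
  rw [prodl, ← Finset.prod_const]
  refine Ideal.prod_mem_prod fun q hq => ?_
  have := mem_edges.mp (hB hq)
  have h : (xv q.1.1 - xv q.1.2 : BA n) = (xv q.1.1 - xv a₀) - (xv q.1.2 - xv a₀) := by ring
  rw [h]
  exact sub_mem (Ideal.subset_span ⟨_, this.1, rfl⟩) (Ideal.subset_span ⟨_, this.2, rfl⟩)

end Local

theorem card_edges (I : Finset (Fin n)) : 2 * (edges I).card = I.card * (I.card - 1) := by
  classical
  have h := sum_sum_sv (M := ℕ) I (fun a b => if a = b then 0 else 1)
    (fun a b => by simp only [eq_comm]) (by simp)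
  rw [Finset.sum_congr rfl fun (q : BraidIdx n) _ => if_neg q.2.ne] at h
  rw [smul_eq_mul, Finset.sum_const, smul_eq_mul, mul_one] at h
  rw [← h]
  have h2 : ∀ a ∈ I, ∑ b ∈ I, (if a = b then 0 else 1) = I.card - 1 := fun a ha => by
    rw [← Finset.card_erase_of_mem ha, Finset.card_eq_sum_ones, ← Finset.add_sum_erase I _ ha,
      if_pos rfl, zero_add]
    exact Finset.sum_congr rfl fun b hb => if_neg (Finset.ne_of_mem_erase hb).symm
  rw [Finset.sum_congr rfl h2, Finset.sum_const, smul_eq_mul]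

theorem coeff_single_lin {I : Finset (Fin n)} (k : ℕ) {e : BraidIdx n} (he : e ∈ edges I) :
    coeff (Finsupp.single e 1) (lin I k) = 1 := by
  classical
  rw [lin, coeff_add, coeff_sum, coeff_C, if_neg (by simp [eq_comm]), add_zero,
    Finset.sum_eq_single_of_mem e he fun b _ hb => ?_, coeff_X, if_pos rfl]
  rw [coeff_X, if_neg]
  simpa [Finsupp.single_left_inj] using hb

theorem totalDegree_lin {I : Finset (Fin n)} (hI : 2 ≤ I.card) (k : ℕ) : (lin I k).totalDegree = 1 := by
  classical
  refine le_antisymm ?_ ?_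
  · refine (totalDegree_add _ _).trans (max_le ?_ (by rw [totalDegree_C]; exact Nat.zero_le 1))
    exact totalDegree_finsetSum_le fun q _ => by simp
  · have h : 0 < (edges I).card := by
      have := card_edges I
      have : 0 < I.card * (I.card - 1) := Nat.mul_pos (by omega) (by omega)
      omega
    obtain ⟨e, he⟩ := Finset.card_pos.mp h
    have hc := coeff_single_lin k he
    have := le_totalDegree (p := lin I k) (s := Finsupp.single e 1)
      (mem_support_iff.mpr (by rw [hc]; exact one_ne_zero))
    simpa using this

theorem irreducible_lin {I : Finset (Fin n)} (hI : 2 ≤ I.card) (k : ℕ) : Irreducible (lin I k) := by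
  classical
  refine irreducible_of_totalDegree_eq_one (totalDegree_lin hI k) fun x hx => ?_
  have h : 0 < (edges I).card := by
    have := card_edges I
    have : 0 < I.card * (I.card - 1) := Nat.mul_pos (by omega) (by omega)
    omega
  obtain ⟨e, he⟩ := Finset.card_pos.mp h
  have hc := coeff_single_lin k he
  have := hx (Finsupp.single e 1)
  rw [hc] at this
  exact isUnit_of_dvd_one this

theorem lin_dvd_of_dvd {I : Finset (Fin n)} (hI : 2 ≤ I.card) {k : ℕ} {ϖ : SR n} (hϖ : Prime ϖ)
    (h : ϖ ∣ lin I k) : lin I k ∣ ϖ :=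
  (hϖ.irreducible.associated_of_dvd (irreducible_lin hI k) h).symm.dvd

theorem eval_lin (I : Finset (Fin n)) (k : ℕ) (s : BraidIdx n → ℂ) :
    eval s (lin I k) = ∑ q ∈ edges I, s q + ((I.card : ℂ) - 1 + k) := by
  simp [lin]

section Main

variable {L : Type} [CommRing L] [Algebra (BA n) L]

local notation "φ" => algebraMap (BA n) L

namespace Sat

variable {D : Fin n → L →+ L} {E : Submodule (BA n) L} (hS : Setting D E)
  {ϖ : SR n} {G : BA n} {V : Submodule (BA n) L} (hV : Sat D ϖ G V)
include hS hV

theorem prodl_mul_evl_theta_mem {I : Finset (Fin n)} {a₀ : Fin n} (h₀ : a₀ ∈ I)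
    (hG : ∀ a ∈ I, ∀ b ∉ I, xv a - xv b ∣ G) {B : Finset (BraidIdx n)} (hB : B ⊆ edges I) (j : ℕ)
    (q : MvPolynomial ↥(I.erase a₀) (SR n))
    (hh : ∀ a ∈ I, φ ((xv a - xv a₀) ^ (j + 1) * (prodl B * evl I a₀ q)) ∈ V) :
    φ (prodl B * evl I a₀ (theta (fun e => X e + if e ∈ B then 1 else 0) j q)) ∈ V := by
  classical
  have h := hV.divergence_mem hS I hG (fun a => (xv a - xv a₀) ^ (j + 1))
    (fun a b => gsum (xv a - xv a₀) (xv b - xv a₀) j)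
    (fun a _ b _ => by rw [sub_mul_gsum]; ring) _ hh
  convert h using 2
  have e1 : ∑ a ∈ I, ∑ b ∈ I, rho n (sv a b) * gsum (xv a - xv a₀) (xv b - xv a₀) j
      = 2 • ∑ e ∈ edges I, rho n (X e) * gsum (xv e.1.1 - xv a₀) (xv e.1.2 - xv a₀) j := by
    rw [sum_sum_sv I _ (fun a b => by rw [sv_symm, gsum_comm]) (by simp)]
    congr 1
    exact Finset.sum_congr rfl fun q _ => by rw [sv_of_lt q.2]
  have h4 : (C (1 / 2) : BA n) * ((2 : ℕ) : BA n) = 1 := by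
    rw [← map_natCast (C (σ := Fin n ⊕ BraidIdx n)), ← map_mul]; norm_num
  rw [e1, nsmul_eq_mul, ← mul_assoc (C (1 / 2)), h4, one_mul]
  have e2 : ∑ a ∈ I, dd a ((xv a - xv a₀) ^ (j + 1) * (prodl B * evl I a₀ q))
      = (∑ a ∈ I, (xv a - xv a₀) ^ (j + 1) * dd a (prodl B)) * evl I a₀ q
        + prodl B * ∑ a ∈ I, dd a ((xv a - xv a₀) ^ (j + 1) * evl I a₀ q) := by
    rw [Finset.sum_mul, Finset.mul_sum, ← Finset.sum_add_distrib]
    refine Finset.sum_congr rfl fun a _ => ?_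
    rw [mul_left_comm, Derivation.leibniz]
    simp only [smul_eq_mul]; ring
  have e3 : ∑ a ∈ I, dd a ((xv a - xv a₀) ^ (j + 1) * evl I a₀ q)
      = evl I a₀ (∑ a, pderiv a (X a ^ (j + 1) * q)) := by
    rw [← Finset.add_sum_erase I _ h₀, sub_self, zero_pow (by omega), zero_mul, map_zero, zero_add,
      map_sum, ← Finset.sum_coe_sort]
    refine Finset.sum_congr rfl fun a _ => ?_
    rw [← dd_evl, RingHom.map_mul, RingHom.map_pow, evl_X]
  have e4 : ∑ e ∈ edges I, rho n (X e + if e ∈ B then 1 else 0) *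
      gsum (xv e.1.1 - xv a₀) (xv e.1.2 - xv a₀) j
      = ∑ e ∈ edges I, rho n (X e) * gsum (xv e.1.1 - xv a₀) (xv e.1.2 - xv a₀) j
        + ∑ e ∈ B, gsum (xv e.1.1 - xv a₀ : BA n) (xv e.1.2 - xv a₀) j := by
    simp only [map_add, add_mul, Finset.sum_add_distrib]
    congr 1
    have : ∀ e : BraidIdx n, rho n (if e ∈ B then 1 else 0) *
        gsum (xv e.1.1 - xv a₀) (xv e.1.2 - xv a₀) j
        = if e ∈ B then gsum (xv e.1.1 - xv a₀) (xv e.1.2 - xv a₀) j else 0 := fun e => by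
      split_ifs <;> simp
    simp only [this]
    rw [← Finset.sum_filter, Finset.filter_mem_eq_inter, Finset.inter_eq_right.mpr hB]
  rw [e2, e3, sum_mul_dd_prodl B hB, theta, map_add, map_mul, evl_HH, e4]
  ring

end Sat

end Main

end Arrangement

namespace Arrangement

open scoped Pointwise

variable {n : ℕ}

/-- The exponents of the monomials of degree `d`. -/
abbrev Expo (σ : Type*) [Fintype σ] [DecidableEq σ] (d : ℕ) : Type _ :=
  ↥((Finset.univ : Finset σ).finsuppAntidiag d)

theorem sum_expo {σ : Type*} [Fintype σ] [DecidableEq σ] {d : ℕ} (β : Expo σ d) :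
    ∑ a, (β : σ →₀ ℕ) a = d := (Finset.mem_finsuppAntidiag.mp β.2).1

theorem eq_sum_expo {σ R : Type*} [Fintype σ] [DecidableEq σ] [CommRing R] {d : ℕ}
    {f : MvPolynomial σ R} (hf : f.IsHomogeneous d) :
    f = ∑ β : Expo σ d, C (coeff β f) * monomial β 1 := by
  ext γ
  rw [coeff_sum]
  simp only [coeff_C_mul, coeff_monomial]
  by_cases hγ : ∑ a, γ a = d
  · rw [Finset.sum_eq_single (⟨γ, Finset.mem_finsuppAntidiag.mpr ⟨hγ, Finset.subset_univ _⟩⟩ : Expo σ d)]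
    · simp
    · intro β _ hβ
      rw [if_neg, mul_zero]
      intro h; exact hβ (Subtype.ext h)
    · simp
  · rw [Finset.sum_eq_zero]
    · exact hf.coeff_eq_zero (by rwa [Finsupp.degree_eq_sum])
    · intro β _
      rw [if_neg, mul_zero]
      rintro rfl; exact hγ (sum_expo β)

theorem exists_det_add_ne_zero {κ : Type*} [Fintype κ] [DecidableEq κ] (Q : Matrix κ κ ℂ) :
    ∃ c : ℂ, (Q + Matrix.scalar κ c).det ≠ 0 := by
  by_contra! h
  have h1 : (-Q).charpoly = 0 := Polynomial.funext fun c => by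
    rw [Matrix.eval_charpoly, sub_neg_eq_add, add_comm, h c, Polynomial.eval_zero]
  exact (Matrix.charpoly_monic (-Q)).ne_zero h1

/-- The combination of vector fields and of a coordinate used for the descent. -/
noncomputable def fam {R : Type*} [CommRing R] {I : Finset (Fin n)} {a₀ : Fin n} (a₁ : ↥(I.erase a₀))
    (t : BraidIdx n → R) (q : ℕ → MvPolynomial ↥(I.erase a₀) R) (p : MvPolynomial ↥(I.erase a₀) R)
    (c : R) : MvPolynomial ↥(I.erase a₀) R :=
  ∑ j ∈ Finset.Icc 1 (I.card - 2), theta t j (q j) + C c * (X a₁ * p)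

theorem map_fam {R R' : Type*} [CommRing R] [CommRing R'] (f : R →+* R') {I : Finset (Fin n)}
    {a₀ : Fin n} (a₁ : ↥(I.erase a₀)) (t : BraidIdx n → R) (q : ℕ → MvPolynomial ↥(I.erase a₀) R)
    (p : MvPolynomial ↥(I.erase a₀) R) (c : R) :
    MvPolynomial.map f (fam a₁ t q p c) = fam a₁ (fun e => f (t e))
      (fun j => MvPolynomial.map f (q j)) (MvPolynomial.map f p) (f c) := by
  simp [fam, map_theta]

theorem fam_add_smul {R : Type*} [CommRing R] {I : Finset (Fin n)}
    {a₀ : Fin n} (a₁ : ↥(I.erase a₀)) (t t' : BraidIdx n → R) (q : ℕ → MvPolynomial ↥(I.erase a₀) R)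
    (p : MvPolynomial ↥(I.erase a₀) R) (c : R) :
    fam a₁ (fun e => t e + c * t' e) q p c = fam a₁ t q p 0
      + C c * (∑ j ∈ Finset.Icc 1 (I.card - 2), HH I a₀ t' j * q j + X a₁ * p) := by
  simp only [fam, theta_add_smul, Finset.sum_add_distrib, ← Finset.mul_sum]
  rw [C_0]; ring

theorem fam_isHomogeneous {R : Type*} [CommRing R] {I : Finset (Fin n)}
    {a₀ : Fin n} (a₁ : ↥(I.erase a₀)) (t : BraidIdx n → R) {q : ℕ → MvPolynomial ↥(I.erase a₀) R}
    {p : MvPolynomial ↥(I.erase a₀) R} (c : R) {d : ℕ} (hd : 0 < d)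
    (hq : ∀ j ∈ Finset.Icc 1 (I.card - 2), j ≤ d ∧ (q j).IsHomogeneous (d - j))
    (hp : p.IsHomogeneous (d - 1)) : (fam a₁ t q p c).IsHomogeneous d := by
  refine IsHomogeneous.add (IsHomogeneous.sum _ _ _ fun j hj => ?_) ?_
  · exact theta_isHomogeneous _ (hq j hj).1 (hq j hj).2
  · refine IsHomogeneous.C_mul ?_ _
    have := (isHomogeneous_X R a₁).mul hp
    rwa [show 1 + (d - 1) = d by omega] at this

theorem map_eval_map_C {σ τ : Type*} (s : τ → ℂ) (f : MvPolynomial σ ℂ) :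
    MvPolynomial.map (eval s) (MvPolynomial.map (C : ℂ →+* MvPolynomial τ ℂ) f) = f := by
  rw [MvPolynomial.map_map]
  convert MvPolynomial.map_id f
  ext; simp

/-- The matrix of coefficients of a family of polynomials. -/
noncomputable def coeffMat {σ R : Type*} [Fintype σ] [DecidableEq σ] [CommRing R] {d : ℕ}
    (v : Expo σ d → MvPolynomial σ R) : Matrix (Expo σ d) (Expo σ d) R :=
  Matrix.of fun α γ => coeff γ (v α)

theorem cramer_expo {σ R : Type*} [Fintype σ] [DecidableEq σ] [CommRing R] {d : ℕ}
    {v : Expo σ d → MvPolynomial σ R} (hv : ∀ α, (v α).IsHomogeneous d) (β : Expo σ d) :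
    ∑ α, C ((coeffMat v).adjugate β α) * v α
      = C (coeffMat v).det * monomial β 1 := by
  set Q := coeffMat v with hQ
  have h1 : ∀ α, v α = ∑ γ, C (Q α γ) * monomial γ 1 := fun α => by
    conv_lhs => rw [eq_sum_expo (hv α)]
    rfl
  have h2 : ∑ α, C (Q.adjugate β α) * v α = ∑ γ : Expo σ d, C ((Q.adjugate * Q) β γ) * monomial γ 1 := by
    simp only [Matrix.mul_apply, map_sum, Finset.sum_mul]
    rw [Finset.sum_comm]
    refine Finset.sum_congr rfl fun α _ => ?_
    rw [h1 α, Finset.mul_sum]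
    refine Finset.sum_congr rfl fun γ _ => ?_
    rw [C_mul, mul_assoc]
  rw [h2, Matrix.adjugate_mul, Finset.sum_eq_single β]
  · simp
  · intro γ _ hγ
    simp [Matrix.one_apply_ne hγ.symm]
  · simp

theorem mapMatrix_coeffMat {I : Finset (Fin n)} {a₀ : Fin n} (a₁ : ↥(I.erase a₀))
    (B : Finset (BraidIdx n)) (s₀ : BraidIdx n → ℂ) {d : ℕ}
    (q : Expo ↥(I.erase a₀) d → ℕ → MvPolynomial ↥(I.erase a₀) ℂ)
    (p : Expo ↥(I.erase a₀) d → MvPolynomial ↥(I.erase a₀) ℂ) (c : ℂ)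
    (he : ∀ α, monomial α.1 1 = ∑ j ∈ Finset.Icc 1 (I.card - 2),
      HH I a₀ (starDir I a₀ a₁) j * q α j + X a₁ * p α) :
    (eval (fun e => s₀ e + c * starDir I a₀ a₁ e)).mapMatrix
      (coeffMat fun α => fam a₁ (fun e => (X e : SR n) + if e ∈ B then 1 else 0)
        (fun j => MvPolynomial.map C (q α j)) (MvPolynomial.map C (p α)) (C c))
    = coeffMat (fun α => fam a₁ (fun e => s₀ e + if e ∈ B then 1 else 0) (q α) (p α) 0)
      + Matrix.scalar _ c := by
  set s : BraidIdx n → ℂ := fun e => s₀ e + c * starDir I a₀ a₁ e with hs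
  ext α γ
  have h2 : (fun e => eval s ((X e : SR n) + if e ∈ B then 1 else 0))
      = fun e => (s₀ e + if e ∈ B then 1 else 0) + c * starDir I a₀ a₁ e := by
    funext e
    rw [map_add, eval_X, hs]
    split_ifs
    · simp; ring
    · simp
  rw [RingHom.mapMatrix_apply, Matrix.map_apply, Matrix.add_apply, coeffMat, coeffMat,
    Matrix.of_apply, Matrix.of_apply, ← coeff_map, map_fam, h2, eval_C, map_eval_map_C]
  simp only [map_eval_map_C]
  rw [fam_add_smul, ← he α, coeff_add, coeff_C_mul, coeff_monomial]
  congr 1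
  by_cases h : α = γ
  · simp [h]
  · rw [if_neg (fun h' => h (Subtype.ext h'))]
    simp [Matrix.diagonal_apply_ne _ h]

theorem exists_family {I : Finset (Fin n)} {a₀ : Fin n} (h₀ : a₀ ∈ I) (a₁ : ↥(I.erase a₀))
    (k : ℕ) (B : Finset (BraidIdx n)) {d : ℕ} (hd : (I.card - 2) * (I.card - 2 - 1) / 2 < d) :
    ∃ (q : Expo ↥(I.erase a₀) d → ℕ → MvPolynomial ↥(I.erase a₀) ℂ)
      (p : Expo ↥(I.erase a₀) d → MvPolynomial ↥(I.erase a₀) ℂ) (c : ℂ),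
      (∀ α, ∀ j ∈ Finset.Icc 1 (I.card - 2), j ≤ d ∧ (q α j).IsHomogeneous (d - j)) ∧
      (∀ α, (p α).IsHomogeneous (d - 1)) ∧
      ¬ lin I k ∣ (coeffMat fun α => fam a₁ (fun e => (X e : SR n) + if e ∈ B then 1 else 0)
        (fun j => MvPolynomial.map C (q α j)) (MvPolynomial.map C (p α)) (C c)).det := by
  have hI : 2 ≤ I.card := by
    have := Finset.card_pos.mpr ⟨_, a₁.2⟩
    rw [Finset.card_erase_of_mem h₀] at this; omega
  choose q p hq hp he using fun α : Expo ↥(I.erase a₀) d => exists_eq_sum_HH h₀ a₁.2 hd α (sum_expo α)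
  have hpos : 0 < (edges I).card := by
    have := card_edges I
    have : 0 < I.card * (I.card - 1) := Nat.mul_pos (by omega) (by omega)
    omega
  obtain ⟨e₀, he₀⟩ := Finset.card_pos.mp hpos
  set s₀ : BraidIdx n → ℂ := fun e => if e = e₀ then -((I.card : ℂ) - 1 + k) else 0 with hs₀
  obtain ⟨c, hc⟩ := exists_det_add_ne_zero (coeffMat fun α : Expo ↥(I.erase a₀) d =>
    fam a₁ (fun e => s₀ e + if e ∈ B then 1 else 0) (q α) (p α) 0)
  refine ⟨q, p, c, hq, hp, fun hdvd => ?_⟩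
  set s : BraidIdx n → ℂ := fun e => s₀ e + c * starDir I a₀ a₁ e with hs
  have h0 : eval s (lin I k) = 0 := by
    rw [eval_lin, hs, Finset.sum_add_distrib, ← Finset.mul_sum, sum_starDir h₀ a₁.2, hs₀]
    simp [he₀]
    ring
  have h1 := map_dvd (eval s) hdvd
  rw [h0, zero_dvd_iff, RingHom.map_det] at h1
  rw [mapMatrix_coeffMat a₁ B s₀ q p c he] at h1
  exact hc h1

section Main

variable {L : Type} [CommRing L] [Algebra (BA n) L]

local notation "φ" => algebraMap (BA n) L

namespace Sat

variable {D : Fin n → L →+ L} {E : Submodule (BA n) L} (hS : Setting D E)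
  {ϖ : SR n} {G : BA n} {V : Submodule (BA n) L} (hV : Sat D ϖ G V)
include hS hV

theorem prodl_mul_mem {I : Finset (Fin n)} {a₀ a₁ : Fin n} (h₀ : a₀ ∈ I) (h₁ : a₁ ∈ I.erase a₀)
    (hG : ∀ a ∈ I, ∀ b ∉ I, xv a - xv b ∣ G) (hϖ : Prime ϖ) {k : ℕ} (hdvd : ϖ ∣ lin I k)
    (hk : Ideal.span (diffs I a₀) ^ (k + 1) ≤ ideal V) {B : Finset (BraidIdx n)} (hB : B ⊆ edges I)
    {d : ℕ} (hBd : B.card + d = k) (hd : (I.card - 2) * (I.card - 2 - 1) / 2 < d)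
    (hp : ∀ h ∈ Ideal.span (diffs I a₀) ^ (d - 1), φ (prodl B * ((xv a₁ - xv a₀) * h)) ∈ V) :
    ∀ h ∈ Ideal.span (diffs I a₀) ^ d, φ (prodl B * h) ∈ V := by
  classical
  have hI : 2 ≤ I.card := by
    have := Finset.card_pos.mpr ⟨a₁, h₁⟩
    rw [Finset.card_erase_of_mem h₀] at this; omega
  obtain ⟨q, p, c, hq, hph, hdet⟩ := exists_family h₀ ⟨a₁, h₁⟩ k B hd
  set v : Expo ↥(I.erase a₀) d → MvPolynomial ↥(I.erase a₀) (SR n) := fun α =>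
    fam ⟨a₁, h₁⟩ (fun e => (X e : SR n) + if e ∈ B then 1 else 0)
        (fun j => MvPolynomial.map C (q α j)) (MvPolynomial.map C (p α)) (C c) with hv
  have hdet' : ¬ ϖ ∣ (coeffMat v).det := fun h =>
    hdet ((lin_dvd_of_dvd hI hϖ hdvd).trans h)
  have hvh : ∀ α, (v α).IsHomogeneous d := fun α =>
    fam_isHomogeneous _ _ _ (by omega) (fun j hj => ⟨(hq α j hj).1, (hq α j hj).2.map _⟩)
      ((hph α).map _)
  have hvm : ∀ α, φ (prodl B * evl I a₀ (v α)) ∈ V := fun α => by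
    rw [hv]
    simp only [fam, map_add, map_sum, mul_add, Finset.mul_sum]
    refine add_mem (sum_mem fun j hj => ?_) ?_
    · refine hV.prodl_mul_evl_theta_mem hS h₀ hG hB j _ fun a ha => mem_ideal.mp (hk ?_)
      have e1 := evl_mem ((hq α j hj).2.map (C : ℂ →+* SR n))
      have e2 := prodl_mem (a₀ := a₀) B hB
      have e3 : (xv a - xv a₀ : BA n) ^ (j + 1) ∈ Ideal.span (diffs I a₀) ^ (j + 1) :=
        Ideal.pow_mem_pow (Ideal.subset_span (show xv a - xv a₀ ∈ diffs I a₀ from ⟨a, ha, rfl⟩)) _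
      have := Ideal.mul_mem_mul e3 (Ideal.mul_mem_mul e2 e1)
      rw [← pow_add, ← pow_add] at this
      have hj' := (hq α j hj).1
      rwa [show j + 1 + (B.card + (d - j)) = k + 1 by omega] at this
    · have := V.smul_mem (rho n (C c)) (hp _ (evl_mem ((hph α).map (C : ℂ →+* SR n))))
      convert this using 1
      rw [Algebra.smul_def, ← map_mul]
      congr 1
      rw [map_mul, map_mul, evl_C, evl_X]
      ring
  intro h hh
  have hle : Ideal.span (diffs I a₀) ^ d
      ≤ Submodule.comap (LinearMap.mulLeft (BA n) (prodl B)) (ideal V) := by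
    rw [Ideal.span, Submodule.span_pow, Submodule.span_le]
    intro h hh
    change φ (prodl B * h) ∈ V
    rcases mem_diffs_pow hh with rfl | ⟨β, hβ, rfl⟩
    · simp
    refine hV.unC _ _ hdet' ?_
    set β' : Expo ↥(I.erase a₀) d := ⟨β, Finset.mem_finsuppAntidiag.mpr ⟨hβ, Finset.subset_univ _⟩⟩
    have hc := congrArg (evl I a₀) (cramer_expo hvh β')
    rw [map_mul, evl_C, map_sum] at hc
    rw [← map_mul, mul_left_comm]
    have : evl I a₀ (monomial (↑β') 1) = evl I a₀ (monomial β 1) := rfl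
    rw [← this, ← hc, Finset.mul_sum, map_sum]
    refine sum_mem fun α _ => ?_
    rw [map_mul (evl I a₀), evl_C, mul_left_comm, map_mul, ← Algebra.smul_def]
    exact V.smul_mem _ (hvm α)
  exact hle hh

end Sat

end Main

end Arrangement

namespace Arrangement

open scoped Pointwise

variable {n : ℕ}

theorem edges_subset_of_dvd {I J : Finset (Fin n)} (hJ : 2 ≤ J.card) {k j : ℕ}
    (h : lin I k ∣ lin J j) : edges I ⊆ edges J := by
  intro e he
  by_contra heJ
  have hpos : 0 < (edges J).card := by
    have := card_edges J
    have : 0 < J.card * (J.card - 1) := Nat.mul_pos (by omega) (by omega)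
    omega
  obtain ⟨f, hf⟩ := Finset.card_pos.mp hpos
  set t : ℂ := 1 - ((J.card : ℂ) - 1 + j)
  set A : ℂ := -((I.card : ℂ) - 1 + k) - if f ∈ edges I then t else 0
  have hfe : f ≠ e := by rintro rfl; exact heJ hf
  have hs : ∀ K : Finset (BraidIdx n), ∑ q ∈ K, (if q = e then A else if q = f then t else 0)
      = (if e ∈ K then A else 0) + if f ∈ K then t else 0 := fun K => by
    rw [← Finset.sum_ite_eq' K e (fun _ => A), ← Finset.sum_ite_eq' K f (fun _ => t),
      ← Finset.sum_add_distrib]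
    refine Finset.sum_congr rfl fun q _ => ?_
    by_cases hq : q = e
    · subst hq; simp [hfe.symm]
    · simp [hq]
  have h1 := map_dvd (eval fun q => if q = e then A else if q = f then t else 0) h
  rw [eval_lin, eval_lin, hs, hs, if_pos he, if_neg heJ, if_pos hf] at h1
  have h2 : A + (if f ∈ edges I then t else 0) + ((I.card : ℂ) - 1 + k) = 0 := by
    simp only [A]; ring
  rw [h2, zero_dvd_iff] at h1
  simp [t] at h1

theorem subset_of_edges_subset {I J : Finset (Fin n)} (hI : 2 ≤ I.card) (h : edges I ⊆ edges J) :
    I ⊆ J := by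
  intro a ha
  obtain ⟨b, hb, hab⟩ := Finset.exists_mem_ne (by omega : 1 < I.card) a
  rcases lt_or_gt_of_ne hab with h' | h'
  · exact (mem_edges.mp (h (mem_edges.mpr (show (⟨(b, a), h'⟩ : BraidIdx n).1.1 ∈ I ∧ _ from
      ⟨hb, ha⟩)))).2
  · exact (mem_edges.mp (h (mem_edges.mpr (show (⟨(a, b), h'⟩ : BraidIdx n).1.1 ∈ I ∧ _ from
      ⟨ha, hb⟩)))).1

theorem eq_of_dvd_lin {I J : Finset (Fin n)} (hI : 2 ≤ I.card) (hJ : 2 ≤ J.card) {k j : ℕ} {ϖ : SR n}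
    (hϖ : Prime ϖ) (h : ϖ ∣ lin I k) (h' : ϖ ∣ lin J j) : I = J ∧ k = j := by
  have e : I = J := Finset.Subset.antisymm
    (subset_of_edges_subset hI (edges_subset_of_dvd hJ ((lin_dvd_of_dvd hI hϖ h).trans h')))
    (subset_of_edges_subset hJ (edges_subset_of_dvd hI ((lin_dvd_of_dvd hJ hϖ h').trans h)))
  refine ⟨e, ?_⟩
  subst e
  by_contra hkj
  have h1 := dvd_sub h h'
  have h2 : lin I k - lin I j = C ((k : ℂ) - j) := by
    unfold lin
    rw [add_sub_add_left_eq_sub, ← C_sub, add_sub_add_left_eq_sub]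
  rw [h2] at h1
  refine hϖ.not_isUnit (isUnit_of_dvd_unit h1 (IsUnit.map C (isUnit_iff_ne_zero.mpr ?_)))
  rw [sub_ne_zero]
  exact_mod_cast hkj

/-- Adjacency in the graph with set of edges `Γ`. -/
def Adj (Γ : Finset (BraidIdx n)) (a b : Fin n) : Prop :=
  ∃ q ∈ Γ, (q.1.1 = a ∧ q.1.2 = b) ∨ (q.1.1 = b ∧ q.1.2 = a)

theorem Adj.symm {Γ : Finset (BraidIdx n)} {a b : Fin n} (h : Adj Γ a b) : Adj Γ b a := by
  obtain ⟨q, hq, h⟩ := h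
  exact ⟨q, hq, h.symm⟩

theorem sub_dvd_prodl {Γ : Finset (BraidIdx n)} {a b : Fin n} (hab : a ≠ b) (h : ¬ Adj Γ a b) :
    (xv a - xv b : BA n) ∣ prodl Γᶜ := by
  rcases lt_or_gt_of_ne hab with h' | h'
  · exact Finset.dvd_prod_of_mem (fun q : BraidIdx n => (xv q.1.1 - xv q.1.2 : BA n))
      (a := ⟨(a, b), h'⟩) (Finset.mem_compl.mpr fun hq => h ⟨_, hq, Or.inl ⟨rfl, rfl⟩⟩)
  · rw [← neg_dvd, neg_sub]
    exact Finset.dvd_prod_of_mem (fun q : BraidIdx n => (xv q.1.1 - xv q.1.2 : BA n))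
      (a := ⟨(b, a), h'⟩) (Finset.mem_compl.mpr fun hq => h ⟨_, hq, Or.inr ⟨rfl, rfl⟩⟩)

/-- The factors of the generator for the complete subgraphs of `Γ`. -/
noncomputable def prodLin (Γ : Finset (BraidIdx n)) : SR n :=
  ∏ J ∈ (Finset.univ : Finset (Fin n)).powerset.filter (fun J => 2 ≤ J.card ∧ edges J ⊆ Γ),
    ∏ k ∈ Finset.range ((J.card - 1) * (J.card - 2) + 1), lin J k

theorem prodLin_dvd {Γ Γ' : Finset (BraidIdx n)} (h : Γ' ⊆ Γ) : prodLin Γ' ∣ prodLin Γ := by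
  refine Finset.prod_dvd_prod_of_subset _ _ _ fun J hJ => ?_
  simp only [Finset.mem_filter] at hJ ⊢
  exact ⟨hJ.1, hJ.2.1, hJ.2.2.trans h⟩

section Main

variable {L : Type} [CommRing L] [Algebra (BA n) L]

local notation "φ" => algebraMap (BA n) L

namespace Sat

variable {D : Fin n → L →+ L} {E : Submodule (BA n) L} (hS : Setting D E)
  {ϖ : SR n} {G : BA n} {V : Submodule (BA n) L} (hV : Sat D ϖ G V)
include hV

theorem one_mem_of_pow {r : ℕ} (h : φ (G ^ r) ∈ V) : (1 : L) ∈ V := by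
  induction r with
  | zero => simpa using h
  | succ r ih => exact ih (hV.unG _ (by rw [← map_mul, ← pow_succ']; exact h))

include hS

theorem span_pow_le {I : Finset (Fin n)} {a₀ : Fin n} (h₀ : a₀ ∈ I) (hI : 2 ≤ I.card)
    (hG : ∀ a ∈ I, ∀ b ∉ I, xv a - xv b ∣ G) (hϖ : Prime ϖ) {k : ℕ} (hdvd : ϖ ∣ lin I k)
    (hk : Ideal.span (diffs I a₀) ^ (k + 1) ≤ ideal V) (hkr : (I.card - 1) * (I.card - 2) < k)
    (hprod : φ (prodl (edges I)) ∈ V) : Ideal.span (diffs I a₀) ^ k ≤ ideal V := by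
  classical
  have hcard := card_edges I
  have key : ∀ m : ℕ, ∀ B ⊆ edges I, m + B.card = (edges I).card →
      ∀ h ∈ Ideal.span (diffs I a₀) ^ (k - B.card), φ (prodl B * h) ∈ V := by
    intro m
    induction m with
    | zero =>
      intro B hB hm h _
      rw [Finset.eq_of_subset_of_card_le hB (by omega), mul_comm, map_mul, ← Algebra.smul_def]
      exact V.smul_mem _ hprod
    | succ m ih =>
      intro B hB hm
      obtain ⟨e, he, heB⟩ := Finset.exists_mem_notMem_of_card_lt_card (s := B) (t := edges I) (by omega)
      have he' := mem_edges.mp he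
      have hne : e.1.2 ∈ I.erase e.1.1 := Finset.mem_erase.mpr ⟨e.2.ne', he'.2⟩
      rw [span_diffs_eq h₀ he'.1]
      have hnum : 2 * B.card + 2 ≤ I.card * (I.card - 1) := by omega
      obtain ⟨r, hr⟩ := Nat.exists_eq_add_of_le hI
      rw [hr] at hnum hkr
      simp only [show 2 + r - 1 = r + 1 by omega, show 2 + r - 2 = r by omega] at hnum hkr
      have hBk : B.card ≤ k := by nlinarith
      refine hV.prodl_mul_mem hS he'.1 hne hG hϖ hdvd (k := k) ?_ hB (d := k - B.card) (by omega) ?_ ?_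
      · rw [span_diffs_eq he'.1 h₀]; exact hk
      · rw [hr, show 2 + r - 2 = r by omega]
        refine Nat.div_lt_of_lt_mul ?_
        zify [hBk]
        rcases Nat.eq_zero_or_pos r with rfl | hr0
        · zify at hnum hkr
          norm_num at hnum hkr ⊢
          linarith
        · zify [hr0] at hnum hkr ⊢
          nlinarith
      · intro h hh
        have hc : (insert e B).card = B.card + 1 := Finset.card_insert_of_notMem heB
        have := ih (insert e B) (Finset.insert_subset he hB) (by omega) h (by
          rw [hc, ← Nat.sub_sub, span_diffs_eq h₀ he'.1]; exact hh)
        rw [prodl, Finset.prod_insert heB] at this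
        have h2 := V.neg_mem this
        convert h2 using 1
        rw [← map_neg]
        congr 1
        rw [prodl]; ring
  intro h hh
  have := key (edges I).card ∅ (Finset.empty_subset _) (by simp) h (by simpa using hh)
  exact mem_ideal.mpr (by simpa [prodl] using this)

end Sat

namespace Setting

variable {D : Fin n → L →+ L} {E : Submodule (BA n) L} (hS : Setting D E)
include hS

theorem prodl_mem_satMod {ϖ : SR n} (hϖ : Prime ϖ) (p : SR n) (Γ : Finset (BraidIdx n)) :
    φ (prodl Γ) ∈ satMod E hϖ p (prodl Γᶜ) := by
  refine ⟨1, 1, fun h => hϖ.not_isUnit (isUnit_of_dvd_one h), ?_⟩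
  convert E.smul_mem (rho n p) hS.memF using 1
  rw [Algebra.smul_def, ← map_mul, ← map_mul]
  congr 1
  rw [braidF_eq, mul_one, pow_one, mul_assoc, mul_comm (prodl Γᶜ)]
  congr 1
  exact Finset.prod_mul_prod_compl Γ _

theorem one_mem_satMod {ϖ : SR n} (hϖ : Prime ϖ) : ∀ (m : ℕ) (Γ : Finset (BraidIdx n)), Γ.card = m →
    (1 : L) ∈ satMod E hϖ (prodLin Γ) (prodl Γᶜ) := by
  classical
  intro m
  induction m with
  | zero =>
    intro Γ hΓ
    have := hS.prodl_mem_satMod hϖ (prodLin Γ) Γ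
    rw [Finset.card_eq_zero.mp hΓ] at this ⊢
    simpa [prodl] using this
  | succ m ih =>
  intro Γ hΓ
  set V := satMod E hϖ (prodLin Γ) (prodl Γᶜ) with hVdef
  have hV : Sat D ϖ (prodl Γᶜ) V := hS.sat_satMod hϖ _ _
  have hpow : ∀ e ∈ Γ, ∃ r, φ ((xv e.1.1 - xv e.1.2) ^ r)
      ∈ satMod E hϖ (prodLin (Γ.erase e)) (prodl Γᶜ) := by
    intro e he
    have h := ih (Γ.erase e) (by rw [Finset.card_erase_of_mem he]; omega)
    have h2 : (prodl (Γ.erase e)ᶜ : BA n) = (xv e.1.1 - xv e.1.2) * prodl Γᶜ := by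
      rw [prodl, Finset.compl_erase, Finset.prod_insert (by simpa using he)]; rfl
    rw [h2] at h
    obtain ⟨r, hr⟩ := exists_pow_mem_satMod h
    exact ⟨r, by simpa using hr⟩
  have hadj : ∀ (W : Submodule (BA n) L),
      (∀ e ∈ Γ, satMod E hϖ (prodLin (Γ.erase e)) (prodl Γᶜ) ≤ W) →
      ∀ a b, Adj Γ a b → ∃ r, φ ((xv a - xv b) ^ r) ∈ W := by
    rintro W hW a b ⟨e, he, ⟨rfl, rfl⟩ | ⟨rfl, rfl⟩⟩
    · obtain ⟨r, hr⟩ := hpow e he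
      exact ⟨r, hW e he hr⟩
    · obtain ⟨r, hr⟩ := hpow e he
      refine ⟨r, ?_⟩
      rw [← neg_sub, neg_pow, map_mul, ← Algebra.smul_def]
      exact W.smul_mem _ (hW e he hr)
  have hadjV := hadj V fun e _ => satMod_mono (prodLin_dvd (Finset.erase_subset e Γ))
  by_contra h1
  have htrans : ∀ a b c, Adj Γ a b → Adj Γ b c → a ≠ c → Adj Γ a c := by
    intro a b c hab hbc hac
    by_contra hn
    obtain ⟨g, hg⟩ := sub_dvd_prodl hac hn
    have h2 : (xv a - xv c : BA n) ∈ (Sat.ideal V).radical := by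
      have : (xv a - xv c : BA n) = (xv a - xv b) + (xv b - xv c) := by ring
      rw [this]
      exact add_mem (hadjV a b hab) (hadjV b c hbc)
    obtain ⟨r, hr⟩ := h2
    refine h1 (hV.one_mem_of_pow (r := r) ?_)
    rw [hg, mul_pow, mul_comm, map_mul, ← Algebra.smul_def]
    exact V.smul_mem _ hr
  set comp : Fin n → Finset (Fin n) := fun a => Finset.univ.filter (fun b => b = a ∨ Adj Γ a b)
    with hcomp
  have mem_comp : ∀ a b, b ∈ comp a ↔ (b = a ∨ Adj Γ a b) := fun a b => by simp [hcomp]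
  have self_mem : ∀ a, a ∈ comp a := fun a => (mem_comp a a).mpr (Or.inl rfl)
  have hadj' : ∀ a b c, b ∈ comp a → c ∈ comp a → b ≠ c → Adj Γ b c := by
    intro a b c hb hc hbc
    rcases (mem_comp a b).mp hb with rfl | hb <;> rcases (mem_comp _ c).mp hc with rfl | hc
    · exact absurd rfl hbc
    · exact hc
    · exact hb.symm
    · exact htrans b a c hb.symm hc hbc
  have hG : ∀ a, ∀ b ∈ comp a, ∀ c ∉ comp a, (xv b - xv c : BA n) ∣ prodl Γᶜ := by
    intro a b hb c hc
    refine sub_dvd_prodl (by rintro rfl; exact hc hb) fun hbc => hc ?_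
    rw [mem_comp] at hb ⊢
    rcases hb with rfl | hb
    · exact Or.inr hbc
    · by_cases h : c = a
      · exact Or.inl h
      · exact Or.inr (htrans a b c hb hbc (Ne.symm h))
  have hr : ∀ (W : Submodule (BA n) L),
      (∀ e ∈ Γ, satMod E hϖ (prodLin (Γ.erase e)) (prodl Γᶜ) ≤ W) →
      ∀ a, ∀ b ∈ comp a, ∃ r, φ ((xv b - xv a) ^ r) ∈ W := by
    intro W hW a b hb
    rcases (mem_comp a b).mp hb with rfl | hb
    · exact ⟨1, by simp⟩
    · exact hadj W hW b a hb.symm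
  have hblock := fun a => hV.block hS (hG a) (self_mem a)
    (hr V (fun e _ => satMod_mono (prodLin_dvd (Finset.erase_subset e Γ))) a) h1
  have hcard : ∀ e ∈ Γ, 2 ≤ (comp e.1.1).card := fun e he =>
    Finset.one_lt_card.mpr ⟨e.1.1, self_mem _, e.1.2,
      (mem_comp _ _).mpr (Or.inr ⟨e, he, Or.inl ⟨rfl, rfl⟩⟩), e.2.ne⟩
  obtain ⟨e, he⟩ := Finset.card_pos.mp (by omega : 0 < Γ.card)
  set a := e.1.1 with ha
  set I := comp a with hI
  have hI2 : 2 ≤ I.card := hcard e he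
  obtain ⟨k, hk, hk1, hk2⟩ := hblock a
  have hΓI : edges I = Γ := by
    apply Finset.Subset.antisymm
    · intro q hq
      have hq' := mem_edges.mp hq
      obtain ⟨q', hq1, ⟨h, h'⟩ | ⟨h, h'⟩⟩ := hadj' a _ _ hq'.1 hq'.2 q.2.ne
      · have : q = q' := Subtype.ext (Prod.ext h.symm h'.symm)
        rwa [this]
      · have h3 := q'.2
        have h4 := q.2
        rw [h, h'] at h3
        exact absurd h3 h4.not_gt
    · intro q hq
      obtain ⟨j, hj, _⟩ := hblock q.1.1
      have := (eq_of_dvd_lin hI2 (hcard q hq) hϖ hk hj).1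
      rw [mem_edges, this]
      exact ⟨self_mem _, (mem_comp _ _).mpr (Or.inr ⟨q, hq, Or.inl ⟨rfl, rfl⟩⟩)⟩
  set p' : SR n := ∏ J ∈ ((Finset.univ : Finset (Fin n)).powerset.filter
    (fun J => 2 ≤ J.card ∧ edges J ⊆ Γ)).erase I,
    ∏ k ∈ Finset.range ((J.card - 1) * (J.card - 2) + 1), lin J k with hp'
  have hp : prodLin Γ = (∏ k ∈ Finset.range ((I.card - 1) * (I.card - 2) + 1), lin I k) * p' := by
    rw [prodLin, ← Finset.mul_prod_erase _ _ (show I ∈ _ from Finset.mem_filter.mpr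
      ⟨Finset.mem_powerset.mpr (Finset.subset_univ _), hI2, hΓI.le⟩)]
  have hp'e : ∀ q ∈ Γ, prodLin (Γ.erase q) ∣ p' := fun q hq => by
    refine Finset.prod_dvd_prod_of_subset _ _ _ fun J hJ => ?_
    simp only [Finset.mem_filter, Finset.mem_erase] at hJ ⊢
    refine ⟨?_, hJ.1, hJ.2.1, hJ.2.2.trans (Finset.erase_subset _ _)⟩
    rintro rfl
    rw [hΓI] at hJ
    exact Finset.notMem_erase q Γ (hJ.2.2 hq)
  set V' := satMod E hϖ p' (prodl Γᶜ) with hV'def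
  have hV' : Sat D ϖ (prodl Γᶜ) V' := hS.sat_satMod hϖ _ _
  have h1' : (1 : L) ∉ V' := fun h => h1 (satMod_mono (hp ▸ dvd_mul_left _ _) h)
  obtain ⟨k₀, hk₀, hk₁, hk₂⟩ := hV'.block hS (hG a) (self_mem a)
    (hr V' (fun e he => satMod_mono (hp'e e he)) a) h1'
  have hle : k₀ ≤ (I.card - 1) * (I.card - 2) := by
    by_contra! hlt
    refine hk₂ (hV'.span_pow_le hS (self_mem a) hI2 (hG a) hϖ hk₀ hk₁ hlt ?_)
    have := hS.prodl_mem_satMod hϖ p' Γ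
    rw [← hI, hΓI]; exact this
  obtain rfl := (eq_of_dvd_lin hI2 hI2 hϖ hk hk₀).2
  refine hk2 ?_
  rw [Ideal.span, Submodule.span_pow, Submodule.span_le]
  intro h hh
  have h2 := hV'.euler_mem hS (hG a) (self_mem a) hh fun b hb => by
    refine Sat.mem_ideal.mp (hk₁ ?_)
    rw [pow_succ']
    refine Ideal.mul_mem_mul (Ideal.subset_span ⟨b, hb, rfl⟩) ?_
    rw [Ideal.span, Submodule.span_pow]
    exact Submodule.subset_span hh
  refine satMod_mono ?_ (mem_satMod_mul h2)
  rw [hp, mul_comm]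
  exact mul_dvd_mul (Finset.dvd_prod_of_mem _ (Finset.mem_range.mpr (by omega))) dvd_rfl

end Setting

end Main

end Arrangement

namespace Arrangement

section

variable {n : ℕ}

/-- Integration over the unit cube in the variables in `S`. -/
noncomputable def cubeInt (S : Finset (Fin n)) :
    MvPolynomial (Fin n) ℂ →ₗ[ℂ] MvPolynomial (Fin n) ℂ :=
  (basisMonomials (Fin n) ℂ).constr ℂ fun γ =>
    monomial (γ.filter (· ∉ S)) (∏ a ∈ S, ((γ a : ℂ) + 1)⁻¹)

theorem cubeInt_monomial (S : Finset (Fin n)) (γ : Fin n →₀ ℕ) (c : ℂ) :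
    cubeInt S (monomial γ c) = monomial (γ.filter (· ∉ S)) (c * ∏ a ∈ S, ((γ a : ℂ) + 1)⁻¹) := by
  have h : monomial γ c = c • basisMonomials (Fin n) ℂ γ := by
    simp [smul_monomial]
  rw [h, map_smul, cubeInt, Module.Basis.constr_basis, smul_monomial, smul_eq_mul]

theorem cubeInt_X_mul {S : Finset (Fin n)} {b : Fin n} (hb : b ∉ S) (g : MvPolynomial (Fin n) ℂ) :
    cubeInt S (X b * g) = X b * cubeInt S g := by
  induction g using MvPolynomial.induction_on' with
  | monomial γ c =>
    rw [X, monomial_mul, cubeInt_monomial, cubeInt_monomial, monomial_mul]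
    refine congrArg₂ (fun γ c => monomial γ c) ?_ ?_
    · rw [Finsupp.filter_add, Finsupp.filter_single_of_pos (· ∉ S) hb]
    · rw [one_mul, one_mul]
      congr 1
      · refine Finset.prod_congr rfl fun a ha => ?_
        have : b ≠ a := fun h => hb (h ▸ ha)
        simp [this]
  | add p q hp hq => rw [mul_add, map_add, map_add, hp, hq, mul_add]

theorem cubeInt_X_pow_mul {S : Finset (Fin n)} {b : Fin n} (hb : b ∉ S) (k : ℕ)
    (g : MvPolynomial (Fin n) ℂ) : cubeInt S (X b ^ k * g) = X b ^ k * cubeInt S g := by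
  induction k generalizing g with
  | zero => simp
  | succ k ih => rw [pow_succ, mul_assoc, ih, cubeInt_X_mul hb, mul_assoc]

theorem cubeInt_pderiv {S : Finset (Fin n)} {b : Fin n} (hb : b ∉ S) (g : MvPolynomial (Fin n) ℂ) :
    cubeInt S (pderiv b g) = pderiv b (cubeInt S g) := by
  induction g using MvPolynomial.induction_on' with
  | monomial γ c =>
    rw [pderiv_monomial, cubeInt_monomial, cubeInt_monomial, pderiv_monomial]
    refine congrArg₂ (fun γ c => monomial γ c) ?_ ?_
    · ext a
      by_cases ha : a ∈ S
      · have : b ≠ a := fun h => hb (h ▸ ha)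
        simp [ha]
      · simp [ha]
    · rw [Finsupp.filter_apply_pos (p := (· ∉ S)) _ hb, mul_right_comm]
      congr 2
      refine Finset.prod_congr rfl fun a ha => ?_
      have : b ≠ a := fun h => hb (h ▸ ha)
      simp [this]
  | add p q hp hq => rw [map_add, map_add, map_add, map_add, hp, hq]

theorem cubeInt_pderiv_self {S : Finset (Fin n)} {a : Fin n} (ha : a ∈ S)
    (g : MvPolynomial (Fin n) ℂ) : cubeInt S (pderiv a (X a * (1 - X a) * g)) = 0 := by
  induction g using MvPolynomial.induction_on' with
  | monomial γ c =>
    have h : (X a * (1 - X a) * monomial γ c : MvPolynomial (Fin n) ℂ)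
        = monomial (Finsupp.single a 1 + γ) c - monomial (Finsupp.single a 2 + γ) c := by
      have h2 : (X a * X a : MvPolynomial (Fin n) ℂ) = monomial (Finsupp.single a 2) 1 := by
        rw [X, monomial_mul, ← Finsupp.single_add]; simp
      rw [mul_sub, mul_one, sub_mul, h2, X, monomial_mul, monomial_mul, one_mul]
    have key : ∀ k : ℕ, cubeInt S (pderiv a (monomial (Finsupp.single a (k + 1) + γ) c))
        = monomial (γ.filter (· ∉ S)) (c * ∏ b ∈ S.erase a, ((γ b : ℂ) + 1)⁻¹) := by
      intro k
      rw [pderiv_monomial, cubeInt_monomial]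
      refine congrArg₂ (fun γ c => monomial γ c) ?_ ?_
      · ext b
        by_cases hb : b ∈ S
        · simp [hb]
        · have : a ≠ b := fun h => hb (h ▸ ha)
          simp [hb, this]
      · rw [← Finset.mul_prod_erase _ _ ha, mul_assoc]
        congr 1
        have h1 : ∀ b ∈ S.erase a,
            (((Finsupp.single a (k + 1) + γ - Finsupp.single a 1 : Fin n →₀ ℕ) b : ℂ) + 1)⁻¹
            = ((γ b : ℂ) + 1)⁻¹ := by
          intro b hb
          have : a ≠ b := (Finset.ne_of_mem_erase hb).symm
          simp [this]
        rw [Finset.prod_congr rfl h1, ← mul_assoc]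
        have h3 : (Finsupp.single a (k + 1) + γ - Finsupp.single a 1 : Fin n →₀ ℕ) a = k + γ a := by
          simp [add_right_comm]
        have h2 : ((k : ℂ) + γ a + 1) ≠ 0 := by exact_mod_cast Nat.succ_ne_zero (k + γ a)
        rw [h3]
        simp only [Finsupp.add_apply, Finsupp.single_eq_same]
        push_cast
        rw [show (k : ℂ) + 1 + γ a = k + γ a + 1 by ring, mul_inv_cancel₀ h2, one_mul]
    rw [h, map_sub, map_sub, key 0, key 1, sub_self]
  | add p q hp hq => rw [mul_add, map_add, map_add, hp, hq, add_zero]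

theorem cubeInt_rename_swap {S : Finset (Fin n)} {a b : Fin n} (ha : a ∈ S) (hb : b ∈ S)
    (g : MvPolynomial (Fin n) ℂ) : cubeInt S (rename (Equiv.swap a b) g) = cubeInt S g := by
  induction g using MvPolynomial.induction_on' with
  | monomial γ c =>
    rw [rename_monomial, cubeInt_monomial, cubeInt_monomial]
    have h : ∀ d, (Finsupp.mapDomain (Equiv.swap a b) γ) d = γ (Equiv.swap a b d) := fun d => by
      conv_lhs => rw [← Equiv.swap_apply_self a b d]
      · exact Finsupp.mapDomain_apply (Equiv.injective _) _ _
    refine congrArg₂ (fun γ c => monomial γ c) ?_ ?_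
    · ext d
      by_cases hd : d ∈ S
      · simp [hd]
      · have h1 : d ≠ a := fun h => hd (h ▸ ha)
        have h2 : d ≠ b := fun h => hd (h ▸ hb)
        simp only [Finsupp.filter_apply, hd, not_false_eq_true, if_true]
        rw [h, Equiv.swap_apply_of_ne_of_ne h1 h2]
    · congr 1
      refine Finset.prod_equiv (Equiv.swap a b) (fun d => ?_) fun d _ => ?_
      · by_cases h1 : d = a
        · subst h1; simp [ha, hb]
        by_cases h2 : d = b
        · subst h2; simp [ha, hb]
        rw [Equiv.swap_apply_of_ne_of_ne h1 h2]
      · rw [h]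
  | add p q hp hq => rw [map_add, map_add, map_add, hp, hq]

/-- The blow-up substitution `x_j ↦ z`, `x_i ↦ z + t`, `x_a ↦ z + t x_a` for `a ∈ S`. -/
noncomputable def blow (S : Finset (Fin n)) (i j : Fin n) :
    MvPolynomial (Fin n) ℂ →ₐ[ℂ] MvPolynomial (Fin n) ℂ :=
  aeval fun a => if a = i then X j + X i else if a ∈ S then X j + X i * X a else X a

variable {S : Finset (Fin n)} {i j : Fin n}

theorem blow_X (a : Fin n) : blow S i j (X a)
    = if a = i then X j + X i else if a ∈ S then X j + X i * X a else X a := by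
  simp [blow]

theorem blow_X_fst : blow S i j (X i) = X j + X i := by simp [blow_X]

theorem blow_X_snd (hij : i ≠ j) (hj : j ∉ S) : blow S i j (X j) = X j := by
  simp [blow_X, hij.symm, hj]

theorem blow_X_mem (hi : i ∉ S) {a : Fin n} (ha : a ∈ S) :
    blow S i j (X a) = X j + X i * X a := by
  have : a ≠ i := fun h => hi (h ▸ ha)
  simp [blow_X, this, ha]

theorem pderiv_aeval {σ τ : Type*} [Fintype σ] (f : σ → MvPolynomial τ ℂ)
    (c : τ) (g : MvPolynomial σ ℂ) :
    pderiv c (aeval f g) = ∑ a, aeval f (pderiv a g) * pderiv c (f a) := by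
  classical
  induction g using MvPolynomial.induction_on with
  | C r => simp
  | add p q hp hq => simp only [map_add, hp, hq, add_mul, Finset.sum_add_distrib]
  | mul_X p b hp =>
    simp only [map_mul, Derivation.leibniz, hp, aeval_X, map_add, smul_eq_mul, add_mul,
      Finset.sum_add_distrib, Finset.mul_sum]
    rw [Finset.sum_eq_single (f := fun a => aeval f p * aeval f (pderiv a (X b)) * pderiv c (f a)) b]
    · simp only [pderiv_X_self, map_one, mul_one]
      congr 1
      exact Finset.sum_congr rfl fun a _ => by ring
    · intro a _ ha
      rw [pderiv_X_of_ne ha.symm]; simp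
    · simp

theorem pderiv_blow (hi : i ∉ S) (hj : j ∉ S) (hij : i ≠ j) (c : Fin n)
    (g : MvPolynomial (Fin n) ℂ) :
    pderiv c (blow S i j g) =
      if c = i then blow S i j (pderiv i g) + ∑ a ∈ S, X a * blow S i j (pderiv a g)
      else if c = j then ∑ a ∈ insert i (insert j S), blow S i j (pderiv a g)
      else if c ∈ S then X i * blow S i j (pderiv c g)
      else blow S i j (pderiv c g) := by
  have hne : ∀ a ∈ S, a ≠ i ∧ a ≠ j := fun a ha => ⟨fun h => hi (h ▸ ha), fun h => hj (h ▸ ha)⟩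
  have key : ∀ a, pderiv c (if a = i then X j + X i else if a ∈ S then X j + X i * X a else X a
      : MvPolynomial (Fin n) ℂ) = if c = i then (if a = i then 1 else if a ∈ S then X a else 0)
      else if c = j then (if a ∈ insert i (insert j S) then 1 else 0)
      else if c ∈ S then (if a = c then X i else 0)
      else if a = c then 1 else 0 := by
    intro a
    have hP : ∀ b, pderiv c (X b : MvPolynomial (Fin n) ℂ) = if b = c then 1 else 0 := fun b => by
      rw [pderiv_X, Pi.single_apply]
    by_cases hai : a = i
    · subst hai
      rw [if_pos rfl, map_add, hP, hP]
      by_cases hc : c = a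
      · subst hc; simp [hij.symm]
      · by_cases hc' : c = j
        · subst hc'; simp [hc, hij]
        · simp [Ne.symm hc', hc, Ne.symm hc, hc']
    · rw [if_neg hai]
      by_cases haS : a ∈ S
      · rw [if_pos haS, map_add, Derivation.leibniz, hP, hP, hP]
        have := hne a haS
        by_cases hc : c = i
        · subst hc; simp [hij.symm, hai, haS]
        · by_cases hc' : c = j
          · subst hc'; simp [hc, hij, haS, this.2]
          · by_cases hcS : c ∈ S
            · simp [Ne.symm hc', hc, Ne.symm hc, hc', hcS]
            · have : a ≠ c := fun h => hcS (h ▸ haS)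
              simp [Ne.symm hc', hc, Ne.symm hc, hc', hcS, this]
      · rw [if_neg haS, hP]
        by_cases hc : c = i
        · subst hc; simp [hai, haS]
        · by_cases hc' : c = j
          · subst hc'; simp [hc, haS, hai]
          · by_cases hcS : c ∈ S
            · have : a ≠ c := fun h => haS (h ▸ hcS)
              simp [hc, hc', hcS, this]
            · simp [hc, hc', hcS]
  have h0 : pderiv c (blow S i j g) = ∑ a, blow S i j (pderiv a g) * pderiv c
      (if a = i then X j + X i else if a ∈ S then X j + X i * X a else X a
      : MvPolynomial (Fin n) ℂ) := pderiv_aeval _ c g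
  rw [h0, Finset.sum_congr rfl fun a _ => by rw [key a]]
  by_cases hc : c = i
  · simp only [hc, if_true]
    have : ∀ a, blow S i j (pderiv a g) * (if a = i then 1 else if a ∈ S then X a else 0)
        = (if a = i then blow S i j (pderiv a g) else 0)
          + if a ∈ S then X a * blow S i j (pderiv a g) else 0 := by
      intro a
      by_cases h1 : a = i
      · subst h1; simp [hi]
      · by_cases h2 : a ∈ S <;> simp [h1, h2, mul_comm]
    rw [Finset.sum_congr rfl fun a _ => this a, Finset.sum_add_distrib]
    simp [Finset.sum_ite_mem]
  · simp only [hc, if_false]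
    by_cases hc' : c = j
    · simp only [hc', if_true, mul_ite, mul_one, mul_zero, Finset.sum_ite_mem, Finset.univ_inter]
    · simp only [hc', if_false]
      by_cases hcS : c ∈ S
      · simp [hcS, mul_comm]
      · simp [hcS]

/-- The residue functional: integration over the unit cube after the blow-up substitution. -/
noncomputable def resid (S : Finset (Fin n)) (i j : Fin n) :
    MvPolynomial (Fin n) ℂ →ₗ[ℂ] MvPolynomial (Fin n) ℂ :=
  cubeInt S ∘ₗ (blow S i j).toLinearMap

theorem resid_apply (g : MvPolynomial (Fin n) ℂ) :
    resid S i j g = cubeInt S (blow S i j g) := rfl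

variable (hi : i ∉ S) (hj : j ∉ S) (hij : i ≠ j)
include hi hj hij

theorem resid_sub_mul (g : MvPolynomial (Fin n) ℂ) :
    resid S i j ((X i - X j) * g) = X i * resid S i j g := by
  rw [resid_apply, resid_apply, map_mul, map_sub, blow_X_fst, blow_X_snd hij hj, add_sub_cancel_left,
    cubeInt_X_mul hi]

theorem cubeInt_pderiv_blow {a : Fin n} (ha : a ∈ S) {g : MvPolynomial (Fin n) ℂ}
    (hg : (X a - X i) * (X a - X j) ∣ g) (p : MvPolynomial (Fin n) ℂ) :
    cubeInt S (pderiv a (p * blow S i j g)) = 0 := by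
  obtain ⟨q, rfl⟩ := hg
  have : p * blow S i j ((X a - X i) * (X a - X j) * q)
      = X a * (1 - X a) * (- (p * X i ^ 2 * blow S i j q)) := by
    rw [map_mul, map_mul, map_sub, map_sub, blow_X_fst, blow_X_snd hij hj, blow_X_mem hi ha]
    ring
  rw [this, cubeInt_pderiv_self ha]

theorem resid_pderiv_mem {a : Fin n} (ha : a ∈ S) {g : MvPolynomial (Fin n) ℂ}
    (hg : (X a - X i) * (X a - X j) ∣ g) : resid S i j (pderiv a g) = 0 := by
  have h := cubeInt_pderiv_blow hi hj hij ha hg 1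
  have hai : a ≠ i := fun h => hi (h ▸ ha)
  have haj : a ≠ j := fun h => hj (h ▸ ha)
  rw [one_mul, pderiv_blow hi hj hij, if_neg hai, if_neg haj, if_pos ha, cubeInt_X_mul hi] at h
  exact (mul_eq_zero.mp h).resolve_left (X_ne_zero i)

theorem resid_pderiv_of_notMem {a : Fin n} (hai : a ≠ i) (haj : a ≠ j) (ha : a ∉ S)
    (g : MvPolynomial (Fin n) ℂ) : resid S i j (pderiv a g) = pderiv a (resid S i j g) := by
  rw [resid_apply, resid_apply, ← cubeInt_pderiv ha, pderiv_blow hi hj hij, if_neg hai, if_neg haj,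
    if_neg ha]

theorem resid_sum_pderiv (g : MvPolynomial (Fin n) ℂ) :
    ∑ a ∈ insert i (insert j S), resid S i j (pderiv a g) = pderiv j (resid S i j g) := by
  rw [resid_apply, ← cubeInt_pderiv hj, pderiv_blow hi hj hij, if_neg hij.symm, if_pos rfl, map_sum]
  rfl

theorem resid_pderiv_fst {g : MvPolynomial (Fin n) ℂ}
    (hg : ∀ a ∈ S, (X a - X i) * (X a - X j) ∣ g) :
    X i * resid S i j (pderiv i g)
      = X i * pderiv i (resid S i j g) + (S.card : MvPolynomial (Fin n) ℂ) * resid S i j g := by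
  have h1 : ∀ a ∈ S, X i * cubeInt S (X a * blow S i j (pderiv a g)) = - resid S i j g := by
    intro a ha
    have hai : a ≠ i := fun h => hi (h ▸ ha)
    have haj : a ≠ j := fun h => hj (h ▸ ha)
    have h := cubeInt_pderiv_blow hi hj hij ha (hg a ha) (X a)
    rw [Derivation.leibniz, pderiv_X_self, pderiv_blow hi hj hij, if_neg hai, if_neg haj, if_pos ha,
      smul_eq_mul, smul_eq_mul, mul_one, map_add, mul_left_comm, cubeInt_X_mul hi] at h
    rw [resid_apply]
    linear_combination h
  rw [resid_apply g, ← cubeInt_pderiv hi, pderiv_blow hi hj hij, if_pos rfl, map_add, map_sum,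
    mul_add, Finset.mul_sum, Finset.sum_congr rfl h1, Finset.sum_const, nsmul_eq_mul, resid_apply,
    resid_apply]
  ring

end

end Arrangement

namespace Arrangement

section

variable {n : ℕ}

theorem leibniz_prod {σ : Type*} {R A : Type*} [DecidableEq σ] [CommRing R] [CommRing A]
    [Algebra R A] (d : Derivation R A A) (s : Finset σ) (f : σ → A) :
    d (∏ q ∈ s, f q) = ∑ q ∈ s, d (f q) * ∏ p ∈ s.erase q, f p := by
  induction s using Finset.induction_on with
  | empty => simp
  | insert a s ha ih =>
    rw [Finset.prod_insert ha, Derivation.leibniz, ih, Finset.sum_insert ha,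
      Finset.erase_insert ha, add_comm, smul_eq_mul, smul_eq_mul, mul_comm, Finset.mul_sum]
    congr 1
    refine Finset.sum_congr rfl fun q hq => ?_
    have hqa : q ≠ a := fun h => ha (h ▸ hq)
    rw [Finset.erase_insert_of_ne hqa.symm, Finset.prod_insert (by simp [ha])]
    ring

/-- The defining polynomial of the subarrangement indexed by `Γ`. -/
noncomputable def subF (Γ : Finset (BraidIdx n)) : MvPolynomial (Fin n) ℂ :=
  ∏ q ∈ Γ, braidForm n q

theorem subF_mul_sum (Γ : Finset (BraidIdx n)) (a : Fin n) :
    subF Γ * ∑ q ∈ Γ, pderiv a (braidForm n q) * ∏ p ∈ Finset.univ.erase q, braidForm n p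
      = subF Finset.univ * pderiv a (subF Γ) := by
  rw [subF, subF, leibniz_prod, Finset.mul_sum, Finset.mul_sum]
  refine Finset.sum_congr rfl fun q hq => ?_
  rw [← Finset.mul_prod_erase _ _ hq, ← Finset.mul_prod_erase _ _ (Finset.mem_univ q)]
  ring

theorem exists_braidForm {a b : Fin n} (h : a ≠ b) : ∃ q : BraidIdx n,
    (q.1 = (a, b) ∨ q.1 = (b, a)) ∧ Associated (X a - X b) (braidForm n q) := by
  rcases lt_or_gt_of_ne h with h | h
  · exact ⟨⟨(a, b), h⟩, Or.inl rfl, Associated.refl _⟩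
  · refine ⟨⟨(b, a), h⟩, Or.inr rfl, ?_⟩
    rw [braidForm, ← neg_sub]
    exact Associated.neg_left (Associated.refl _)

theorem sub_mul_sub_dvd_subF {a b c : Fin n} (hab : a ≠ b) (hac : a ≠ c) (hbc : b ≠ c) :
    (X a - X b) * (X a - X c) ∣ subF (Finset.univ : Finset (BraidIdx n)) := by
  obtain ⟨q, hq, hq'⟩ := exists_braidForm hab
  obtain ⟨p, hp, hp'⟩ := exists_braidForm hac
  have hne : q ≠ p := by
    rintro rfl
    rcases hq with hq | hq <;> rw [hq] at hp <;> simp_all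
  refine (mul_dvd_mul hq'.dvd hp'.dvd).trans ?_
  rw [← Finset.prod_pair hne (f := braidForm n)]
  exact Finset.prod_dvd_prod_of_subset _ _ _ (Finset.subset_univ _)

variable {S : Finset (Fin n)} {i j : Fin n}

theorem X_pow_dvd_resid_step (hi : i ∉ S) (hj : j ∉ S) (hij : i ≠ j)
    {h : MvPolynomial (Fin n) ℂ} {h' : Fin n → MvPolynomial (Fin n) ℂ} {d : ℕ}
    (hb : ∀ a ∈ S, (X a - X i) * (X a - X j) ∣ h)
    (hh' : ∀ a, (X i - X j) * h' a = (X i - X j) * pderiv a h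
      - ((d + S.card : ℕ) : MvPolynomial (Fin n) ℂ) * pderiv a (X i - X j) * h)
    (hd : ∀ g, X i ^ d ∣ resid S i j (g * h)) (a : Fin n) (g : MvPolynomial (Fin n) ℂ) :
    X i ^ d ∣ resid S i j (g * h' a) := by
  have hX : (X i : MvPolynomial (Fin n) ℂ) ≠ 0 := X_ne_zero i
  have hX' : (X i - X j : MvPolynomial (Fin n) ℂ) ≠ 0 := by
    rw [sub_ne_zero]
    exact fun h => hij (X_injective h)
  have hs : ∀ a g, (X i - X j) * (g * h' a) = (X i - X j) * pderiv a (g * h)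
      - ((X i - X j) * (pderiv a g * h)
        + ((d + S.card : ℕ) : MvPolynomial (Fin n) ℂ) * (pderiv a (X i - X j) * (g * h))) := by
    intro a g
    rw [Derivation.leibniz, smul_eq_mul, smul_eq_mul]
    linear_combination g * hh' a
  have hzero : ∀ a, a ≠ i → a ≠ j → ∀ g, g * h' a = pderiv a (g * h) - pderiv a g * h := by
    intro a hai haj g
    apply mul_left_cancel₀ hX'
    rw [hs a g, map_sub, pderiv_X_of_ne hai.symm, pderiv_X_of_ne haj.symm]
    ring
  have hmem : ∀ a ∈ S, ∀ g, X i ^ d ∣ resid S i j (g * h' a) := by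
    intro a ha g
    rw [hzero a (fun h => hi (h ▸ ha)) (fun h => hj (h ▸ ha)), map_sub,
      resid_pderiv_mem hi hj hij ha ((hb a ha).mul_left g), zero_sub, dvd_neg]
    exact hd _
  have hfst : ∀ g, X i ^ d ∣ resid S i j (g * h' i) := by
    intro g
    have h1 := congrArg (resid S i j) (hs i g)
    rw [map_sub, map_add, show pderiv i (X i - X j : MvPolynomial (Fin n) ℂ) = 1 by
        rw [map_sub, pderiv_X_self, pderiv_X_of_ne hij.symm, sub_zero],
      one_mul, resid_sub_mul hi hj hij, resid_sub_mul hi hj hij, resid_sub_mul hi hj hij,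
      resid_pderiv_fst hi hj hij fun a ha => (hb a ha).mul_left g,
      ← nsmul_eq_mul (d + S.card) (g * h), map_nsmul, nsmul_eq_mul] at h1
    obtain ⟨u, hu⟩ := hd g
    obtain ⟨v, hv⟩ := hd (pderiv i g)
    rw [hu, hv, Derivation.leibniz, Derivation.leibniz_pow, pderiv_X_self] at h1
    refine ⟨pderiv i u - v, mul_left_cancel₀ hX (h1.trans ?_)⟩
    rcases d with _ | d
    · simp; ring
    · simp only [smul_eq_mul, nsmul_eq_mul, Nat.add_sub_cancel]
      push_cast
      ring
  by_cases haS : a ∈ S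
  · exact hmem a haS g
  by_cases hai : a = i
  · subst hai; exact hfst g
  by_cases haj : a = j
  · subst haj
    have hsum : ∑ b ∈ insert i (insert a S), g * h' b
        = ∑ b ∈ insert i (insert a S), pderiv b (g * h)
          - ∑ b ∈ insert i (insert a S), pderiv b g * h := by
      have hia : i ∉ insert a S := by simp [hij, hi]
      apply mul_left_cancel₀ hX'
      rw [mul_sub, Finset.mul_sum, Finset.mul_sum, Finset.mul_sum,
        Finset.sum_congr rfl fun b _ => hs b g, Finset.sum_sub_distrib, Finset.sum_add_distrib]
      have hz : ∑ b ∈ insert i (insert a S), ((d + S.card : ℕ) : MvPolynomial (Fin n) ℂ) *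
          (pderiv b (X i - X a) * (g * h)) = 0 := by
        rw [← Finset.mul_sum, ← Finset.sum_mul, Finset.sum_insert hia, Finset.sum_insert haS,
          Finset.sum_eq_zero fun b hb => ?_]
        · simp only [map_sub, pderiv_X_self, pderiv_X_of_ne hij, pderiv_X_of_ne hij.symm]
          ring
        · rw [map_sub, pderiv_X_of_ne (ne_of_mem_of_not_mem hb hi).symm,
            pderiv_X_of_ne (ne_of_mem_of_not_mem hb hj).symm, sub_zero]
      rw [hz]; ring
    have h1 := congrArg (resid S i a) hsum
    rw [map_sub, map_sum, map_sum, map_sum, resid_sum_pderiv hi hj hij,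
      Finset.sum_insert (by simp [hij, hi]), Finset.sum_insert haS] at h1
    have h2 : resid S i a (g * h' a) = pderiv a (resid S i a (g * h))
        - ∑ b ∈ insert i (insert a S), resid S i a (pderiv b g * h)
        - resid S i a (g * h' i) - ∑ b ∈ S, resid S i a (g * h' b) := by
      linear_combination h1
    rw [h2]
    refine dvd_sub (dvd_sub (dvd_sub ?_ (Finset.dvd_sum fun b _ => hd _)) (hfst g))
      (Finset.dvd_sum fun b hb => hmem b hb g)
    obtain ⟨u, hu⟩ := hd g
    rw [hu, Derivation.leibniz, Derivation.leibniz_pow, pderiv_X_of_ne hij]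
    simp
  · rw [hzero a hai haj, map_sub, resid_pderiv_of_notMem hi hj hij hai haj haS]
    refine dvd_sub ?_ (hd _)
    obtain ⟨u, hu⟩ := hd g
    rw [hu, Derivation.leibniz, Derivation.leibniz_pow, pderiv_X_of_ne (Ne.symm hai)]
    simp

end

end Arrangement

namespace Arrangement

section

variable {n : ℕ}

/-- The specialization of the exponents at a point. -/
noncomputable def spec (s : BraidIdx n → ℂ) : BA n →ₐ[ℂ] MvPolynomial (Fin n) ℂ :=
  aeval (Sum.elim X fun q => C (s q))

theorem spec_rename_inl (s : BraidIdx n → ℂ) (g : MvPolynomial (Fin n) ℂ) :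
    spec s (rename Sum.inl g) = g := by
  rw [spec, aeval_rename]
  exact aeval_X_left_apply g

theorem spec_X_inr (s : BraidIdx n → ℂ) (q : BraidIdx n) : spec s (X (Sum.inr q)) = C (s q) := by
  simp [spec]

theorem spec_rho (s : BraidIdx n → ℂ) (c : SR n) : spec s (rho n c) = C (eval s c) := by
  rw [spec, rho, aeval_rename]
  induction c using MvPolynomial.induction_on with
  | C r => simp
  | add p q hp hq => rw [map_add, hp, hq, map_add, map_add]
  | mul_X p q hp => rw [map_mul, hp, map_mul, aeval_X, eval_X, C_mul]; rfl

theorem spec_braidF (s : BraidIdx n → ℂ) : spec s (braidF n) = subF Finset.univ :=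
  spec_rename_inl s _

theorem spec_dd (s : BraidIdx n → ℂ) (a : Fin n) (r : BA n) :
    spec s (dd a r) = pderiv a (spec s r) := by
  unfold dd
  induction r using MvPolynomial.induction_on with
  | C r => simp
  | add p q hp hq => simp only [map_add, hp, hq]
  | mul_X p q hp =>
    simp only [map_mul, Derivation.leibniz, map_add, smul_eq_mul, hp, pderiv_X]
    congr 2
    rcases q with b | q
    · by_cases h : b = a
      · subst h; simp [spec]
      · have : (Sum.inl b : Fin n ⊕ BraidIdx n) ≠ Sum.inl a := by simpa using h
        simp [spec, h]
    · simp [spec]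

/-- The numerator of the logarithmic derivative of `∏ l_q ^ s_q`. -/
noncomputable def logNum (n : ℕ) (a : Fin n) : BA n :=
  ∑ q : BraidIdx n, X (Sum.inr q) *
    rename Sum.inl (pderiv a (braidForm n q) * ∏ p ∈ Finset.univ.erase q, braidForm n p)

variable (S : Finset (Fin n)) (i j : Fin n) (k μ ν : ℕ)

/-- The order of vanishing of the residues. -/
def resOrder : ℕ := (2 * μ + 4 * ν) * (edges (insert i (insert j S))).card + k + 1

/-- The exponents at which the residues are taken. -/
noncomputable def resPoint (q : BraidIdx n) : ℂ :=
  2 * μ + (if q ∈ edges (insert i (insert j S)) then (4 * ν : ℂ) else 0)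
    - if q.1 = (i, j) then ((resOrder S i j k μ ν + S.card : ℕ) : ℂ) else 0

variable {S i j}

theorem spec_logNum (hlt : i < j) (a : Fin n) :
    subF (edges (insert i (insert j S))) * (X i - X j) * spec (resPoint S i j k μ ν) (logNum n a)
      = ((2 * μ : ℕ) : MvPolynomial (Fin n) ℂ) * pderiv a (subF Finset.univ)
          * subF (edges (insert i (insert j S))) * (X i - X j)
        + ((4 * ν : ℕ) : MvPolynomial (Fin n) ℂ) * subF Finset.univ
          * pderiv a (subF (edges (insert i (insert j S)))) * (X i - X j)
        - ((resOrder S i j k μ ν + S.card : ℕ) : MvPolynomial (Fin n) ℂ) * pderiv a (X i - X j)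
          * subF Finset.univ * subF (edges (insert i (insert j S))) := by
  set Γ := edges (insert i (insert j S)) with hΓ
  set M := resOrder S i j k μ ν + S.card with hM
  set T : BraidIdx n → MvPolynomial (Fin n) ℂ := fun q =>
    pderiv a (braidForm n q) * ∏ p ∈ Finset.univ.erase q, braidForm n p with hT
  have hC : ∀ q : BraidIdx n, (C (resPoint S i j k μ ν q) : MvPolynomial (Fin n) ℂ)
      = ((2 * μ : ℕ) : MvPolynomial (Fin n) ℂ)
        + (if q ∈ Γ then ((4 * ν : ℕ) : MvPolynomial (Fin n) ℂ) else 0)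
        - if q = ⟨(i, j), hlt⟩ then (M : MvPolynomial (Fin n) ℂ) else 0 := by
    intro q
    rw [resPoint, ← hΓ, ← hM, map_sub, map_add]
    simp only [Subtype.ext_iff]
    have h2 : (C (2 : ℂ) : MvPolynomial (Fin n) ℂ) = 2 := map_ofNat C 2
    have h4 : (C (4 : ℂ) : MvPolynomial (Fin n) ℂ) = 4 := map_ofNat C 4
    split_ifs <;> simp [h2, h4]
  have h1 : spec (resPoint S i j k μ ν) (logNum n a) = ((2 * μ : ℕ) : MvPolynomial (Fin n) ℂ)
      * ∑ q, T q + ((4 * ν : ℕ) : MvPolynomial (Fin n) ℂ) * ∑ q ∈ Γ, T q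
      - (M : MvPolynomial (Fin n) ℂ) * T ⟨(i, j), hlt⟩ := by
    have h2 : ∀ q, spec (resPoint S i j k μ ν) (X (Sum.inr q) *
        rename Sum.inl (pderiv a (braidForm n q) * ∏ p ∈ Finset.univ.erase q, braidForm n p))
        = ((2 * μ : ℕ) : MvPolynomial (Fin n) ℂ) * T q
          + (if q ∈ Γ then ((4 * ν : ℕ) : MvPolynomial (Fin n) ℂ) * T q else 0)
          - if q = ⟨(i, j), hlt⟩ then (M : MvPolynomial (Fin n) ℂ) * T q else 0 := by
      intro q
      rw [map_mul, spec_X_inr, spec_rename_inl, hC, sub_mul, add_mul, ite_mul, ite_mul, zero_mul]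
    rw [logNum, map_sum, Finset.sum_congr rfl fun q _ => h2 q, Finset.sum_sub_distrib,
      Finset.sum_add_distrib, Finset.mul_sum, Finset.mul_sum]
    simp
  have h2 : pderiv a (subF Finset.univ) = ∑ q, T q := leibniz_prod _ _ _
  have h3 : subF Γ * ∑ q ∈ Γ, T q = subF Finset.univ * pderiv a (subF Γ) := subF_mul_sum Γ a
  have h4 : (X i - X j) * T ⟨(i, j), hlt⟩ = pderiv a (X i - X j) * subF Finset.univ := by
    rw [subF, ← Finset.mul_prod_erase _ _ (Finset.mem_univ (⟨(i, j), hlt⟩ : BraidIdx n)), hT]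
    simp only [braidForm]
    ring
  rw [h1, h2]
  linear_combination (X i - X j) * ((4 * ν : ℕ) : MvPolynomial (Fin n) ℂ) * h3
    - subF Γ * (M : MvPolynomial (Fin n) ℂ) * h4

theorem subF_ne_zero (Γ : Finset (BraidIdx n)) : subF Γ ≠ 0 := by
  refine Finset.prod_ne_zero_iff.mpr fun q _ => ?_
  rw [braidForm, sub_ne_zero]
  exact fun h => q.2.ne (X_injective h)

/-- The weight by which specialized numerators with denominator `F ^ N` are multiplied. -/
noncomputable def resWeight (S : Finset (Fin n)) (i j : Fin n) (N μ ν : ℕ) :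
    MvPolynomial (Fin n) ℂ :=
  subF Finset.univ ^ (2 * μ - N) * subF (edges (insert i (insert j S))) ^ (4 * ν)

theorem resWeight_step (hlt : i < j) (a : Fin n) {N : ℕ} (hN : N + 1 ≤ 2 * μ) (r : BA n) :
    (X i - X j) * (spec (resPoint S i j k μ ν)
        (braidF n * dd a r + r * logNum n a - N * dd a (braidF n) * r) *
          resWeight S i j (N + 1) μ ν)
      = (X i - X j) * pderiv a (spec (resPoint S i j k μ ν) r * resWeight S i j N μ ν)
        - ((resOrder S i j k μ ν + S.card : ℕ) : MvPolynomial (Fin n) ℂ) * pderiv a (X i - X j)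
          * (spec (resPoint S i j k μ ν) r * resWeight S i j N μ ν) := by
  apply mul_left_cancel₀ (subF_ne_zero (edges (insert i (insert j S))))
  have h := spec_logNum (S := S) k μ ν hlt a
  obtain ⟨c, hc⟩ : ∃ c, 2 * μ = N + 1 + c := ⟨2 * μ - (N + 1), by omega⟩
  have hc1 : 2 * μ - N = c + 1 := by omega
  have hc2 : 2 * μ - (N + 1) = c := by omega
  rw [hc] at h
  rw [resWeight, resWeight, hc1, hc2]
  set Γ := edges (insert i (insert j S)) with hΓ
  set M := resOrder S i j k μ ν + S.card with hM
  have hpow : subF Γ * pderiv a (subF Γ ^ (4 * ν))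
      = ((4 * ν : ℕ) : MvPolynomial (Fin n) ℂ) * subF Γ ^ (4 * ν) * pderiv a (subF Γ) := by
    rw [Derivation.leibniz_pow, smul_eq_mul, nsmul_eq_mul]
    rcases Nat.eq_zero_or_pos (4 * ν) with h0 | h0
    · rw [h0]; simp
    · obtain ⟨e, he⟩ : ∃ e, 4 * ν = e + 1 := ⟨4 * ν - 1, by omega⟩
      rw [he, Nat.add_sub_cancel]; ring
  simp only [map_sub (spec _), map_add (spec _), map_mul (spec _), spec_dd, spec_braidF,
    map_natCast, Derivation.leibniz, Derivation.leibniz_pow (pderiv a) (subF Finset.univ),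
    Nat.add_sub_cancel, smul_eq_mul, nsmul_eq_mul]
  push_cast at h ⊢
  push_cast at hpow
  linear_combination spec (resPoint S i j k μ ν) r * subF Finset.univ ^ c * subF Γ ^ (4 * ν) * h
    - (X i - X j) * spec (resPoint S i j k μ ν) r * subF Finset.univ ^ (c + 1) * hpow

variable {L : Type} [CommRing L] [Algebra (BA n) L]

local notation "φ" => algebraMap (BA n) L

variable (L S i j) in
/-- The elements whose residues vanish to a high order. -/
def resMod : Submodule (BA n) L where
  carrier := {m | ∃ (N : ℕ) (r : BA n) (d : ℕ), N + 1 ≤ 2 * d ∧ φ (braidF n) ^ N * m = φ r ∧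
    ∀ μ ν, d ≤ μ → ∀ g, X i ^ resOrder S i j k μ ν ∣
      resid S i j (g * (spec (resPoint S i j k μ ν) r * resWeight S i j N μ ν))}
  zero_mem' := ⟨0, 0, 1, by simp, by simp, by simp⟩
  add_mem' := by
    rintro m m' ⟨N, r, d, hN, hm, h⟩ ⟨N', r', d', hN', hm', h'⟩
    refine ⟨N + N', braidF n ^ N' * r + braidF n ^ N * r', d + d', by omega, ?_, ?_⟩
    · simp only [map_add, map_mul, map_pow]
      linear_combination φ (braidF n) ^ N' * hm + φ (braidF n) ^ N * hm'
    · intro μ ν hμ g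
      have key : spec (resPoint S i j k μ ν) (braidF n ^ N' * r + braidF n ^ N * r')
          * resWeight S i j (N + N') μ ν = spec (resPoint S i j k μ ν) r * resWeight S i j N μ ν
          + spec (resPoint S i j k μ ν) r' * resWeight S i j N' μ ν := by
        simp only [resWeight, map_add, map_mul, map_pow, spec_braidF]
        rw [show 2 * μ - N = (2 * μ - (N + N')) + N' by omega,
          show 2 * μ - N' = (2 * μ - (N + N')) + N by omega]
        ring
      rw [key, mul_add, map_add]
      exact dvd_add (h μ ν (by omega) g) (h' μ ν (by omega) g)
  smul_mem' := by
    rintro c m ⟨N, r, d, hN, hm, h⟩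
    refine ⟨N, c * r, d, hN, ?_, fun μ ν hμ g => ?_⟩
    · rw [Algebra.smul_def, map_mul]
      linear_combination φ c * hm
    · rw [map_mul (spec _), mul_assoc, ← mul_assoc g]
      exact h μ ν hμ _

theorem Setting.resMod_memD {D : Fin n → L →+ L} {E : Submodule (BA n) L} (hS : Setting D E)
    (hlog : ∀ a, φ (braidF n) * D a 1 = φ (logNum n a)) (hi : i ∉ S) (hj : j ∉ S) (hlt : i < j)
    (a : Fin n) {m : L} (hm : m ∈ resMod S i j k L) : D a m ∈ resMod S i j k L := by
  obtain ⟨N, r, d, hN, hr, h⟩ := hm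
  refine ⟨N + 1, braidF n * dd a r + r * logNum n a - N * dd a (braidF n) * r, d + 1, by omega,
    ?_, fun μ ν hμ => X_pow_dvd_resid_step hi hj hlt.ne (fun b hb => ?_)
      (fun a => resWeight_step k μ ν hlt a (by omega) r) (h μ ν (by omega)) a⟩
  · have h1 := hS.leib a (braidF n ^ N) m
    rw [map_pow, hr, hS.D_phi] at h1
    have h2 : φ (braidF n) * φ (dd a (braidF n ^ N))
        = N * φ (dd a (braidF n)) * φ (braidF n) ^ N := by
      rw [Derivation.leibniz_pow, smul_eq_mul, nsmul_eq_mul, map_mul, map_mul, map_natCast, map_pow]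
      rcases N with _ | N
      · simp
      · rw [Nat.add_sub_cancel]; ring
    simp only [map_sub, map_add, map_mul, map_natCast]
    linear_combination (-φ (braidF n)) * h1 + φ r * hlog a - m * h2
      - N * φ (dd a (braidF n)) * hr
  · refine Dvd.dvd.mul_left (Dvd.dvd.mul_right ?_ _) _
    refine (sub_mul_sub_dvd_subF (ne_of_mem_of_not_mem hb hi) (ne_of_mem_of_not_mem hb hj) hlt.ne).trans
      (dvd_pow_self _ (by omega))

end

end Arrangement

namespace Arrangement

section

variable {n : ℕ}

theorem card_mul_card_sub_one_le_sum (T : Finset ℕ) :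
    T.card * (T.card - 1) ≤ 2 * ∑ x ∈ T, x := by
  induction T using Finset.induction_on_max with
  | empty => simp
  | insert a s hs ih =>
    have ha : a ∉ s := fun h => lt_irrefl _ (hs a h)
    have hc : s.card ≤ a := by
      simpa using Finset.card_le_card (show s ⊆ Finset.range a from fun x hx => by simpa using hs x hx)
    rw [Finset.card_insert_of_notMem ha, Finset.sum_insert ha, Nat.add_sub_cancel]
    rcases Nat.eq_zero_or_pos s.card with h | h
    · rw [h]; simp
    · obtain ⟨c, hc'⟩ : ∃ c, s.card = c + 1 := ⟨s.card - 1, by omega⟩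
      rw [hc'] at ih hc ⊢
      rw [Nat.add_sub_cancel] at ih
      nlinarith

theorem exists_ne_map_eq_of_sum_lt {σ : Type*} (S : Finset σ) (f : σ → ℕ)
    (h : 2 * ∑ a ∈ S, f a < S.card * (S.card - 1)) : ∃ a ∈ S, ∃ b ∈ S, a ≠ b ∧ f a = f b := by
  by_contra! hne
  have hinj : Set.InjOn f S := fun a ha b hb hab => by
    by_contra h'
    exact hne a ha b hb h' hab
  have := card_mul_card_sub_one_le_sum (S.image f)
  rw [Finset.card_image_of_injOn hinj, Finset.sum_image hinj] at this
  omega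

theorem rename_subF_univ {σ : Equiv.Perm (Fin n)} :
    rename σ (subF (Finset.univ : Finset (BraidIdx n)))
      = (Equiv.Perm.sign σ : MvPolynomial (Fin n) ℂ) * subF Finset.univ := by
  have h : subF (Finset.univ : Finset (BraidIdx n))
      = (Matrix.vandermonde fun a : Fin n => (-X a : MvPolynomial (Fin n) ℂ)).det := by
    rw [Matrix.det_vandermonde, subF]
    have := sum_braidIdx (M := Additive (MvPolynomial (Fin n) ℂ))
      fun q => Additive.ofMul (braidForm n q)
    have h2 : ∏ q, braidForm n q = ∏ a : Fin n, ∏ b : Fin n, if a < b then X a - X b else 1 := by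
      refine this.trans ?_
      refine Finset.sum_congr rfl fun a _ => Finset.sum_congr rfl fun b _ => ?_
      by_cases h : a < b
      · simp only [h, dif_pos, if_pos]; rfl
      · simp only [h, dif_neg, if_neg, not_false_eq_true]; rfl
    rw [h2]
    refine Finset.prod_congr rfl fun a _ => ?_
    rw [← Finset.prod_filter]
    refine Finset.prod_congr (by ext b; simp) fun b _ => by ring
  rw [h, AlgHom.map_det, ← Matrix.det_permute]
  congr 1
  ext a b
  simp [Matrix.vandermonde_apply]

theorem subF_edges_pow_four (I : Finset (Fin n)) :
    subF (edges I) ^ 4 = ∏ a ∈ I, ∏ b ∈ I, if a = b then 1 else (X a - X b) ^ 2 := by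
  have h := sum_sum_sv (M := Additive (MvPolynomial (Fin n) ℂ)) I
    (fun a b => Additive.ofMul (if a = b then 1 else (X a - X b) ^ 2))
    (fun a b => by
      by_cases h : a = b
      · simp [h]
      · simp only [h, Ne.symm h, if_false]; congr 1; ring) (fun a => by simp)
  have h2 : ∏ a ∈ I, ∏ b ∈ I, (if a = b then 1 else (X a - X b) ^ 2 : MvPolynomial (Fin n) ℂ)
      = (∏ q ∈ edges I, if q.1.1 = q.1.2 then 1 else (X q.1.1 - X q.1.2) ^ 2) ^ 2 := h
  rw [h2, subF, show (4 : ℕ) = 2 * 2 from rfl, pow_mul, ← Finset.prod_pow]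
  congr 1
  exact Finset.prod_congr rfl fun q _ => by rw [if_neg q.2.ne, braidForm]

theorem rename_subF_edges_pow_four {I : Finset (Fin n)} {a b : Fin n} (ha : a ∈ I) (hb : b ∈ I) :
    rename (Equiv.swap a b) (subF (edges I) ^ 4) = subF (edges I) ^ 4 := by
  have hI : ∀ c, c ∈ I ↔ Equiv.swap a b c ∈ I := fun c => by
    by_cases h1 : c = a
    · subst h1; simp [ha, hb]
    by_cases h2 : c = b
    · subst h2; simp [ha, hb]
    rw [Equiv.swap_apply_of_ne_of_ne h1 h2]
  rw [subF_edges_pow_four, map_prod]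
  refine Finset.prod_equiv (Equiv.swap a b) hI fun c _ => ?_
  rw [map_prod]
  refine Finset.prod_equiv (Equiv.swap a b) hI fun d _ => ?_
  by_cases h : c = d
  · simp [h]
  · simp [h]

variable {S : Finset (Fin n)} {i j : Fin n}

theorem rename_blow (hi : i ∉ S) (hj : j ∉ S) {a b : Fin n} (ha : a ∈ S) (hb : b ∈ S)
    (g : MvPolynomial (Fin n) ℂ) : rename (Equiv.swap a b) (blow S i j g)
      = blow S i j (rename (Equiv.swap a b) g) := by
  have hi' : Equiv.swap a b i = i := Equiv.swap_apply_of_ne_of_ne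
    (ne_of_mem_of_not_mem ha hi).symm (ne_of_mem_of_not_mem hb hi).symm
  have hj' : Equiv.swap a b j = j := Equiv.swap_apply_of_ne_of_ne
    (ne_of_mem_of_not_mem ha hj).symm (ne_of_mem_of_not_mem hb hj).symm
  have : (rename (Equiv.swap a b)).comp (blow S i j)
      = (blow S i j).comp (rename (R := ℂ) (Equiv.swap a b)) := by
    apply algHom_ext
    intro c
    rw [AlgHom.comp_apply, AlgHom.comp_apply, rename_X, blow_X, blow_X]
    by_cases hci : c = i
    · subst hci; rw [if_pos rfl, hi', if_pos rfl, map_add, rename_X, rename_X, hi', hj']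
    have h1 : Equiv.swap a b c ≠ i := fun h => hci (by rw [← hi'] at h; exact (Equiv.injective _) h)
    rw [if_neg hci, if_neg h1]
    have h2 : Equiv.swap a b c ∈ S ↔ c ∈ S := by
      by_cases h1 : c = a
      · subst h1; simp [ha, hb]
      by_cases h2 : c = b
      · subst h2; simp [ha, hb]
      rw [Equiv.swap_apply_of_ne_of_ne h1 h2]
    by_cases hcS : c ∈ S
    · rw [if_pos hcS, if_pos (h2.mpr hcS), map_add, map_mul, rename_X, rename_X, rename_X, hi', hj']
    · rw [if_neg hcS, if_neg (mt h2.mp hcS), rename_X]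
  exact congrArg (fun f : MvPolynomial (Fin n) ℂ →ₐ[ℂ] MvPolynomial (Fin n) ℂ => f g) this

/-- The polynomials all of whose monomials have total degree in the variables in `S` at most the
degree in the variable `x_i`. -/
def tame (S : Finset (Fin n)) (i : Fin n) : Subalgebra ℂ (MvPolynomial (Fin n) ℂ) where
  carrier := {p | ∀ γ ∈ p.support, ∑ a ∈ S, γ a ≤ γ i}
  mul_mem' := by
    intro p q hp hq γ hγ
    obtain ⟨α, hα, β, hβ, rfl⟩ := Finset.mem_add.mp (support_mul p q hγ)
    simp only [Finsupp.add_apply, Finset.sum_add_distrib]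
    exact add_le_add (hp α hα) (hq β hβ)
  add_mem' := by
    intro p q hp hq γ hγ
    rcases Finset.mem_union.mp (support_add hγ) with h | h
    · exact hp γ h
    · exact hq γ h
  algebraMap_mem' := by
    intro c γ hγ
    rw [algebraMap_eq, mem_support_iff, coeff_C] at hγ
    have : (0 : Fin n →₀ ℕ) = γ := by by_contra h; simp [h] at hγ
    simp [← this]

theorem monomial_mem_tame {γ : Fin n →₀ ℕ} (h : ∑ a ∈ S, γ a ≤ γ i) (c : ℂ) :
    monomial γ c ∈ tame S i := by
  intro γ' h'
  have := Finset.mem_singleton.mp (support_monomial_subset h')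
  rwa [this]

theorem blow_mem_tame (hi : i ∉ S) (hj : j ∉ S) (g : MvPolynomial (Fin n) ℂ) :
    blow S i j g ∈ tame S i := by
  have hX : ∀ b, b ∉ S → X b ∈ tame S i := fun b hb => by
    refine monomial_mem_tame ?_ 1
    rw [Finset.sum_eq_zero fun a ha => ?_]
    · exact Nat.zero_le _
    · have : b ≠ a := fun h => hb (h ▸ ha)
      simp [this]
  induction g using MvPolynomial.induction_on with
  | C r => rw [← algebraMap_eq, AlgHom.commutes]; exact Subalgebra.algebraMap_mem _ _
  | add p q hp hq => rw [map_add]; exact add_mem hp hq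
  | mul_X p q hp =>
    rw [map_mul]
    refine mul_mem hp ?_
    rw [blow_X]
    split_ifs with h1 h2
    · exact add_mem (hX _ hj) (hX _ hi)
    · refine add_mem (hX _ hj) ?_
      rw [X, X, monomial_mul]
      refine monomial_mem_tame ?_ _
      have hqi : q ≠ i := h1
      simp only [Finsupp.add_apply, Finset.sum_add_distrib, Finsupp.single_apply, if_true,
        Finset.sum_ite_eq, h2, hi, if_false, hqi]
      simp
    · exact hX _ h2

theorem X_pow_dvd_cubeInt (hi : i ∉ S) {K : MvPolynomial (Fin n) ℂ}
    (hK : ∀ a ∈ S, ∀ b ∈ S, a ≠ b → rename (Equiv.swap a b) K = -K)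
    {c : ℕ} (hc : 2 * c ≤ S.card * (S.card - 1)) {p : MvPolynomial (Fin n) ℂ}
    (hp : p ∈ tame S i) : X i ^ c ∣ cubeInt S (p * K) := by
  rw [p.as_sum, Finset.sum_mul, map_sum]
  refine Finset.dvd_sum fun γ hγ => ?_
  by_cases h : c ≤ γ i
  · obtain ⟨e, he⟩ := Nat.exists_eq_add_of_le h
    have : monomial γ (coeff γ p) = X i ^ c * monomial (γ - Finsupp.single i c) (coeff γ p) := by
      rw [X_pow_eq_monomial, monomial_mul, one_mul, add_tsub_cancel_of_le]
      rwa [Finsupp.single_le_iff]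
    rw [this, mul_assoc, cubeInt_X_pow_mul hi]
    exact dvd_mul_right _ _
  · have h1 := hp γ hγ
    obtain ⟨a, ha, b, hb, hab, he⟩ := exists_ne_map_eq_of_sum_lt S γ (by omega)
    have h2 : rename (Equiv.swap a b) (monomial γ (coeff γ p)) = monomial γ (coeff γ p) := by
      rw [rename_monomial]
      congr 2
      ext d
      have h3 : (Finsupp.mapDomain (Equiv.swap a b) γ) d = γ (Equiv.swap a b d) := by
        conv_lhs => rw [← Equiv.swap_apply_self a b d]
        exact Finsupp.mapDomain_apply (Equiv.injective _) _ _
      rw [h3]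
      by_cases h1 : d = a
      · subst h1; simp [he]
      by_cases h2 : d = b
      · subst h2; simp [he]
      rw [Equiv.swap_apply_of_ne_of_ne h1 h2]
    have h3 := cubeInt_rename_swap ha hb (monomial γ (coeff γ p) * K)
    rw [map_mul (rename _), h2, hK a ha b hb hab, mul_neg, map_neg, neg_eq_iff_add_eq_zero,
      ← two_mul] at h3
    rw [(mul_eq_zero.mp h3).resolve_left two_ne_zero]
    exact dvd_zero _

theorem X_dvd_blow_braidForm {q : BraidIdx n}
    (hq : q ∈ edges (insert i (insert j S))) : X i ∣ blow S i j (braidForm n q) := by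
  have key : ∀ a ∈ insert i (insert j S), X i ∣ blow S i j (X a) - X j := by
    intro a ha
    rw [blow_X]
    split_ifs with h1 h2
    · simp
    · simp
    · have : a = j := by simpa [h1, h2] using ha
      simp [this]
  rw [mem_edges] at hq
  have h := dvd_sub (key _ hq.1) (key _ hq.2)
  rw [sub_sub_sub_cancel_right, ← map_sub] at h
  exact h

theorem exists_blow_subF_edges :
    ∃ V, blow S i j (subF (edges (insert i (insert j S))))
      = X i ^ (edges (insert i (insert j S))).card * V := by
  rw [subF, map_prod]
  refine dvd_def.mp ?_
  rw [← Finset.prod_const]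
  exact Finset.prod_dvd_prod_of_dvd _ _ fun q hq => X_dvd_blow_braidForm hq

theorem subF_mul_compl (Γ : Finset (BraidIdx n)) :
    subF Γ * subF Γᶜ = subF Finset.univ := Finset.prod_mul_prod_compl _ _

variable {L : Type} [CommRing L] [Algebra (BA n) L]

local notation "φ" => algebraMap (BA n) L

theorem braidF_mem_resMod (hi : i ∉ S) (hj : j ∉ S) (hij : i ≠ j) {k : ℕ}
    (hk : k ≤ (S.card + 1) * S.card) : φ (braidF n) ∈ resMod S i j k L := by
  refine ⟨0, braidF n, 1, by simp, by simp, fun μ ν _ g => ?_⟩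
  set Γ := edges (insert i (insert j S)) with hΓ
  obtain ⟨V, hV⟩ := exists_blow_subF_edges (S := S) (i := i) (j := j)
  rw [← hΓ] at hV
  set G := blow S i j (subF Γᶜ) with hG
  have hF : blow S i j (subF Finset.univ) = X i ^ Γ.card * (V * G) := by
    rw [← subF_mul_compl Γ, map_mul, hV, mul_assoc]
  have hX : (X i ^ Γ.card : MvPolynomial (Fin n) ℂ) ≠ 0 := pow_ne_zero _ (X_ne_zero i)
  have hXr : ∀ a ∈ S, ∀ b ∈ S, rename (Equiv.swap a b) (X i : MvPolynomial (Fin n) ℂ) = X i := by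
    intro a ha b hb
    rw [rename_X, Equiv.swap_apply_of_ne_of_ne (ne_of_mem_of_not_mem ha hi).symm
      (ne_of_mem_of_not_mem hb hi).symm]
  have hanti : ∀ a ∈ S, ∀ b ∈ S, a ≠ b → rename (Equiv.swap a b) (V * G) = -(V * G) := by
    intro a ha b hb hab
    apply mul_left_cancel₀ hX
    have h := rename_blow hi hj ha hb (subF Finset.univ)
    rw [rename_subF_univ, Equiv.Perm.sign_swap hab, map_mul, hF, map_mul, map_pow,
      hXr a ha b hb] at h
    rw [h]; simp
  have hsymm : ∀ a ∈ S, ∀ b ∈ S, rename (Equiv.swap a b) (V ^ 4) = V ^ 4 := by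
    intro a ha b hb
    apply mul_left_cancel₀ (pow_ne_zero 4 hX)
    have h := rename_blow hi hj ha hb (subF Γ ^ 4)
    rw [rename_subF_edges_pow_four (by simp [ha]) (by simp [hb]), map_pow (blow S i j), hV, mul_pow,
      map_mul, map_pow, map_pow, hXr a ha b hb] at h
    exact h
  set K := (V * G) ^ (2 * μ + 1) * (V ^ 4) ^ ν with hK
  have hprod : blow S i j (g * (spec (resPoint S i j k μ ν) (braidF n) * resWeight S i j 0 μ ν))
      = X i ^ ((2 * μ + 1 + 4 * ν) * Γ.card) * (blow S i j g * K) := by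
    rw [spec_braidF, resWeight, ← hΓ]
    simp only [map_mul, map_pow, hF, hV, Nat.sub_zero, hK]
    ring
  have hcard : 2 * Γ.card = (S.card + 2) * (S.card + 1) := by
    rw [hΓ, card_edges, Finset.card_insert_of_notMem (by simp [hij, hi]),
      Finset.card_insert_of_notMem hj]
    simp
  obtain ⟨c, hc, hc'⟩ : ∃ c, 2 * c ≤ S.card * (S.card - 1) ∧ k + 1 ≤ Γ.card + c := by
    refine ⟨k + 1 - Γ.card, ?_, by omega⟩
    rcases Nat.eq_zero_or_pos S.card with h | h
    · rw [h] at hk hcard ⊢; omega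
    · obtain ⟨m, hm⟩ : ∃ m, S.card = m + 1 := ⟨S.card - 1, by omega⟩
      rw [hm] at hk hcard ⊢
      rw [Nat.add_sub_cancel]
      have h1 : 2 * (k + 1) ≤ 2 * Γ.card + (m + 1) * m := by rw [hcard]; nlinarith
      omega
  rw [resid_apply, hprod, cubeInt_X_pow_mul hi]
  have hd := X_pow_dvd_cubeInt hi (K := K) (fun a ha b hb hab => by
    rw [hK, map_mul, map_pow, map_pow, hanti a ha b hb hab, hsymm a ha b hb,
      Odd.neg_pow ⟨μ, rfl⟩, neg_mul]) hc (blow_mem_tame hi hj g)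
  refine (pow_dvd_pow (X i) ?_).trans ((pow_add (X i) _ c).dvd.trans (mul_dvd_mul_left _ hd))
  rw [resOrder, ← hΓ]
  have : (2 * μ + 1 + 4 * ν) * Γ.card = (2 * μ + 4 * ν) * Γ.card + Γ.card := by ring
  omega

end

end Arrangement

namespace Arrangement

section

open MeasureTheory

variable {n : ℕ}

/-- Lebesgue measure on the unit interval in the coordinates in `S`, and a point mass at `y` in the
other coordinates. -/
noncomputable def cubeMeasure (S : Finset (Fin n)) (y : Fin n → ℝ) (a : Fin n) : Measure ℝ :=
  if a ∈ S then volume.restrict (Set.Icc 0 1) else Measure.dirac (y a)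

instance (S : Finset (Fin n)) (y : Fin n → ℝ) (a : Fin n) :
    IsFiniteMeasure (cubeMeasure S y a) := by
  unfold cubeMeasure
  split_ifs <;> infer_instance

theorem integrable_pow_cubeMeasure (S : Finset (Fin n)) (y : Fin n → ℝ) (a : Fin n) (k : ℕ) :
    Integrable (fun x : ℝ => x ^ k) (cubeMeasure S y a) := by
  unfold cubeMeasure
  split_ifs
  · exact (continuous_pow k).continuousOn.integrableOn_compact isCompact_Icc
  · exact integrable_dirac (by simp)

theorem integral_pow_cubeMeasure (S : Finset (Fin n)) (y : Fin n → ℝ) (a : Fin n) (k : ℕ) :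
    ∫ x, x ^ k ∂(cubeMeasure S y a) = if a ∈ S then ((k : ℝ) + 1)⁻¹ else y a ^ k := by
  unfold cubeMeasure
  split_ifs
  · rw [integral_Icc_eq_integral_Ioc, ← intervalIntegral.integral_of_le zero_le_one, integral_pow]
    simp
  · simp

theorem integrable_monomial (S : Finset (Fin n)) (y : Fin n → ℝ) (γ : Fin n →₀ ℕ) (c : ℝ) :
    Integrable (fun x => eval x (monomial γ c)) (Measure.pi (cubeMeasure S y)) := by
  simp only [eval_monomial, Finsupp.prod_fintype _ _ fun a => pow_zero _]
  exact (Integrable.fintype_prod fun a => integrable_pow_cubeMeasure S y a (γ a)).const_mul c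

theorem integrable_eval (S : Finset (Fin n)) (y : Fin n → ℝ) (g : MvPolynomial (Fin n) ℝ) :
    Integrable (fun x => eval x g) (Measure.pi (cubeMeasure S y)) := by
  induction g using MvPolynomial.induction_on' with
  | monomial γ c => exact integrable_monomial S y γ c
  | add p q hp hq => simp only [map_add]; exact hp.add hq

theorem eval_cubeInt_map (S : Finset (Fin n)) (y : Fin n → ℝ) (g : MvPolynomial (Fin n) ℝ) :
    eval (fun a => (y a : ℂ)) (cubeInt S (map Complex.ofRealHom g))
      = ((∫ x, eval x g ∂(Measure.pi (cubeMeasure S y)) : ℝ) : ℂ) := by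
  induction g using MvPolynomial.induction_on' with
  | monomial γ c =>
    simp only [eval_monomial, Finsupp.prod_fintype _ _ fun a => pow_zero _]
    rw [integral_const_mul, integral_fintype_prod_eq_prod (fun a (x : ℝ) => x ^ γ a), map_monomial,
      cubeInt_monomial, eval_monomial, Finsupp.prod_fintype _ _ fun a => pow_zero _,
      mul_assoc, Complex.ofReal_mul, ← Finset.prod_ite_mem_eq S, ← Finset.prod_mul_distrib,
      Complex.ofReal_prod]
    congr 1
    refine Finset.prod_congr rfl fun a _ => ?_
    rw [integral_pow_cubeMeasure]
    by_cases h : a ∈ S <;> simp [h]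
  | add p q hp hq =>
    simp only [map_add]
    rw [hp, hq, integral_add (integrable_eval S y p) (integrable_eval S y q), Complex.ofReal_add]

theorem pi_cubeMeasure_pos {S : Finset (Fin n)} {y : Fin n → ℝ}
    (hy : ∀ a ∈ S, y a ∈ Set.Ioo (0 : ℝ) 1) {U : Set (Fin n → ℝ)} (hU : IsOpen U) (hyU : y ∈ U) :
    0 < Measure.pi (cubeMeasure S y) U := by
  obtain ⟨u, hu, hu'⟩ := isOpen_pi_iff'.mp hU y hyU
  refine lt_of_lt_of_le ?_ (measure_mono hu')
  rw [Measure.pi_pi, CanonicallyOrderedAdd.prod_pos]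
  intro a _
  unfold cubeMeasure
  split_ifs with h
  · rw [Measure.restrict_apply (hu a).1.measurableSet]
    refine lt_of_lt_of_le (((hu a).1.inter isOpen_Ioo).measure_pos volume ⟨y a, (hu a).2, hy a h⟩)
      (measure_mono (Set.inter_subset_inter_right _ Set.Ioo_subset_Icc_self))
  · rw [Measure.dirac_apply_of_mem (hu a).2]
    exact one_pos

theorem eval_cubeInt_map_sq_ne_zero {S : Finset (Fin n)} {y : Fin n → ℝ}
    (hy : ∀ a ∈ S, y a ∈ Set.Ioo (0 : ℝ) 1) {g : MvPolynomial (Fin n) ℝ} (hg : eval y g ≠ 0) :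
    eval (fun a => (y a : ℂ)) (cubeInt S (map Complex.ofRealHom (g ^ 2))) ≠ 0 := by
  rw [eval_cubeInt_map, Complex.ofReal_ne_zero]
  refine ne_of_gt ((integral_pos_iff_support_of_nonneg (fun x => ?_)
    (integrable_eval S y _)).mpr (pi_cubeMeasure_pos hy ?_ ?_))
  · simp only [map_pow]; positivity
  · exact (MvPolynomial.continuous_eval _).isOpen_support
  · simpa using hg

variable {S : Finset (Fin n)} {i j : Fin n}

theorem exists_blow_subF_eq_map (hi : i ∉ S) (hj : j ∉ S) (hij : i ≠ j) :
    ∃ (V G : MvPolynomial (Fin n) ℝ) (y : Fin n → ℝ), y i = 0 ∧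
      (∀ a ∈ S, y a ∈ Set.Ioo (0 : ℝ) 1) ∧ eval y V ≠ 0 ∧ eval y G ≠ 0 ∧
      blow S i j (subF (edges (insert i (insert j S))))
        = X i ^ (edges (insert i (insert j S))).card * map Complex.ofRealHom V ∧
      blow S i j (subF (edges (insert i (insert j S)))ᶜ) = map Complex.ofRealHom G := by
  have hne : ∀ a ∈ S, a ≠ i ∧ a ≠ j := fun a ha => ⟨fun h => hi (h ▸ ha), fun h => hj (h ▸ ha)⟩
  set u : Fin n → MvPolynomial (Fin n) ℝ := fun a => if a = i then 1 else if a = j then 0 else X a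
    with hu
  set w : Fin n → MvPolynomial (Fin n) ℝ := fun a =>
    if a = i then X j + X i else if a ∈ S then X j + X i * X a else X a with hw
  set z : Fin n → ℝ := fun a => ((a : ℝ) + 1) / (n + 1) with hz
  have hn : (0 : ℝ) < n + 1 := by positivity
  have hz0 : ∀ a, 0 < z a := fun a => by simp only [hz]; positivity
  have hz1 : ∀ a, z a < 1 := fun a => by
    have : (a : ℝ) < n := by exact_mod_cast a.2
    simp only [hz]
    rw [div_lt_one hn]; linarith
  have hzi : ∀ a b, a ≠ b → z a ≠ z b := fun a b hab h => by
    simp only [hz] at h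
    rw [div_left_inj' hn.ne', add_left_inj, Nat.cast_inj] at h
    exact hab (Fin.ext h)
  set y : Fin n → ℝ := fun a => if a = i then 0 else z a with hy
  refine ⟨∏ q ∈ edges (insert i (insert j S)), (u q.1.1 - u q.1.2),
    ∏ q ∈ (edges (insert i (insert j S)))ᶜ, (w q.1.1 - w q.1.2), y, by simp [hy], fun a ha => ?_,
    ?_, ?_, ?_, ?_⟩
  · simp only [hy, (hne a ha).1, if_false]
    exact ⟨hz0 a, hz1 a⟩
  · rw [map_prod, Finset.prod_ne_zero_iff]
    intro q _
    have hq := q.2.ne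
    have hu' : ∀ a, eval y (u a) = if a = i then 1 else if a = j then 0 else z a := fun a => by
      simp only [hu]
      split_ifs with h1 h2 <;> simp [hy, h1]
    rw [map_sub, sub_ne_zero, hu', hu']
    split_ifs with h1 h2 h3 h4 h5 h6 h7 h8
    all_goals first
      | exact absurd (h1.trans h2.symm) hq
      | exact absurd (h4.trans h6.symm) hq
      | exact one_ne_zero
      | exact zero_ne_one
      | exact (hz0 _).ne
      | exact (hz0 _).ne'
      | exact (hz1 _).ne
      | exact (hz1 _).ne'
      | exact hzi _ _ hq
  · rw [map_prod, Finset.prod_ne_zero_iff]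
    intro q hq
    rw [Finset.mem_compl, mem_edges] at hq
    have hw' : ∀ a, eval y (w a) = if a ∈ insert i (insert j S) then z j else z a := fun a => by
      simp only [hw, Finset.mem_insert]
      by_cases h1 : a = i
      · simp [hy, h1, hij.symm]
      by_cases h2 : a = j
      · subst h2; simp [hy, h1, hj]
      by_cases h3 : a ∈ S
      · simp [hy, h1, h2, h3, hij.symm]
      · simp [hy, h1, h2, h3]
    have hjI : j ∈ insert i (insert j S) := by simp
    rw [map_sub, sub_ne_zero, hw', hw']
    split_ifs with h1 h2 h2
    · exact absurd ⟨h1, h2⟩ hq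
    · exact hzi _ _ (ne_of_mem_of_not_mem hjI h2)
    · exact hzi _ _ (ne_of_mem_of_not_mem hjI h1).symm
    · exact hzi _ _ q.2.ne
  · rw [subF, map_prod, map_prod, ← Finset.prod_const, ← Finset.prod_mul_distrib]
    refine Finset.prod_congr rfl fun q hq => ?_
    rw [mem_edges] at hq
    have key : ∀ a ∈ insert i (insert j S),
        blow S i j (X a) = X j + X i * map Complex.ofRealHom (u a) := fun a ha => by
      rw [blow_X]
      simp only [hu]
      by_cases h1 : a = i
      · simp [h1]
      by_cases h2 : a = j
      · subst h2; simp [h1, hj]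
      have h3 : a ∈ S := by simpa [h1, h2] using ha
      simp [h1, h2, h3]
    rw [braidForm, map_sub, map_sub, key _ hq.1, key _ hq.2]
    ring
  · rw [subF, map_prod, map_prod]
    refine Finset.prod_congr rfl fun q _ => ?_
    have key : ∀ a, blow S i j (X a) = map Complex.ofRealHom (w a) := fun a => by
      rw [blow_X]
      simp only [hw]
      split_ifs <;> simp
    rw [braidForm, map_sub, map_sub, key, key]

variable {L : Type} [CommRing L] [Algebra (BA n) L]

local notation "φ" => algebraMap (BA n) L

theorem Setting.eval_resPoint_eq_zero {D : Fin n → L →+ L} {E : Submodule (BA n) L}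
    (hS : Setting D E) (hlog : ∀ a, φ (braidF n) * D a 1 = φ (logNum n a)) (hi : i ∉ S)
    (hj : j ∉ S) (hlt : i < j) {k : ℕ} (hk : k ≤ (S.card + 1) * S.card) {b : SR n}
    (hb : φ (rho n b) ∈ E) : ∃ d, ∀ μ ν, d ≤ μ → eval (resPoint S i j k μ ν) b = 0 := by
  have hle : E ≤ resMod S i j k L := hS.min _ (braidF_mem_resMod hi hj hlt.ne hk)
    fun a m hm => hS.resMod_memD k hlog hi hj hlt a hm
  obtain ⟨N, r, d, hN, hr, h⟩ := hle hb
  have hr' : r = braidF n ^ N * rho n b := by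
    apply hS.inj
    rw [map_mul, map_pow, hr]
  refine ⟨d, fun μ ν hμ => ?_⟩
  obtain ⟨V, G, y, hyi, hy, hV, hG, hV', hG'⟩ := exists_blow_subF_eq_map hi hj hlt.ne
  have h1 := h μ ν hμ ((X i - X j) ^ k)
  set Γ := edges (insert i (insert j S)) with hΓ
  set P := ((V * G) ^ μ * V ^ (2 * ν)) with hP
  have hF : blow S i j (subF Finset.univ)
      = X i ^ Γ.card * (map Complex.ofRealHom V * map Complex.ofRealHom G) := by
    rw [← subF_mul_compl Γ, map_mul, hV', hG', mul_assoc]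
  have h2 : blow S i j ((X i - X j) ^ k *
      (spec (resPoint S i j k μ ν) r * resWeight S i j N μ ν))
      = X i ^ ((2 * μ + 4 * ν) * Γ.card + k) * (C (eval (resPoint S i j k μ ν) b)
        * map Complex.ofRealHom (P ^ 2)) := by
    have h3 : 2 * μ = N + (2 * μ - N) := by omega
    have h4 : spec (resPoint S i j k μ ν) r * resWeight S i j N μ ν
        = C (eval (resPoint S i j k μ ν) b) * (subF Finset.univ ^ (2 * μ) * subF Γ ^ (4 * ν)) := by
      rw [hr', map_mul, map_pow, spec_braidF, spec_rho, resWeight, h3, pow_add, ← h3]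
      ring
    rw [h4, ← algebraMap_eq]
    simp only [map_mul, map_pow, AlgHom.commutes, hF, hV', map_sub, blow_X_fst,
      blow_X_snd hlt.ne hj, add_sub_cancel_left, hP]
    ring
  rw [resid_apply, h2, cubeInt_X_pow_mul hi, resOrder, pow_succ,
    mul_dvd_mul_iff_left (pow_ne_zero _ (X_ne_zero i)), ← smul_eq_C_mul, map_smul] at h1
  obtain ⟨v, hv⟩ := h1
  have h5 := congrArg (eval fun a => (y a : ℂ)) hv
  rw [smul_eval, map_mul, eval_X, hyi, Complex.ofReal_zero, zero_mul] at h5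
  refine (mul_eq_zero.mp h5).resolve_right (eval_cubeInt_map_sq_ne_zero hy ?_)
  simp only [hP, map_mul, map_pow]
  exact mul_ne_zero (pow_ne_zero _ (mul_ne_zero hV hG)) (pow_ne_zero _ hV)

end

end Arrangement

namespace Arrangement

section

variable {n : ℕ}

theorem eval_lin_resPoint {S : Finset (Fin n)} {i j : Fin n} (hlt : i < j) (k μ ν : ℕ)
    (J : Finset (Fin n)) (l : ℕ) : eval (resPoint S i j k μ ν) (lin J l)
      = ((2 * μ * (edges J).card + 4 * ν * (edges J ∩ edges (insert i (insert j S))).card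
        - (if i ∈ J ∧ j ∈ J then (resOrder S i j k μ ν + S.card : ℤ) else 0)
        + J.card - 1 + l : ℤ) : ℂ) := by
  have h : ∀ q : BraidIdx n, (q.1 = (i, j)) ↔ ⟨(i, j), hlt⟩ = q := fun q => by
    rw [Subtype.ext_iff, eq_comm]
  have h2 : (⟨(i, j), hlt⟩ : BraidIdx n) ∈ edges J ↔ i ∈ J ∧ j ∈ J := mem_edges
  rw [eval_lin]
  simp only [resPoint, Finset.sum_sub_distrib, Finset.sum_add_distrib, Finset.sum_const, h,
    Finset.sum_ite_eq, h2, Finset.sum_ite_mem, nsmul_eq_mul]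
  push_cast
  split_ifs <;> ring

theorem card_edges_le (J : Finset (Fin n)) : (edges J).card ≤ n * n := by
  have h1 := card_edges J
  have h2 : J.card ≤ n := by simpa using Finset.card_le_univ J
  have h3 : J.card * (J.card - 1) ≤ n * n := Nat.mul_le_mul h2 ((Nat.sub_le _ _).trans h2)
  omega

theorem eval_lin_resPoint_ne_zero {S : Finset (Fin n)} {i j : Fin n} (hi : i ∉ S) (hj : j ∉ S)
    (hlt : i < j) {k : ℕ} (hk : k ≤ (S.card + 1) * S.card) {μ : ℕ} (hμ : n * n ≤ μ)
    {J : Finset (Fin n)} (hJ : 2 ≤ J.card) {l : ℕ} (hl : l ≤ (J.card - 1) * (J.card - 2))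
    (hne : ¬ (J = insert i (insert j S) ∧ l = k)) :
    eval (resPoint S i j k μ (n * n * (μ + 1))) (lin J l) ≠ 0 := by
  rw [eval_lin_resPoint hlt, Int.cast_ne_zero]
  have hcard : (insert i (insert j S)).card = S.card + 2 := by
    rw [Finset.card_insert_of_notMem (by simp [hlt.ne, hi]), Finset.card_insert_of_notMem hj]
  have hJn : J.card ≤ n := by simpa using Finset.card_le_univ J
  have hIn : S.card + 2 ≤ n := by
    rw [← hcard]; simpa using Finset.card_le_univ (insert i (insert j S))
  have hI2 : 2 ≤ (insert i (insert j S)).card := by omega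
  set I := insert i (insert j S) with hI
  by_cases hij : i ∈ J ∧ j ∈ J
  · rw [if_pos hij, resOrder, ← hI]
    by_cases hIJ : I ⊆ J
    · have h1 : edges I ⊆ edges J := fun q hq => by
        rw [mem_edges] at hq ⊢
        exact ⟨hIJ hq.1, hIJ hq.2⟩
      rw [Finset.inter_eq_right.mpr h1]
      by_cases hJI : J ⊆ I
      · have h2 : I = J := Finset.Subset.antisymm hIJ hJI
        have h3 : l ≠ k := fun h => hne ⟨h2.symm, h⟩
        rw [← h2, hcard]
        push_cast
        ring_nf
        omega
      · have h2 : (edges I).card < (edges J).card := by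
          refine Finset.card_lt_card ((Finset.ssubset_iff_subset_ne).mpr ⟨h1, fun h => hJI ?_⟩)
          exact subset_of_edges_subset hJ h.ge
        have h3 : S.card + 2 ≤ J.card := hcard ▸ Finset.card_le_card hIJ
        have h4 : k ≤ n * n := hk.trans (Nat.mul_le_mul (by omega) (by omega))
        obtain ⟨e, he⟩ := Nat.exists_eq_add_of_lt h2
        have h5 : J.card ≠ S.card + 2 := fun h => hJI
          (Finset.eq_of_subset_of_card_le hIJ (by omega)).ge
        have h6 : 0 ≤ (μ : ℤ) * e := by positivity
        rw [he]
        push_cast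
        ring_nf
        have h7 : (0 : ℤ) ≤ (μ : ℤ) * e := by positivity
        refine ne_of_gt ?_
        have h8 : (k : ℤ) ≤ μ := by exact_mod_cast h4.trans hμ
        have h9 : (S.card : ℤ) + 2 ≤ J.card := by exact_mod_cast h3
        nlinarith
    · have h2 : (edges J ∩ edges I).card < (edges I).card := by
        refine Finset.card_lt_card ((Finset.ssubset_iff_subset_ne).mpr
          ⟨Finset.inter_subset_right, fun h => hIJ ?_⟩)
        exact subset_of_edges_subset hI2 (Finset.inter_eq_right.mp h)
      have h3 : ((edges J).card : ℤ) ≤ n * n := by exact_mod_cast card_edges_le J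
      have h4 : (l : ℤ) ≤ n * n := by
        exact_mod_cast hl.trans (Nat.mul_le_mul (by omega) (by omega))
      obtain ⟨e, he⟩ := Nat.exists_eq_add_of_lt h2
      have h5 : (J.card : ℤ) ≤ n * n := by exact_mod_cast hJn.trans (Nat.le_mul_self n)
      have h6 : 0 < (n : ℤ) * n := by
        have : 0 < n := by omega
        positivity
      have h7 : (μ : ℤ) * (edges J).card ≤ μ * (n * n) :=
        mul_le_mul_of_nonneg_left h3 (by positivity)
      rw [he]
      push_cast
      refine ne_of_lt ?_
      have h8 : 0 ≤ (n : ℤ) * n * (μ + 1) * e := by positivity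
      have h9 : 0 ≤ (μ : ℤ) * ((edges J ∩ edges I).card + e + 1) := by positivity
      have h10 : 0 ≤ (μ : ℤ) * (n * n) := by positivity
      have h11 : (0 : ℤ) ≤ k := by positivity
      have h12 : (0 : ℤ) ≤ S.card := by positivity
      nlinarith
  · rw [if_neg hij]
    have h2 : (2 : ℤ) ≤ J.card := by exact_mod_cast hJ
    have h3 : (0 : ℤ) ≤ 2 * μ * (edges J).card
      + 4 * ((n * n * (μ + 1) : ℕ) : ℤ) * (edges J ∩ edges I).card := by positivity
    refine ne_of_gt ?_
    have h4 : (0 : ℤ) ≤ l := by positivity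
    linarith

end

end Arrangement

namespace Arrangement

section

variable {n : ℕ} {L : Type} [CommRing L] [Algebra (BA n) L]

local notation "φ" => algebraMap (BA n) L

theorem lin_ne_zero {I : Finset (Fin n)} (hI : 2 ≤ I.card) (k : ℕ) : lin I k ≠ 0 := by
  intro h
  have := totalDegree_lin hI k
  simp [h] at this

theorem prodLin_univ_eq : prodLin (Finset.univ : Finset (BraidIdx n)) = braidGen n := by
  refine Finset.prod_congr (Finset.filter_congr fun J _ => ?_) fun J _ => rfl
  simp

theorem braidGen_ne_zero : braidGen n ≠ 0 := by
  rw [← prodLin_univ_eq]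
  refine Finset.prod_ne_zero_iff.mpr fun J hJ => Finset.prod_ne_zero_iff.mpr fun k _ => ?_
  exact lin_ne_zero (Finset.mem_filter.mp hJ).2.1 k

namespace Setting

variable {D : Fin n → L →+ L} {E : Submodule (BA n) L} (hS : Setting D E)
include hS

theorem exists_mul_braidGen_mem {ϖ : SR n} (hϖ : Prime ϖ) :
    ∃ c, ¬ ϖ ∣ c ∧ φ (rho n (braidGen n * c)) ∈ E := by
  obtain ⟨c, r, hc, h⟩ := hS.one_mem_satMod hϖ _ Finset.univ rfl
  refine ⟨c, hc, ?_⟩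
  rwa [Finset.compl_univ, prodl, Finset.prod_empty, one_pow, mul_one, mul_one, prodLin_univ_eq] at h

theorem braidGen_mem (hn : 2 ≤ n) : φ (rho n (braidGen n)) ∈ E := by
  have key : ∀ c : SR n, c ≠ 0 → φ (rho n (braidGen n * c)) ∈ E → φ (rho n (braidGen n)) ∈ E := by
    intro c
    induction c using (IsWellFounded.wf (r := DvdNotUnit (α := SR n))).induction with | _ c ih => ?_
    intro hc h
    by_cases hu : IsUnit c
    · obtain ⟨u, rfl⟩ := hu
      have := E.smul_mem (rho n ↑u⁻¹) h
      rwa [Algebra.smul_def, ← map_mul, ← map_mul, mul_left_comm, Units.inv_mul, mul_one] at this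
    · obtain ⟨ϖ, hϖ, hϖc⟩ := WfDvdMonoid.exists_irreducible_factor hu hc
      obtain ⟨c', hc', h'⟩ := hS.exists_mul_braidGen_mem hϖ.prime
      obtain ⟨a, a', g, hrel, rfl, rfl⟩ := UniqueFactorizationMonoid.exists_reduced_factors c hc c'
      have ha : ¬ IsUnit a := fun ha => hc' ((ha.dvd_mul_right.mp hϖc).mul_right _)
      refine ih g ⟨left_ne_zero_of_mul hc, a, ha, rfl⟩ (left_ne_zero_of_mul hc) ?_
      have h₁ : φ (rho n (braidGen n * g * a)) * 1 ∈ E := by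
        rw [mul_assoc (braidGen n) g a, mul_one (φ _)]; exact h
      have h₂ : φ (rho n (braidGen n * g * a')) * 1 ∈ E := by
        rw [mul_assoc (braidGen n) g a', mul_one (φ _)]; exact h'
      have := hS.smul_mem_of_isRelPrime (g := braidGen n * g) (e := 1)
        (right_ne_zero_of_mul hc) hrel h₁ h₂
      rw [mul_one (φ _)] at this
      exact this
  have hϖ := irreducible_lin (I := (Finset.univ : Finset (Fin n))) (by simpa using hn) 0
  obtain ⟨c, hc, h⟩ := hS.exists_mul_braidGen_mem hϖ.prime
  exact key c (fun h0 => hc (h0 ▸ dvd_zero _)) h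

theorem braidGen_dvd (hn : 2 ≤ n) (hlog : ∀ a, φ (braidF n) * D a 1 = φ (logNum n a)) {b : SR n}
    (hb : φ (rho n b) ∈ E) : braidGen n ∣ b := by
  obtain ⟨g, b', d, hrel, hg, rfl⟩ :=
    UniqueFactorizationMonoid.exists_reduced_factors (braidGen n) braidGen_ne_zero b
  have hd : φ (rho n d) ∈ E := by
    have hg0 : g ≠ 0 := fun h => braidGen_ne_zero (n := n) (by rw [← hg, h, mul_zero])
    have := hS.smul_mem_of_isRelPrime (g := d) (e := 1) hg0 hrel
      (by rw [hg, mul_one]; exact hS.braidGen_mem hn) (by rwa [mul_one])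
    rwa [mul_one] at this
  have hu : IsUnit g := by
    by_contra hu
    have hg0 : g ≠ 0 := fun h => braidGen_ne_zero (n := n) (by rw [← hg, h, mul_zero])
    obtain ⟨ϖ, hϖ, hϖg⟩ := WfDvdMonoid.exists_irreducible_factor hu hg0
    have h1 : ϖ ∣ prodLin Finset.univ := by
      rw [prodLin_univ_eq, ← hg]; exact hϖg.mul_left _
    obtain ⟨I, hI, h2⟩ := hϖ.prime.exists_mem_finset_dvd h1
    obtain ⟨k, hk, h3⟩ := hϖ.prime.exists_mem_finset_dvd h2
    have hI2 : 2 ≤ I.card := (Finset.mem_filter.mp hI).2.1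
    obtain ⟨e, he⟩ := (lin_dvd_of_dvd hI2 hϖ.prime h3).trans hϖg
    have h4 : d * e = (∏ l ∈ (Finset.range ((I.card - 1) * (I.card - 2) + 1)).erase k, lin I l) *
        ∏ J ∈ ((Finset.univ : Finset (Fin n)).powerset.filter
          (fun J => 2 ≤ J.card ∧ edges J ⊆ Finset.univ)).erase I,
          ∏ l ∈ Finset.range ((J.card - 1) * (J.card - 2) + 1), lin J l := by
      apply mul_left_cancel₀ (lin_ne_zero hI2 k)
      rw [← mul_assoc (lin I k) (∏ l ∈ _, _), Finset.mul_prod_erase _ _ hk, Finset.mul_prod_erase _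
        (fun J => ∏ l ∈ Finset.range ((J.card - 1) * (J.card - 2) + 1), lin J l) hI]
      change _ = prodLin Finset.univ
      rw [prodLin_univ_eq, ← hg, he]
      ring
    obtain ⟨i, j, hiI, hjI, hlt⟩ : ∃ i j, i ∈ I ∧ j ∈ I ∧ i < j := by
      obtain ⟨a, ha, b, hb, hab⟩ := Finset.one_lt_card.mp hI2
      rcases lt_or_gt_of_ne hab with h | h
      · exact ⟨a, b, ha, hb, h⟩
      · exact ⟨b, a, hb, ha, h⟩
    set S := (I.erase i).erase j with hSdef
    have hi : i ∉ S := by simp [hSdef]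
    have hj : j ∉ S := by simp [hSdef]
    have hIS : insert i (insert j S) = I := by
      rw [hSdef, Finset.insert_erase (by simp [hlt.ne', hjI]), Finset.insert_erase hiI]
    have hcard : I.card = S.card + 2 := by
      rw [← hIS, Finset.card_insert_of_notMem (by simp [hlt.ne, hi]),
        Finset.card_insert_of_notMem hj]
    have hk' : k ≤ (S.card + 1) * S.card := by
      rw [Finset.mem_range, hcard] at hk
      simpa [Nat.lt_succ_iff] using hk
    obtain ⟨m, hm⟩ := hS.eval_resPoint_eq_zero hlog hi hj hlt hk' hd
    have h5 := hm (m + n * n) (n * n * (m + n * n + 1)) (by omega)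
    have h6 := congrArg (eval (resPoint S i j k (m + n * n) (n * n * (m + n * n + 1)))) h4
    rw [map_mul, h5, zero_mul] at h6
    have key : ∀ J l, 2 ≤ J.card → l ∈ Finset.range ((J.card - 1) * (J.card - 2) + 1) →
        ¬ (J = I ∧ l = k) →
        eval (resPoint S i j k (m + n * n) (n * n * (m + n * n + 1))) (lin J l) ≠ 0 := by
      intro J l hJ hl hne
      exact eval_lin_resPoint_ne_zero hi hj hlt hk' (by omega) hJ
        (Nat.lt_succ_iff.mp (Finset.mem_range.mp hl)) (by rwa [hIS])
    refine absurd h6.symm ?_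
    rw [map_mul, map_prod, map_prod]
    refine mul_ne_zero (Finset.prod_ne_zero_iff.mpr fun l hl => ?_)
      (Finset.prod_ne_zero_iff.mpr fun J hJ => ?_)
    · exact key I l hI2 (Finset.mem_of_mem_erase hl) fun h => Finset.ne_of_mem_erase hl h.2
    · rw [map_prod]
      refine Finset.prod_ne_zero_iff.mpr fun l hl => ?_
      exact key J l (Finset.mem_filter.mp (Finset.mem_of_mem_erase hJ)).2.1 hl
        fun h => Finset.ne_of_mem_erase hJ h.1
  rw [← hg]
  exact mul_dvd_mul_left _ hu.dvd

end Setting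

end

end Arrangement

namespace Arrangement

section

variable {n : ℕ} {L : Type} [CommRing L] [Algebra (BA n) L]

local notation "φ" => algebraMap (BA n) L

theorem rename_pderiv_braidForm (a : Fin n) (q : BraidIdx n) :
    (rename Sum.inl (pderiv a (braidForm n q)) : BA n)
      = (if q.1.1 = a then 1 else 0) - if q.1.2 = a then 1 else 0 := by
  rw [braidForm, map_sub, pderiv_X, pderiv_X, Pi.single_apply, Pi.single_apply]
  split_ifs <;> simp

theorem algebraMap_braidF_mul_uv (hu : IsUnit (φ (braidF n))) (q : BraidIdx n) :
    φ (braidF n) * uv L q.1.1 q.1.2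
      = φ (rename Sum.inl (∏ p ∈ Finset.univ.erase q, braidForm n p)) := by
  have h : braidF n = rename Sum.inl (∏ p ∈ Finset.univ.erase q, braidForm n p)
      * (xv q.1.1 - xv q.1.2) := by
    rw [braidF, ← Finset.prod_erase_mul _ _ (Finset.mem_univ q), map_mul]
    congr 1
    simp [braidForm, xv]
  have hu' : IsUnit (φ (xv q.1.1 - xv q.1.2)) := by
    rw [h, map_mul] at hu
    exact isUnit_of_mul_isUnit_right hu
  rw [uv, h, map_mul, mul_assoc, Ring.mul_inverse_cancel _ hu', mul_one]

theorem sum_sv_mul_uv (a : Fin n) : ∑ b, φ (rho n (sv a b)) * uv L a b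
    = ∑ q : BraidIdx n, φ (rho n (X q)) * (((if q.1.1 = a then 1 else 0)
        - if q.1.2 = a then 1 else 0) * uv L q.1.1 q.1.2) := by
  set f : Fin n → Fin n → L := fun b c => φ (rho n (sv b c)) * uv L b c with hf
  have h1 : ∀ b c, (if h : b < c then φ (rho n (X ⟨(b, c), h⟩)) * (((if b = a then 1 else 0)
        - if c = a then 1 else 0) * uv L b c) else 0)
      = (if b = a then (if b < c then f b c else 0) else 0)
        - if c = a then (if b < c then f b c else 0) else 0 := by
    intro b c
    by_cases h : b < c
    · rw [dif_pos h, if_pos h, hf]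
      simp only
      rw [sv_of_lt h]
      split_ifs <;> ring
    · simp [h]
  rw [sum_braidIdx]
  refine Eq.trans ?_ (Finset.sum_congr rfl fun b _ => Finset.sum_congr rfl fun c _ => (h1 b c).symm)
  simp only [Finset.sum_sub_distrib]
  rw [Finset.sum_comm (f := fun b c => if b = a then _ else _)]
  simp only [Finset.sum_ite_eq', Finset.mem_univ, if_true]
  rw [← Finset.sum_sub_distrib]
  refine Finset.sum_congr rfl fun b _ => ?_
  have h2 : f b a = - f a b := by
    rw [hf]; simp only; rw [sv_symm, uv_symm, mul_neg]
  rcases lt_trichotomy a b with h | h | h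
  · simp [h, not_lt.mpr h.le, hf]
  · subst h; simp
  · simp only [h, not_lt.mpr h.le, if_true, if_false, h2]
    simp [hf]

theorem algebraMap_braidF_mul_sum_uv (hu : IsUnit (φ (braidF n))) (a : Fin n) :
    φ (braidF n) * ∑ b, φ (rho n (sv a b)) * uv L a b = φ (logNum n a) := by
  rw [sum_sv_mul_uv, logNum, map_sum, Finset.mul_sum]
  refine Finset.sum_congr rfl fun q _ => ?_
  have h : rho n (X q) = X (Sum.inr q) := by simp [rho]
  rw [map_mul, map_mul (rename _), map_mul, rename_pderiv_braidForm, ← algebraMap_braidF_mul_uv hu,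
    h]
  have h2 : ∀ p : Prop, [Decidable p] → φ (if p then 1 else 0) = if p then 1 else 0 := by
    intro p _
    split_ifs <;> simp
  rw [map_sub, h2, h2]
  ring

theorem IsTwisted.logNum {D : Fin n → Module.End ℂ (Localization.Away (braidF n))}
    (hD : IsTwisted (braidForm n) D) (a : Fin n) :
    algebraMap (BA n) (Localization.Away (braidF n)) (braidF n) * D a 1
      = algebraMap (BA n) _ (logNum n a) := by
  refine (hD.2 a).trans (congrArg _ ?_)
  refine Finset.sum_congr rfl fun q _ => ?_
  congr!

/-- The algebra `W` of the braid arrangement. -/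
noncomputable def braidWa (D : Fin n → Module.End ℂ (Localization.Away (braidF n))) :
    Subalgebra ℂ (Module.End ℂ (Localization.Away (braidF n))) :=
  Wa (braidForm n) D

theorem braidWa_eq (D : Fin n → Module.End ℂ (Localization.Away (braidF n))) :
    braidWa D = Algebra.adjoin ℂ
      ((Set.range fun i : Fin n => LinearMap.mulLeft ℂ
          (algebraMap (BA n) (Localization.Away (braidF n)) (X (Sum.inl i)))) ∪
        (Set.range fun j : BraidIdx n => LinearMap.mulLeft ℂ
          (algebraMap (BA n) (Localization.Away (braidF n)) (X (Sum.inr j)))) ∪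
        Set.range D) := rfl

theorem mulLeft_mem_braidWa (D : Fin n → Module.End ℂ (Localization.Away (braidF n))) (r : BA n) :
    LinearMap.mulLeft ℂ (algebraMap (BA n) (Localization.Away (braidF n)) r)
      ∈ braidWa D := by
  induction r using MvPolynomial.induction_on with
  | C c =>
    have h : LinearMap.mulLeft ℂ (algebraMap (BA n) (Localization.Away (braidF n)) (C c))
        = algebraMap ℂ (Module.End ℂ (Localization.Away (braidF n))) c := by
      ext m
      rw [LinearMap.mulLeft_apply, Module.algebraMap_end_apply, Algebra.smul_def,
        IsScalarTower.algebraMap_apply ℂ (BA n), algebraMap_eq]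
    rw [h]
    exact Subalgebra.algebraMap_mem _ c
  | add p q hp hq =>
    have h : LinearMap.mulLeft ℂ (algebraMap (BA n) (Localization.Away (braidF n)) (p + q))
        = LinearMap.mulLeft ℂ (algebraMap (BA n) (Localization.Away (braidF n)) p)
          + LinearMap.mulLeft ℂ (algebraMap (BA n) (Localization.Away (braidF n)) q) := by
      ext m
      simp [add_mul]
    rw [h]
    exact add_mem hp hq
  | mul_X p q hp =>
    rw [map_mul, LinearMap.mulLeft_mul]
    rw [braidWa_eq] at hp ⊢
    refine mul_mem hp (Algebra.subset_adjoin ?_)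
    rcases q with a | q
    · exact Or.inl (Or.inl ⟨a, rfl⟩)
    · exact Or.inl (Or.inr ⟨q, rfl⟩)

/-- The module generated by `F` over the algebra of twisted differential operators. -/
noncomputable def waSpan (D : Fin n → Module.End ℂ (Localization.Away (braidF n))) :
    Submodule (BA n) (Localization.Away (braidF n)) where
  carrier := {m | ∃ P ∈ braidWa D, m = P (algebraMap _ _ (braidF n))}
  zero_mem' := ⟨0, zero_mem _, rfl⟩
  add_mem' := by
    rintro _ _ ⟨P, hP, rfl⟩ ⟨Q, hQ, rfl⟩
    exact ⟨P + Q, add_mem hP hQ, rfl⟩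
  smul_mem' := by
    rintro c _ ⟨P, hP, rfl⟩
    exact ⟨_, mul_mem (mulLeft_mem_braidWa D c) hP, Algebra.smul_def _ _⟩

theorem IsTwisted.setting {D : Fin n → Module.End ℂ (Localization.Away (braidF n))}
    (hD : IsTwisted (braidForm n) D) :
    Setting (fun a => (D a).toAddMonoidHom) (waSpan D) where
  loc := inferInstance
  leib := hD.1
  one a := by
    have hu : IsUnit (algebraMap (BA n) (Localization.Away (braidF n)) (braidF n)) :=
      IsLocalization.Away.algebraMap_isUnit _
    exact hu.mul_left_cancel ((hD.logNum a).trans (algebraMap_braidF_mul_sum_uv hu a).symm)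
  memF := ⟨1, one_mem _, rfl⟩
  memD := by
    rintro a _ ⟨P, hP, rfl⟩
    exact ⟨D a * P, mul_mem (braidWa_eq D ▸ Algebra.subset_adjoin (Or.inr ⟨a, rfl⟩)) hP, rfl⟩
  min := by
    rintro E' hF hD' _ ⟨P, hP, rfl⟩
    suffices h : ∀ m ∈ E', P m ∈ E' from h _ hF
    rw [braidWa_eq] at hP
    induction hP using Algebra.adjoin_induction with
    | mem P hP =>
      rcases hP with (⟨a, rfl⟩ | ⟨q, rfl⟩) | ⟨a, rfl⟩
      · exact fun m hm => by
          simp only [LinearMap.mulLeft_apply]; rw [← Algebra.smul_def]; exact E'.smul_mem _ hm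
      · exact fun m hm => by
          simp only [LinearMap.mulLeft_apply]; rw [← Algebra.smul_def]; exact E'.smul_mem _ hm
      · exact hD' a
    | algebraMap c =>
      intro m hm
      rw [Module.algebraMap_end_apply, ← algebraMap_smul (BA n)]
      exact E'.smul_mem _ hm
    | add P Q _ _ hP hQ => exact fun m hm => E'.add_mem (hP m hm) (hQ m hm)
    | mul P Q _ _ hP hQ => exact fun m hm => hP _ (hQ m hm)

end

end Arrangement

open Arrangement in
/-- The Bernstein ideal of the braid arrangement is the principal ideal
generated by `braidGen n`. -/
theorem bernstein_ideal_braid_arrangement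
    (n : ℕ) (hn : 2 ≤ n)
    (D : Fin n → Module.End ℂ
      (Localization.Away
        (rename Sum.inl (∏ q : BraidIdx n, braidForm n q) :
          MvPolynomial (Fin n ⊕ BraidIdx n) ℂ)))
    (hD : IsTwisted (braidForm n) D) :
    Bideal (braidForm n) D = ↑(Ideal.span {braidGen n}) := by
  have hS := IsTwisted.setting hD
  ext b
  rw [SetLike.mem_coe, Ideal.mem_span_singleton]
  refine ⟨fun hb => hS.braidGen_dvd hn (IsTwisted.logNum hD) hb, ?_⟩
  rintro ⟨c, rfl⟩
  have h := (waSpan D).smul_mem (rho n c) (hS.braidGen_mem hn)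
  rw [Algebra.smul_def, ← map_mul, ← map_mul, mul_comm] at h
  exact h
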